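/- Fix an integer p and c with either p > 5 and c ∈ (0,1/2), or p = 5 and c ∈ (0,1/4), and let γ_n, β_n, α_n, θ_n, a_n, c_n, k_n(t) be as in the standing setup. Define ν_n^t(u,∞) = k_n(t)·𝒫(Σ_{j=1}^{θ_n} e^{β_n H_n(J_n(j))} e_{n,j} > c_n u^{β_n/γ_n} | H_n). Then ℙ-almost surely (with respect to the environment), for every u > 0 and every t > 0, lim_{n→∞} ν_n^t(u,∞) = 2p·t·u^{-1}. -/

import Mathlib

open MeasureTheory ProbabilityTheory Filter Real Finset

/-- Configuration space: the hypercube `Σ_n = {−1,1}^n`, encoded as `Fin n → Bool`,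
with the Hamming distance as graph distance. -/
abbrev V (n : ℕ) := Fin n → Bool

/-- Overlap `R_n(x,x') = 1 − 2·dist(x,x')/n`. -/
noncomputable def overlap (n : ℕ) (x y : V n) : ℝ := 1 - 2 * (hammingDist x y : ℝ) / n

/-- `γ_n = n^{-c}`. -/
noncomputable def γseq (c : ℝ) (n : ℕ) : ℝ := (n : ℝ) ^ (-c)

/-- Block length `θ_n = 3n²`. -/
def θseq (n : ℕ) : ℕ := 3 * n ^ 2

/-- Jump scale `a_n = √(2πn)·γ_n⁻¹·e^{γ_n²n/2}`. -/
noncomputable def aseq (c : ℝ) (n : ℕ) : ℝ :=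
  Real.sqrt (2 * π * n) * (γseq c n)⁻¹ * Real.exp ((γseq c n) ^ 2 * n / 2)

/-- Time scale `c_n = e^{γ_nβ_n n}`. -/
noncomputable def cseq (c : ℝ) (β : ℕ → ℝ) (n : ℕ) : ℝ := Real.exp (γseq c n * β n * n)

/-- `k_n(t) = ⌊⌊a_n t⌋/θ_n⌋`. -/
noncomputable def kseq (c : ℝ) (n : ℕ) (t : ℝ) : ℕ := ⌊aseq c n * t⌋₊ / θseq n

/-- `X` is a centered Gaussian random vector with covariance `Δ`: every linear combination
of its coordinates is a centered real Gaussian with the corresponding variance. -/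
def IsCenteredGaussianVector {Ω : Type*} [MeasurableSpace Ω] (P : Measure Ω)
    {I : Type*} [Fintype I] (X : I → Ω → ℝ) (Δ : I → I → ℝ) : Prop :=
  ∀ c : I → ℝ, Measure.map (fun ω => ∑ i, c i * X i ω) P =
    gaussianReal 0 (Real.toNNReal (∑ i, ∑ j, c i * c j * Δ i j))

/-- Joint law of the dynamics: `J n` is the simple random walk on `Σ_n` started from the
uniform distribution, `(e n j)` are i.i.d. mean-one exponentials, and the walk and the
exponentials are independent; all of this is encoded through the joint finite-dimensional
distributions. -/
def WalkExpLaw {Ω' : Type*} [MeasurableSpace Ω'] (Pw : Measure Ω')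
    (J : (n : ℕ) → ℕ → Ω' → V n) (e : ℕ → ℕ → Ω' → ℝ) : Prop :=
  ∀ (n m : ℕ) (xs : Fin (m + 1) → V n) (ys : Fin (m + 1) → ℝ), (∀ k, 0 ≤ ys k) →
    Pw {ω' | (∀ k : Fin (m + 1), J n k ω' = xs k) ∧ (∀ k : Fin (m + 1), ys k < e n k ω')} =
      ENNReal.ofReal (((2 : ℝ) ^ n)⁻¹ *
        ∏ k : Fin m, (if hammingDist (xs k.castSucc) (xs k.succ) = 1 then (n : ℝ)⁻¹ else 0)) *
      ENNReal.ofReal (Real.exp (-∑ k, ys k))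

/-- `ν_n^t(u,∞) = k_n(t)·𝒫(Σ_{j=1}^{θ_n} e^{β_n h(J_n(j))} e_{n,j} > c_n u^{β_n/γ_n})`,
for a fixed realization `h` of the environment. -/
noncomputable def nuSum {Ω' : Type*} [MeasurableSpace Ω'] (Pw : Measure Ω')
    (J : (n : ℕ) → ℕ → Ω' → V n) (e : ℕ → ℕ → Ω' → ℝ)
    (c : ℝ) (β : ℕ → ℝ) (n : ℕ) (t u : ℝ) (h : V n → ℝ) : ℝ :=
  (kseq c n t : ℝ) *
    (Pw {ω' | cseq c β n * u ^ (β n / γseq c n) <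
      ∑ j ∈ Icc 1 (θseq n), Real.exp (β n * h (J n j ω')) * e n j ω'}).toReal

-- part A1
/-! ### Centered Gaussian vectors -/

/-- Working notion of a centered Gaussian vector. -/
structure GV {Ω : Type*} [MeasurableSpace Ω] (P : Measure Ω) {I : Type*} [Fintype I]
    (X : I → Ω → ℝ) (Δ : I → I → ℝ) : Prop where
  meas : ∀ i, Measurable (X i)
  law : HasGaussianLaw (fun ω i => X i ω) P
  mean : ∀ i, ∫ ω, X i ω ∂P = 0
  cov : ∀ i j, cov[X i, X j; P] = Δ i j

namespace GV
variable {Ω : Type*} [MeasurableSpace Ω] {P : Measure Ω} {I : Type*} [Fintype I]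
    {X : I → Ω → ℝ} {Δ : I → I → ℝ}

lemma prob (h : GV P X Δ) : IsProbabilityMeasure P := h.law.isProbabilityMeasure

lemma memLp (h : GV P X Δ) (i : I) : MemLp (X i) 2 P := (h.law.eval i).memLp_two

lemma integrable (h : GV P X Δ) (i : I) : Integrable (X i) P := (h.law.eval i).integrable

lemma integral_mul (h : GV P X Δ) (i j : I) : ∫ ω, X i ω * X j ω ∂P = Δ i j := by
  have := h.prob
  rw [← h.cov, covariance_eq_sub (h.memLp i) (h.memLp j), h.mean, h.mean]
  simp

lemma lin (h : GV P X Δ) {K : Type*} [Fintype K] (A : K → I → ℝ) :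
    GV P (fun k ω => ∑ i, A k i * X i ω) (fun k l => ∑ i, ∑ j, A k i * A l j * Δ i j) := by
  have := h.prob
  refine ⟨fun k => ?_, ?_, fun k => ?_, fun k l => ?_⟩
  · have := h.meas
    fun_prop
  · let T : (I → ℝ) →L[ℝ] (K → ℝ) := ContinuousLinearMap.pi
      (fun k => ∑ i, A k i • ContinuousLinearMap.proj (R := ℝ) (φ := fun _ : I => ℝ) i)
    have hT := h.law.map_fun T
    have e : (fun ω k => ∑ i, A k i * X i ω) = fun ω => T (fun i => X i ω) := by
      ext ω k; simp [T]
    rw [e]; exact hT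
  · rw [integral_finsetSum _ (fun i _ => (h.integrable i).const_mul _)]
    simp [integral_const_mul, h.mean]
  · rw [covariance_fun_sum_fun_sum (fun i => (h.memLp i).const_mul _)
      (fun i => (h.memLp i).const_mul _)]
    simp only [covariance_const_mul_left, covariance_const_mul_right, h.cov]
    refine Finset.sum_congr rfl fun i _ => Finset.sum_congr rfl fun j _ => by ring

lemma comp (h : GV P X Δ) {K : Type*} [Fintype K] (f : K → I) :
    GV P (fun k => X (f k)) (fun k l => Δ (f k) (f l)) := by
  refine ⟨fun k => h.meas _, ?_, fun k => h.mean _, fun k l => h.cov _ _⟩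
  let T : (I → ℝ) →L[ℝ] (K → ℝ) := ContinuousLinearMap.pi
      (fun k => ContinuousLinearMap.proj (R := ℝ) (φ := fun _ : I => ℝ) (f k))
  have hT := h.law.map_fun T
  exact hT

lemma var_nonneg (h : GV P X Δ) (i : I) : 0 ≤ Δ i i := by
  rw [← h.integral_mul i i]
  exact integral_nonneg fun ω => mul_self_nonneg _

lemma map_eq (h : GV P X Δ) (i : I) : P.map (X i) = gaussianReal 0 (Δ i i).toNNReal := by
  have h1 := (h.law.eval i).map_eq_gaussianReal
  rw [h1, h.mean, ← covariance_self (h.meas i).aemeasurable, h.cov]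

lemma indep {K₁ K₂ : Type*} [Fintype K₁] [Fintype K₂] {Y : K₁ ⊕ K₂ → Ω → ℝ}
    {Γ : K₁ ⊕ K₂ → K₁ ⊕ K₂ → ℝ} (h : GV P Y Γ) (h0 : ∀ i j, Γ (Sum.inl i) (Sum.inr j) = 0) :
    IndepFun (fun ω i => Y (Sum.inl i) ω) (fun ω j => Y (Sum.inr j) ω) P := by
  refine HasGaussianLaw.indepFun_of_covariance_eval (X := fun i => Y (Sum.inl i))
    (Y := fun i => Y (Sum.inr i)) ?_ (fun i j => by rw [h.cov, h0])
  let T : (K₁ ⊕ K₂ → ℝ) →L[ℝ] (K₁ → ℝ) × (K₂ → ℝ) := ContinuousLinearMap.prod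
     (ContinuousLinearMap.pi
      (fun k => ContinuousLinearMap.proj (R := ℝ) (φ := fun _ : K₁ ⊕ K₂ => ℝ) (Sum.inl k)))
     (ContinuousLinearMap.pi
      (fun k => ContinuousLinearMap.proj (R := ℝ) (φ := fun _ : K₁ ⊕ K₂ => ℝ) (Sum.inr k)))
  have hT := h.law.map_fun T
  exact hT

lemma congr_cov {Δ' : I → I → ℝ} (h : GV P X Δ) (hD : ∀ i j, Δ i j = Δ' i j) : GV P X Δ' :=
  ⟨h.meas, h.law, h.mean, fun i j => by rw [h.cov, hD]⟩

lemma congr_fun {X' : I → Ω → ℝ} (h : GV P X Δ) (hD : ∀ i ω, X i ω = X' i ω) : GV P X' Δ := by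
  have : X = X' := by ext i ω; exact hD i ω
  exact this ▸ h

lemma prod (h : GV P X Δ) {Ω' : Type*} [MeasurableSpace Ω'] {Q : Measure Ω'} {K : Type*}
    [Fintype K] {Y : K → Ω' → ℝ} {Γ : K → K → ℝ} (h' : GV Q Y Γ) :
    GV (P.prod Q) (Sum.elim (fun i (z : Ω × Ω') => X i z.1) (fun k z => Y k z.2))
      (Sum.elim (fun i => Sum.elim (fun j => Δ i j) (fun _ => 0))
        (fun k => Sum.elim (fun _ => 0) (fun l => Γ k l))) := by
  have := h.prob
  have := h'.prob
  have mX := h.meas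
  have mY := h'.meas
  have e1 : (P.prod Q).map Prod.fst = P := by simp
  have e2 : (P.prod Q).map Prod.snd = Q := by simp
  have l1 : HasGaussianLaw (fun (z : Ω × Ω') i => X i z.1) (P.prod Q) := by
    refine ⟨?_⟩
    have : (P.prod Q).map (fun (z : Ω × Ω') i => X i z.1) = P.map (fun ω i => X i ω) := by
      conv_rhs => rw [← e1]
      rw [Measure.map_map (by fun_prop) (by fun_prop)]
      rfl
    rw [this]; exact h.law.isGaussian_map
  have l2 : HasGaussianLaw (fun (z : Ω × Ω') i => Y i z.2) (P.prod Q) := by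
    refine ⟨?_⟩
    have : (P.prod Q).map (fun (z : Ω × Ω') i => Y i z.2) = Q.map (fun ω i => Y i ω) := by
      conv_rhs => rw [← e2]
      rw [Measure.map_map (by fun_prop) (by fun_prop)]
      rfl
    rw [this]; exact h'.law.isGaussian_map
  have hind : IndepFun (fun (z : Ω × Ω') i => X i z.1) (fun (z : Ω × Ω') i => Y i z.2)
      (P.prod Q) := by
    exact indepFun_prod (X := fun ω i => X i ω) (Y := fun ω i => Y i ω) (by fun_prop) (by fun_prop)
  have l3 := hind.hasGaussianLaw l1 l2
  refine ⟨?_, ?_, ?_, ?_⟩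
  · rintro (i | k)
    · exact (mX i).comp measurable_fst
    · exact (mY k).comp measurable_snd
  · let T : (I → ℝ) × (K → ℝ) →L[ℝ] (I ⊕ K → ℝ) := ContinuousLinearMap.pi
      (Sum.elim (fun i => (ContinuousLinearMap.proj (R := ℝ) (φ := fun _ : I => ℝ) i).comp
          (ContinuousLinearMap.fst ℝ _ _))
        (fun i => (ContinuousLinearMap.proj (R := ℝ) (φ := fun _ : K => ℝ) i).comp
          (ContinuousLinearMap.snd ℝ _ _)))
    have hT := l3.map_fun T
    have e : (fun ω k => Sum.elim (fun i (z : Ω × Ω') => X i z.1) (fun k z => Y k z.2) k ω) =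
        fun ω => T (fun i => X i ω.1, fun i => Y i ω.2) := by
      ext ω k; cases k <;> simp [T]
    rw [e]; exact hT
  · rintro (i | k)
    · simp only [Sum.elim_inl]
      rw [integral_fun_fst (f := X i)]
      simp [h.mean]
    · simp only [Sum.elim_inr]
      rw [integral_fun_snd (f := Y k)]
      simp [h'.mean]
  · rintro (i | k) (j | l)
    · simp only [Sum.elim_inl]
      rw [← h.cov i j]
      conv_rhs => rw [← e1]
      rw [covariance_map_fun (by rw [e1]; exact (mX i).aestronglyMeasurable)
        (by rw [e1]; exact (mX j).aestronglyMeasurable) (by fun_prop)]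
    · simp only [Sum.elim_inl, Sum.elim_inr]
      exact covariance_fst_snd_prod (h.memLp i) (h'.memLp l)
    · simp only [Sum.elim_inl, Sum.elim_inr]
      rw [covariance_comm]
      exact covariance_fst_snd_prod (h.memLp j) (h'.memLp k)
    · simp only [Sum.elim_inr]
      rw [← h'.cov k l]
      conv_rhs => rw [← e2]
      rw [covariance_map_fun (by rw [e2]; exact (mY k).aestronglyMeasurable)
        (by rw [e2]; exact (mY l).aestronglyMeasurable) (by fun_prop)]

end GV

lemma exists_GV {I : Type} [Fintype I] [DecidableEq I] (S : Matrix I I ℝ) (hS : S.PosSemidef) :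
    GV (multivariateGaussian 0 S) (fun i (x : EuclideanSpace ℝ I) => x i) (fun i j => S i j) := by
  have hl : HasGaussianLaw (fun (x : EuclideanSpace ℝ I) i => x i) (multivariateGaussian 0 S) := by
    have := (IsGaussian.hasGaussianLaw_id (μ := multivariateGaussian 0 S)).map_equiv_fun
      (PiLp.continuousLinearEquiv 2 ℝ (fun _ : I => ℝ))
    exact this
  refine ⟨fun i => by fun_prop, hl, fun i => ?_, fun i j => ?_⟩
  · have h1 := (measurePreserving_eval_multivariateGaussian (μ := 0) hS (i := i))
    have h2 := integral_map (μ := multivariateGaussian 0 S) (φ := fun x : EuclideanSpace ℝ I => x i)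
      (f := fun y => y) (by fun_prop) (by fun_prop)
    rw [← h2, h1.map_eq]
    simp
  · exact covariance_eval_multivariateGaussian hS i j

lemma GV_of_isCentered {Ω : Type*} [MeasurableSpace Ω] {P : Measure Ω} [IsProbabilityMeasure P]
    {I : Type*} [Fintype I] {X : I → Ω → ℝ} {Δ : I → I → ℝ} (hm : ∀ i, Measurable (X i))
    (h : IsCenteredGaussianVector P X Δ) (hs : ∀ i j, Δ i j = Δ j i)
    (h1 : ∀ i j, 0 ≤ Δ i i + Δ j j + 2 * Δ i j)
    (h2 : ∀ i j, 0 ≤ Δ i i + Δ j j - 2 * Δ i j) : GV P X Δ := by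
  classical
  have hlaw : HasGaussianLaw (fun ω i => X i ω) P := by
    refine ⟨?_⟩
    refine isGaussian_of_isGaussian_map fun L => ?_
    have e : (P.map (fun ω i => X i ω)).map L = gaussianReal 0 (Real.toNNReal
        (∑ i, ∑ j, L (Pi.single i 1) * L (Pi.single j 1) * Δ i j)) := by
      rw [Measure.map_map (by fun_prop) (by fun_prop), ← h]
      congr 1
      ext ω
      simp only [Function.comp]
      have := L.toLinearMap.pi_apply_eq_sum_univ (fun i => X i ω)
      simp only [ContinuousLinearMap.coe_coe] at this
      rw [this]
      refine Finset.sum_congr rfl fun i _ => ?_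
      rw [smul_eq_mul, mul_comm]
      congr 2
      ext j
      simp [Pi.single_apply, eq_comm]
    rw [e]; infer_instance
  have key : ∀ c : I → ℝ, ∫ ω, (∑ i, c i * X i ω) ∂P = 0 ∧
      Var[fun ω => ∑ i, c i * X i ω; P] = max (∑ i, ∑ j, c i * c j * Δ i j) 0 := by
    intro c
    have hmm : Measurable (fun ω => ∑ i, c i * X i ω) := by fun_prop
    constructor
    · have := integral_map (μ := P) (φ := fun ω => ∑ i, c i * X i ω) (f := fun y => y)
        (by fun_prop) (by fun_prop)
      rw [← this, h c]; simp
    · have := variance_map (X := fun y : ℝ => y) (Y := fun ω => ∑ i, c i * X i ω) (μ := P)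
        (by fun_prop) (by fun_prop)
      have h3 : Var[fun ω => ∑ i, c i * X i ω; P] = Var[fun y : ℝ => y;
        P.map (fun ω => ∑ i, c i * X i ω)] := this.symm
      rw [h3, h c, variance_fun_id_gaussianReal]
      simp
  have m2 : ∀ i, MemLp (X i) 2 P := fun i => (hlaw.eval i).memLp_two
  refine ⟨hm, hlaw, fun i => ?_, fun i j => ?_⟩
  · have := (key (Pi.single i 1)).1
    simpa [Pi.single_apply] using this
  · have a1 := (key (Pi.single i 1 + Pi.single j 1)).2
    have a2 := (key (Pi.single i 1 - Pi.single j 1)).2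
    have b1 : (∑ k, ∑ l, (Pi.single i 1 + Pi.single j 1 : I → ℝ) k *
        (Pi.single i 1 + Pi.single j 1 : I → ℝ) l * Δ k l) = Δ i i + Δ j j + 2 * Δ i j := by
      simp [Pi.single_apply, add_mul, mul_add, Finset.sum_add_distrib, Finset.sum_ite_eq]
      rw [hs j i]; ring
    have b2 : (∑ k, ∑ l, (Pi.single i 1 - Pi.single j 1 : I → ℝ) k *
        (Pi.single i 1 - Pi.single j 1 : I → ℝ) l * Δ k l) = Δ i i + Δ j j - 2 * Δ i j := by
      simp [Pi.single_apply, sub_mul, mul_sub, Finset.sum_sub_distrib, Finset.sum_ite_eq]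
      rw [hs j i]; ring
    have c1 : (fun ω => ∑ k, (Pi.single i 1 + Pi.single j 1 : I → ℝ) k * X k ω) =
      (fun ω => X i ω + X j ω) := by
      ext ω; simp [Pi.single_apply, add_mul, Finset.sum_add_distrib]
    have c2 : (fun ω => ∑ k, (Pi.single i 1 - Pi.single j 1 : I → ℝ) k * X k ω) =
      (fun ω => X i ω - X j ω) := by
      ext ω; simp [Pi.single_apply, sub_mul, Finset.sum_sub_distrib]
    rw [b1, max_eq_left (h1 i j), c1] at a1
    rw [b2, max_eq_left (h2 i j), c2] at a2
    have d1 := variance_fun_add (m2 i) (m2 j)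
    have d2 := variance_fun_sub (m2 i) (m2 j)
    linarith

-- part A2
/-! ### Slepian -/

lemma GV.comb {Ω : Type*} [MeasurableSpace Ω] {P : Measure Ω} {I : Type*} [Fintype I]
    {X : I → Ω → ℝ} {Δ : I → I → ℝ} (h : GV P X Δ) {K : Type*} [Fintype K] (f g : K → I)
    (a b : K → ℝ) :
    GV P (fun k ω => a k * X (f k) ω + b k * X (g k) ω)
      (fun k l => a k * a l * Δ (f k) (f l) + a k * b l * Δ (f k) (g l) +
        b k * a l * Δ (g k) (f l) + b k * b l * Δ (g k) (g l)) := by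
  classical
  have := h.prob
  have hm := h.meas
  have m2 := h.memLp
  refine ⟨fun k => ?_, ?_, fun k => ?_, fun k l => ?_⟩
  · fun_prop
  · have := (h.lin (fun (k : K) i => a k * (if f k = i then 1 else 0) +
      b k * (if g k = i then 1 else 0))).law
    have e : (fun ω k => a k * X (f k) ω + b k * X (g k) ω) = fun ω k => ∑ i,
      (a k * (if f k = i then 1 else 0) + b k * (if g k = i then 1 else 0)) * X i ω := by
      ext ω k
      simp [add_mul, Finset.sum_add_distrib]
    rw [e]; exact this
  · rw [integral_add ((h.integrable _).const_mul _) ((h.integrable _).const_mul _)]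
    simp [integral_const_mul, h.mean]
  · have q1 := covariance_add_left ((m2 (f k)).const_mul (a k)) ((m2 (g k)).const_mul (b k))
      (((m2 (f l)).const_mul (a l)).add ((m2 (g l)).const_mul (b l)))
    have q2 := fun i (t : ℝ) => covariance_add_right ((m2 i).const_mul t)
      ((m2 (f l)).const_mul (a l)) ((m2 (g l)).const_mul (b l))
    rw [q2, q2] at q1
    simp only [covariance_const_mul_left, covariance_const_mul_right, h.cov] at q1
    refine Eq.trans q1 (by ring)

lemma corr_nonpos {Ω : Type*} [MeasurableSpace Ω] {ℛ : Measure Ω} {I : Type*} [Fintype I]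
    {W : Ω → ℝ} {Z : I → Ω → ℝ} {Γ : Unit ⊕ I → Unit ⊕ I → ℝ}
    (h : GV ℛ (Sum.elim (fun _ => W) Z) Γ) (G : (I → ℝ) → ℝ) (hGm : Measurable G) (K : ℝ)
    (hGb : ∀ z, |G z| ≤ K)
    (hG : ∀ z t, t * (G (fun j => z j + t * Γ (Sum.inl ()) (Sum.inr j)) - G z) ≤ 0) :
    ∫ ω, W ω * G (fun j => Z j ω) ∂ℛ ≤ 0 := by
  have := h.prob
  have hWm : Measurable W := h.meas (Sum.inl ())
  have hZm : ∀ i, Measurable (Z i) := fun i => h.meas (Sum.inr i)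
  have hWi : Integrable W ℛ := h.integrable (Sum.inl ())
  have hW2 : ∫ ω, W ω * W ω ∂ℛ = Γ (Sum.inl ()) (Sum.inl ()) :=
    h.integral_mul (Sum.inl ()) (Sum.inl ())
  have hW0 : ∫ ω, W ω ∂ℛ = 0 := h.mean (Sum.inl ())
  by_cases hs : Γ (Sum.inl ()) (Sum.inl ()) = 0
  · rw [hs] at hW2
    have h0 := (integral_eq_zero_iff_of_nonneg (fun ω => mul_self_nonneg (W ω))
      ((h.memLp (Sum.inl ())).integrable_mul (h.memLp (Sum.inl ())))).1 hW2
    have : ∫ ω, W ω * G (fun j => Z j ω) ∂ℛ = 0 := by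
      refine integral_eq_zero_of_ae ?_
      filter_upwards [h0] with ω hω
      have : W ω = 0 := by simpa using hω
      simp [this]
    exact this.le
  · set σ := Γ (Sum.inl ()) (Sum.inl ()) with hσ
    have hσ0 : 0 < σ := lt_of_le_of_ne (h.var_nonneg _) (Ne.symm hs)
    set c := fun j => Γ (Sum.inl ()) (Sum.inr j) with hc
    have hV := h.comb (K := Unit ⊕ I) (fun k => k) (fun _ => Sum.inl ()) (fun _ => 1)
      (Sum.elim (fun _ => 0) (fun j => -(c j / σ)))
    have hind := hV.indep (fun i j => by
      simp only [Sum.elim_inl, Sum.elim_inr, ← hσ]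
      have : Γ (Sum.inl ()) (Sum.inr j) = c j := rfl
      rw [this]
      field_simp
      ring)
    simp only [Sum.elim_inl, Sum.elim_inr, one_mul, zero_mul, add_zero] at hind
    have mu : Measurable (fun w : Unit → ℝ => w ()) := by fun_prop
    have hind2 := hind.comp (φ := fun w : Unit → ℝ => w ()) (ψ := G) mu hGm
    set V : Ω → I → ℝ := fun ω j => Z j ω + -(c j / σ) * W ω with hVdef
    have hVm : Measurable V := by fun_prop
    have e0 : ∫ ω, W ω * G (V ω) ∂ℛ = 0 := by
      have := hind2.integral_fun_mul_eq_mul_integral (by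
          exact hWm.aestronglyMeasurable) (by exact (hGm.comp hVm).aestronglyMeasurable)
      simp only [Function.comp] at this
      rw [hW0] at this
      simpa using this
    have i1 : Integrable (fun ω => W ω * G (V ω)) ℛ :=
      hWi.mul_bdd (c := K) (hGm.comp hVm).aestronglyMeasurable (ae_of_all _ fun ω => hGb _)
    have i2 : Integrable (fun ω => W ω * G (fun j => Z j ω)) ℛ :=
      hWi.mul_bdd (c := K) (hGm.comp (by fun_prop)).aestronglyMeasurable
        (ae_of_all _ fun ω => hGb _)
    rw [← e0]
    refine integral_mono i2 i1 fun ω => ?_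
    have := hG (V ω) (W ω / σ)
    have e1 : (fun j => V ω j + W ω / σ * Γ (Sum.inl ()) (Sum.inr j)) = fun j => Z j ω := by
      ext j
      simp only [hVdef, hc]
      ring
    rw [e1] at this
    have h3 : W ω / σ * (G (fun j => Z j ω) - G (V ω)) =
      (W ω * (G (fun j => Z j ω) - G (V ω))) / σ := by ring
    rw [h3, div_le_iff₀ hσ0] at this
    simp only
    linarith

lemma slepian_smooth {Ω Ω' : Type*} [MeasurableSpace Ω] [MeasurableSpace Ω'] {P : Measure Ω}
    {Q : Measure Ω'} {I : Type*} [Fintype I] {X : I → Ω → ℝ} {Y : I → Ω' → ℝ}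
    {Δ Δ' : I → I → ℝ} (hX : GV P X Δ) (hY : GV Q Y Δ') (hd : ∀ i, Δ i i = Δ' i i)
    (hle : ∀ i j, Δ' i j ≤ Δ i j) (φ φ' : ℝ → ℝ) (hφ : ∀ x, HasDerivAt φ (φ' x) x)
    (h0 : ∀ x, 0 ≤ φ x) (h1 : ∀ x, φ x ≤ 1) (hanti : Antitone φ) (hφ'm : Measurable φ')
    (K : ℝ) (hK : ∀ x, |φ' x| ≤ K) :
    ∫ ω, ∏ i, φ (Y i ω) ∂Q ≤ ∫ ω, ∏ i, φ (X i ω) ∂P := by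
  classical
  have := hX.prob
  have := hY.prob
  have hφ'0 : ∀ x, φ' x ≤ 0 := fun x => by
    have := hanti.deriv_nonpos (x := x)
    rw [(hφ x).deriv] at this
    exact this
  have hφc : Continuous φ := continuous_iff_continuousAt.2 fun x => (hφ x).continuousAt
  have hφm : Measurable φ := hφc.measurable
  have hXY := hX.prod hY
  set ℛ := P.prod Q with hR
  have mX := hX.meas
  have mY := hY.meas
  have habs : ∀ x, |φ x| ≤ 1 := fun x => by rw [abs_of_nonneg (h0 x)]; exact h1 x
  let Z : ℝ → I → Ω × Ω' → ℝ := fun s i z => Real.cos s * X i z.1 + Real.sin s * Y i z.2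
  let W : ℝ → I → Ω × Ω' → ℝ := fun s i z => -Real.sin s * X i z.1 + Real.cos s * Y i z.2
  have hZm : ∀ s i, Measurable (Z s i) := fun s i => by fun_prop
  have hWm : ∀ s i, Measurable (W s i) := fun s i => by fun_prop
  let G : I → (I → ℝ) → ℝ := fun i z => (∏ j ∈ univ.erase i, φ (z j)) * φ' (z i)
  have hGm : ∀ i, Measurable (G i) := fun i => by fun_prop
  have hGb : ∀ i z, |G i z| ≤ K := fun i z => by
    simp only [G, abs_mul, Finset.abs_prod]
    calc _ ≤ 1 * K := mul_le_mul (Finset.prod_le_one (fun _ _ => abs_nonneg _) fun _ _ => habs _)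
            (hK _) (abs_nonneg _) zero_le_one
      _ = K := one_mul _
  have hK0 : 0 ≤ K := (abs_nonneg _).trans (hK 0)
  let F : ℝ → Ω × Ω' → ℝ := fun s z => ∏ i, φ (Z s i z)
  let F' : ℝ → Ω × Ω' → ℝ := fun s z => ∑ i, W s i z * G i (fun j => Z s j z)
  have hder : ∀ s z, HasDerivAt (fun s => F s z) (F' s z) s := by
    intro s z
    have hz : ∀ i ∈ (univ : Finset I), HasDerivAt (fun s => φ (Z s i z))
        (φ' (Z s i z) * W s i z) s := by
      intro i _
      refine (hφ (Z s i z)).comp s ?_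
      exact ((Real.hasDerivAt_cos s).mul_const _).add ((Real.hasDerivAt_sin s).mul_const _)
    have := HasDerivAt.fun_finsetProd hz
    refine this.congr_deriv ?_
    refine Finset.sum_congr rfl fun i _ => ?_
    simp only [smul_eq_mul, G]
    ring
  have iX : ∀ i, Integrable (fun z : Ω × Ω' => X i z.1) ℛ := fun i => hXY.integrable (Sum.inl i)
  have iY : ∀ i, Integrable (fun z : Ω × Ω' => Y i z.2) ℛ := fun i => hXY.integrable (Sum.inr i)
  have hWb : ∀ s i z, |W s i z| ≤ |X i z.1| + |Y i z.2| := fun s i z => by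
    refine (abs_add_le _ _).trans ?_
    rw [abs_mul, abs_mul, abs_neg]
    have := Real.abs_sin_le_one s
    have := Real.abs_cos_le_one s
    have := abs_nonneg (X i z.1)
    have := abs_nonneg (Y i z.2)
    nlinarith
  have hFb : ∀ s z, |F s z| ≤ 1 := fun s z => by
    simp only [F, Finset.abs_prod]
    exact Finset.prod_le_one (fun _ _ => abs_nonneg _) fun _ _ => habs _
  have hFm : ∀ s, Measurable (F s) := fun s => by fun_prop
  have hF'm : ∀ s, Measurable (F' s) := fun s => by fun_prop
  have hmain : ∀ s, HasDerivAt (fun s => ∫ z, F s z ∂ℛ) (∫ z, F' s z ∂ℛ) s := by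
    intro s
    refine (hasDerivAt_integral_of_dominated_loc_of_deriv_le (F := F) (F' := F') (s := Set.univ)
      (bound := fun z => ∑ i, (|X i z.1| + |Y i z.2|) * K) Filter.univ_mem ?_ ?_ ?_ ?_ ?_ ?_).2
    · exact Eventually.of_forall fun s => (hFm s).aestronglyMeasurable
    · exact Integrable.of_bound (hFm s).aestronglyMeasurable 1 (ae_of_all _ fun z => hFb s z)
    · exact (hF'm s).aestronglyMeasurable
    · refine ae_of_all _ fun z s _ => ?_
      refine (norm_sum_le _ _).trans (Finset.sum_le_sum fun i _ => ?_)
      rw [Real.norm_eq_abs, abs_mul]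
      exact mul_le_mul (hWb _ _ _) (hGb _ _) (abs_nonneg _) (by positivity)
    · exact integrable_finsetSum _ fun i _ => ((iX i).abs.add (iY i).abs).mul_const K
    · exact ae_of_all _ fun z s _ => hder s z
  have hneg : ∀ s ∈ Set.Icc 0 (π / 2), ∫ z, F' s z ∂ℛ ≤ 0 := by
    intro s hs
    have hsin : 0 ≤ Real.sin s := Real.sin_nonneg_of_nonneg_of_le_pi hs.1 (by linarith [hs.2, pi_pos])
    have hcos : 0 ≤ Real.cos s := Real.cos_nonneg_of_mem_Icc ⟨by linarith [hs.1, pi_pos], hs.2⟩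
    simp only [F']
    have iW : ∀ i, Integrable (W s i) ℛ := fun i => ((iX i).const_mul _).add ((iY i).const_mul _)
    have iWG : ∀ i ∈ (univ : Finset I),
        Integrable (fun z => W s i z * G i (fun j => Z s j z)) ℛ := fun i _ =>
      (iW i).mul_bdd (c := K) ((hGm i).comp (measurable_pi_lambda _ (hZm s))).aestronglyMeasurable
        (ae_of_all _ fun ω => hGb _ _)
    rw [integral_finsetSum _ iWG]
    refine Finset.sum_nonpos fun i _ => ?_
    have hWZ := hXY.comb (K := Unit ⊕ I) (Sum.elim (fun _ => Sum.inl i) (fun j => Sum.inl j))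
      (Sum.elim (fun _ => Sum.inr i) (fun j => Sum.inr j))
      (Sum.elim (fun _ => -Real.sin s) (fun j => Real.cos s))
      (Sum.elim (fun _ => Real.cos s) (fun j => Real.sin s))
    have hWZ2 := hWZ.congr_fun (X' := Sum.elim (fun _ => W s i) (Z s)) (by
      rintro (_ | j) ω <;> simp [W, Z])
    refine corr_nonpos hWZ2 (G i) (hGm i) K (hGb i) ?_
    intro z t
    simp only [Sum.elim_inl, Sum.elim_inr]
    have hcj : ∀ j, -sin s * cos s * Δ i j + -sin s * sin s * 0 + cos s * cos s * 0 +
      cos s * sin s * Δ' i j = - (sin s * cos s * (Δ i j - Δ' i j)) := fun j => by ring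
    simp only [hcj]
    have hmono : ∀ x d : ℝ, 0 ≤ d → ∀ t, (0 ≤ t → φ x ≤ φ (x + t * (-d))) ∧
        (t ≤ 0 → φ (x + t * (-d)) ≤ φ x) := fun x d hd t =>
      ⟨fun ht => hanti (by nlinarith), fun ht => hanti (by nlinarith)⟩
    have hdj : ∀ j, 0 ≤ sin s * cos s * (Δ i j - Δ' i j) := fun j =>
      mul_nonneg (mul_nonneg hsin hcos) (by linarith [hle i j])
    simp only [G, hd i, sub_self, mul_zero, neg_zero, add_zero]
    rw [← sub_mul]
    rcases le_total 0 t with ht | ht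
    · refine mul_nonpos_of_nonneg_of_nonpos ht (mul_nonpos_of_nonneg_of_nonpos ?_ (hφ'0 _))
      rw [sub_nonneg]
      exact Finset.prod_le_prod (fun _ _ => h0 _) fun j _ => (hmono _ _ (hdj j) t).1 ht
    · refine mul_nonpos_of_nonpos_of_nonneg ht (mul_nonneg_of_nonpos_of_nonpos ?_ (hφ'0 _))
      rw [sub_nonpos]
      exact Finset.prod_le_prod (fun _ _ => h0 _) fun j _ => (hmono _ _ (hdj j) t).2 ht
  have hant : AntitoneOn (fun s => ∫ z, F s z ∂ℛ) (Set.Icc 0 (π / 2)) := by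
    refine antitoneOn_of_deriv_nonpos (convex_Icc _ _)
      (fun s _ => (hmain s).continuousAt.continuousWithinAt)
      (fun s _ => (hmain s).differentiableAt.differentiableWithinAt) fun s hs => ?_
    rw [(hmain s).deriv]
    exact hneg s (interior_subset hs)
  have hfin := hant (a := 0) (b := π / 2) ⟨le_rfl, by positivity⟩ ⟨by positivity, le_rfl⟩
    (by positivity)
  simp only [F, Z, Real.cos_pi_div_two, Real.sin_pi_div_two, Real.cos_zero, Real.sin_zero,
    zero_mul, one_mul, zero_add, add_zero] at hfin
  rw [hR, integral_fun_snd (f := fun ω => ∏ i, φ (Y i ω)),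
    integral_fun_fst (f := fun ω => ∏ i, φ (X i ω))] at hfin
  simpa using hfin

/-- smooth step -/
lemma exists_step : ∃ (T T' : ℝ → ℝ) (K : ℝ), (∀ x, HasDerivAt T (T' x) x) ∧ Continuous T' ∧
    (∀ x, |T' x| ≤ K) ∧ (∀ x, 0 ≤ T x) ∧ (∀ x, T x ≤ 1) ∧ Monotone T ∧ (∀ x ≤ 0, T x = 0) ∧
    (∀ x, 1 ≤ x → T x = 1) ∧ (∀ x < 0, T' x = 0) := by
  have hcd := Real.smoothTransition.contDiff (n := 1)
  have hd : ∀ x, HasDerivAt smoothTransition (deriv smoothTransition x) x := fun x =>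
    (hcd.differentiable (by simp)).differentiableAt.hasDerivAt
  have hc : Continuous (deriv smoothTransition) := hcd.continuous_deriv (by simp)
  have hneg : ∀ x < 0, deriv smoothTransition x = 0 := fun x hx => by
    have : smoothTransition =ᶠ[nhds x] fun _ => 0 := by
      filter_upwards [gt_mem_nhds hx] with y hy using smoothTransition.zero_of_nonpos hy.le
    rw [this.deriv_eq]; simp
  have hpos : ∀ x > 1, deriv smoothTransition x = 0 := fun x hx => by
    have : smoothTransition =ᶠ[nhds x] fun _ => 1 := by
      filter_upwards [lt_mem_nhds hx] with y hy using smoothTransition.one_of_one_le (le_of_lt hy)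
    rw [this.deriv_eq]; simp
  obtain ⟨K, hK⟩ := (isCompact_Icc (a := (0 : ℝ)) (b := 1)).exists_bound_of_continuousOn
    hc.continuousOn
  have hK0 : 0 ≤ K := (norm_nonneg _).trans (hK 0 ⟨le_rfl, zero_le_one⟩)
  refine ⟨smoothTransition, deriv smoothTransition, K, hd, hc, fun x => ?_,
    smoothTransition.nonneg, smoothTransition.le_one, smoothTransition.monotone,
    fun x hx => smoothTransition.zero_of_nonpos hx,
    fun x hx => smoothTransition.one_of_one_le hx, hneg⟩
  rcases lt_or_ge x 0 with h | h
  · rw [hneg x h]; simpa using hK0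
  rcases lt_or_ge 1 x with h' | h'
  · rw [hpos x h']; simpa using hK0
  · exact hK x ⟨h, h'⟩

lemma tendsto_step {Ω : Type*} [MeasurableSpace Ω] {P : Measure Ω} [IsProbabilityMeasure P]
    {I : Type*} [Fintype I] {X : I → Ω → ℝ} (hm : ∀ i, Measurable (X i)) (L : ℝ) (T : ℝ → ℝ)
    (hT : Continuous T) (h0 : ∀ x, 0 ≤ T x) (h1 : ∀ x, T x ≤ 1) (hz : ∀ x ≤ 0, T x = 0)
    (ho : ∀ x, 1 ≤ x → T x = 1) :
    Tendsto (fun k : ℕ => ∫ ω, ∏ i, (1 - T (k * (X i ω - L))) ∂P) atTop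
      (nhds (1 - P.real {ω | ∃ i, L < X i ω})) := by
  have hms : MeasurableSet {ω | ∃ i, L < X i ω} := by
    rw [Set.ofPred_exists]
    exact MeasurableSet.iUnion fun i => measurableSet_lt measurable_const (hm i)
  have e : 1 - P.real {ω | ∃ i, L < X i ω} =
      ∫ ω, {ω | ∃ i, L < X i ω}ᶜ.indicator (fun _ => (1 : ℝ)) ω ∂P := by
    rw [integral_indicator_const _ hms.compl, probReal_compl_eq_one_sub hms]; simp
  rw [e]
  have hTm := hT.measurable
  refine tendsto_integral_of_dominated_convergence (fun _ => 1) (fun k => ?_) (by simp)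
    (fun k => ae_of_all _ fun ω => ?_) (ae_of_all _ fun ω => ?_)
  · exact Measurable.aestronglyMeasurable (by fun_prop)
  · rw [Real.norm_eq_abs, Finset.abs_prod]
    refine Finset.prod_le_one (fun _ _ => abs_nonneg _) fun i _ => ?_
    rw [abs_le]; constructor <;> linarith [h0 (k * (X i ω - L)), h1 (k * (X i ω - L))]
  · by_cases hω : ∃ i, L < X i ω
    · rw [Set.indicator_of_notMem (by simpa using hω)]
      obtain ⟨i, hi⟩ := hω
      obtain ⟨N, hN⟩ := exists_nat_gt (1 / (X i ω - L))
      refine tendsto_const_nhds.congr' ?_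
      filter_upwards [eventually_ge_atTop N] with k hk
      have : (1:ℝ) ≤ k * (X i ω - L) := by
        have h2 : (N : ℝ) ≤ k := by exact_mod_cast hk
        have h3 : 0 < X i ω - L := by linarith
        have := (div_lt_iff₀ h3).1 hN
        nlinarith
      exact (Finset.prod_eq_zero (Finset.mem_univ i) (by rw [ho _ this]; simp)).symm
    · rw [Set.indicator_of_mem (by simpa using hω)]
      refine tendsto_const_nhds.congr fun k => ?_
      push Not at hω
      refine (Finset.prod_eq_one fun i _ => ?_).symm
      rw [hz _ (mul_nonpos_of_nonneg_of_nonpos (by positivity) (by linarith [hω i]))]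
      simp

theorem slepian {Ω Ω' : Type*} [MeasurableSpace Ω] [MeasurableSpace Ω'] {P : Measure Ω}
    {Q : Measure Ω'} {I : Type*} [Fintype I] {X : I → Ω → ℝ} {Y : I → Ω' → ℝ}
    {Δ Δ' : I → I → ℝ} (hX : GV P X Δ) (hY : GV Q Y Δ') (hd : ∀ i, Δ i i = Δ' i i)
    (hle : ∀ i j, Δ' i j ≤ Δ i j) (L : ℝ) :
    P.real {ω | ∃ i, L < X i ω} ≤ Q.real {ω | ∃ i, L < Y i ω} := by
  have := hX.prob
  have := hY.prob
  obtain ⟨T, T', K, hT, hT'c, hK, h0, h1, hmono, hz, ho, -⟩ := exists_step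
  have hTc : Continuous T := continuous_iff_continuousAt.2 fun x => (hT x).continuousAt
  have a1 := tendsto_step (P := P) hX.meas L T hTc h0 h1 hz ho
  have a2 := tendsto_step (P := Q) hY.meas L T hTc h0 h1 hz ho
  have := le_of_tendsto_of_tendsto' a2 a1 fun k => by
    refine slepian_smooth hX hY hd hle (fun x => 1 - T (k * (x - L)))
      (fun x => -(T' (k * (x - L)) * k)) (fun x => ?_) (fun x => by linarith [h1 (k * (x - L))])
      (fun x => by linarith [h0 (k * (x - L))]) (fun x y hxy => ?_) (by
        have := hT'c.measurable; fun_prop) (K * k) (fun x => ?_)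
    · have h2 : HasDerivAt (fun x : ℝ => (k : ℝ) * (x - L)) k x := by
        simpa using ((hasDerivAt_id x).sub_const L).const_mul (k : ℝ)
      exact ((hT (k * (x - L))).comp x h2).const_sub 1
    · have : (k : ℝ) * (x - L) ≤ k * (y - L) :=
        mul_le_mul_of_nonneg_left (by linarith) (by positivity)
      have := hmono this
      simp only
      linarith
    · rw [abs_neg, abs_mul, Nat.abs_cast]
      exact mul_le_mul_of_nonneg_right (hK _) (by positivity)
  linarith

-- part A3
/-! ### Poincare -/

lemma sq_intervalIntegral_le (g : ℝ → ℝ) (hg : Continuous g) :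
    (∫ s in (0:ℝ)..(π / 2), g s) ^ 2 ≤ (π / 2) * ∫ s in (0:ℝ)..(π / 2), g s ^ 2 := by
  set A := ∫ s in (0:ℝ)..(π / 2), g s with hA
  set m := A / (π / 2) with hm
  have hpi := pi_pos
  have h0 : 0 ≤ ∫ s in (0:ℝ)..(π / 2), (g s - m) ^ 2 :=
    intervalIntegral.integral_nonneg (by positivity) fun s _ => sq_nonneg _
  have e : ∫ s in (0:ℝ)..(π / 2), (g s - m) ^ 2 =
      (∫ s in (0:ℝ)..(π / 2), g s ^ 2) - 2 * m * A + m ^ 2 * (π / 2) := by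
    have : (fun s => (g s - m) ^ 2) = fun s => (g s ^ 2 - 2 * m * g s) + m ^ 2 := by
      ext s; ring
    rw [this, intervalIntegral.integral_add, intervalIntegral.integral_sub,
      intervalIntegral.integral_const_mul, ← hA]
    · simp; ring
    all_goals exact Continuous.intervalIntegrable (by fun_prop) _ _
  rw [e] at h0
  have h2 : m * (π / 2) = A := by rw [hm]; field_simp
  nlinarith

set_option maxHeartbeats 1000000 in
theorem gaussian_poincare {Ω : Type*} [MeasurableSpace Ω] {P : Measure Ω} {I : Type*} [Fintype I]
    {X : I → Ω → ℝ} {Δ : I → I → ℝ} (hX : GV P X Δ) (f : (I → ℝ) → ℝ) (b : I → (I → ℝ) → ℝ)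
    (K : ℝ) (hfb : ∀ h, |f h| ≤ K) (hbc : ∀ i, Continuous (b i)) (hbb : ∀ i h, |b i h| ≤ K)
    (hd : ∀ h, HasFDerivAt f (∑ i, b i h •
      ContinuousLinearMap.proj (R := ℝ) (φ := fun _ : I => ℝ) i) h) :
    Var[fun ω => f (fun i => X i ω); P] ≤
      π ^ 2 / 8 * ∫ ω, ∑ i, ∑ j, Δ i j * (b i (fun k => X k ω) * b j (fun k => X k ω)) ∂P := by
  classical
  have := hX.prob
  have mX := hX.meas
  set μ := P.map (fun ω i => X i ω) with hμ
  have mXv : Measurable (fun ω i => X i ω) := by fun_prop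
  have hG : IsGaussian μ := hX.law.isGaussian_map
  have hfc : Continuous f := continuous_iff_continuousAt.2 fun h => (hd h).continuousAt
  have hmean : μ[id] = 0 := by
    ext i
    have h1 : Integrable (fun x : I → ℝ => x) μ := IsGaussian.integrable_id
    have := (ContinuousLinearMap.proj (R := ℝ) (φ := fun _ : I => ℝ) i).integral_comp_comm h1
    simp only [ContinuousLinearMap.proj_apply] at this
    simp only [id, Pi.zero_apply]
    rw [← this, hμ, integral_map (by fun_prop) (Continuous.aestronglyMeasurable (by fun_prop))]
    exact hX.mean i
  have hrot := fun θ => IsGaussian.map_rotation_eq_self hmean θ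
  have i2 : ∀ i, Integrable (fun x : I → ℝ => x i ^ 2) μ := by
    intro i
    rw [hμ, integrable_map_measure (Continuous.aestronglyMeasurable (by fun_prop)) (by fun_prop)]
    exact (hX.memLp i).integrable_sq
  have i11 : ∀ i j, Integrable (fun x : I → ℝ => x i * x j) μ := by
    intro i j
    rw [hμ, integrable_map_measure (Continuous.aestronglyMeasurable (by fun_prop)) (by fun_prop)]
    exact (hX.memLp i).integrable_mul (hX.memLp j)
  have m11 : ∀ i j, ∫ x : I → ℝ, x i * x j ∂μ = Δ i j := by
    intro i j
    rw [hμ, integral_map (by fun_prop) (Continuous.aestronglyMeasurable (by fun_prop))]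
    exact hX.integral_mul i j
  have ifb : ∀ {g : (I → ℝ) → ℝ}, Continuous g → (C : ℝ) → (∀ x, |g x| ≤ C) → Integrable g μ :=
    fun hg C hC => Integrable.of_bound hg.aestronglyMeasurable C (ae_of_all _ hC)
  have ibb : ∀ i j, Integrable (fun x => b i x * b j x) μ := fun i j =>
    ifb (by fun_prop) (K * K) fun x => by
      rw [abs_mul]; exact mul_le_mul (hbb i x) (hbb j x) (abs_nonneg _)
        ((abs_nonneg _).trans (hbb i x))
  let g : (I → ℝ) × (I → ℝ) → ℝ := fun z => (∑ i, b i z.1 * z.2 i) ^ 2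
  have hgc : Continuous g := by fun_prop
  have hgint : ∫ z, g z ∂(μ.prod μ) = ∫ x, ∑ i, ∑ j, Δ i j * (b i x * b j x) ∂μ := by
    have e : ∀ z, g z = ∑ i, ∑ j, (b i z.1 * b j z.1) * (z.2 i * z.2 j) := by
      intro z
      simp only [g, sq, Finset.sum_mul_sum]
      refine Finset.sum_congr rfl fun i _ => Finset.sum_congr rfl fun j _ => by ring
    simp only [e]
    rw [integral_finsetSum _ fun i _ => integrable_finsetSum _ fun j _ =>
      (ibb i j).mul_prod (i11 i j), integral_finsetSum _ fun i _ => integrable_finsetSum _ fun j _ =>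
      (ibb i j).const_mul _]
    refine Finset.sum_congr rfl fun i _ => ?_
    rw [integral_finsetSum _ fun j _ =>
      (ibb i j).mul_prod (i11 i j), integral_finsetSum _ fun j _ =>
      (ibb i j).const_mul _]
    refine Finset.sum_congr rfl fun j _ => ?_
    rw [integral_prod_mul (fun x => b i x * b j x) (fun x : I → ℝ => x i * x j), m11, integral_const_mul]
    ring
  -- pointwise bound
  let Z : ℝ → (I → ℝ) × (I → ℝ) → (I → ℝ) × (I → ℝ) := fun s z =>
    (Real.cos s • z.1 + Real.sin s • z.2, - Real.sin s • z.1 + Real.cos s • z.2)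
  have hZ : ∀ s z, Z s z = (Real.cos s • z.1 + Real.sin s • z.2,
      - Real.sin s • z.1 + Real.cos s • z.2) := fun s z => rfl
  have hZc : Continuous (fun q : ℝ × ((I → ℝ) × (I → ℝ)) => Z q.1 q.2) := by
    simp only [hZ]; fun_prop
  have hpt : ∀ z : (I → ℝ) × (I → ℝ), (f z.1 - f z.2) ^ 2 ≤
      (π / 2) * ∫ s in (0:ℝ)..(π / 2), g (Z s z) := by
    intro z
    let q : ℝ → ℝ := fun s => ∑ i, b i (Z s z).1 * (Z s z).2 i
    have hZc' : Continuous (fun s => Z s z) := hZc.comp (by fun_prop : Continuous fun s => (s, z))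
    have hq : Continuous q := by fun_prop
    have hder : ∀ s, HasDerivAt (fun s => f (Z s z).1) (q s) s := by
      intro s
      have h1 : HasDerivAt (fun s => (Z s z).1) (Z s z).2 s := by
        simp only [hZ]
        exact ((Real.hasDerivAt_cos s).smul_const _).add ((Real.hasDerivAt_sin s).smul_const _)
      have := (hd (Z s z).1).comp_hasDerivAt s h1
      refine this.congr_deriv ?_
      simp [q]
    have hintg := intervalIntegral.integral_eq_sub_of_hasDerivAt (a := 0) (b := π / 2)
      (fun s _ => hder s) (hq.intervalIntegrable _ _)
    have := sq_intervalIntegral_le q hq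
    rw [hintg] at this
    simp only [hZ] at this
    simp only [Real.cos_pi_div_two, Real.sin_pi_div_two, Real.cos_zero, Real.sin_zero,
      zero_smul, one_smul, zero_add, add_zero] at this
    rw [show (f z.1 - f z.2) ^ 2 = (f z.2 - f z.1) ^ 2 by ring]
    exact this
  let B : (I → ℝ) × (I → ℝ) → ℝ := fun z => (K ^ 2 * Fintype.card I) *
    ∑ i, (2 * (z.1 i ^ 2 + z.2 i ^ 2))
  have hB : ∀ s z, |g (Z s z)| ≤ B z := by
    intro s z
    have h1 : |g (Z s z)| = g (Z s z) := abs_of_nonneg (sq_nonneg _)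
    rw [h1]
    have h3 : ∀ i, (Z s z).2 i = - Real.sin s * z.1 i + Real.cos s * z.2 i := fun i => rfl
    generalize Z s z = y at h3
    have h2 := Finset.sum_mul_sq_le_sq_mul_sq univ (fun i => b i y.1) (fun i => y.2 i)
    simp only [g, B]
    refine h2.trans ?_
    refine mul_le_mul ?_ ?_ (Finset.sum_nonneg fun i _ => sq_nonneg _) (by positivity)
    · refine (Finset.sum_le_card_nsmul _ _ (K ^ 2) fun i _ => ?_).trans ?_
      · rw [← sq_abs]; exact pow_le_pow_left₀ (abs_nonneg _) (hbb _ _) 2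
      · simp [mul_comm]
    · refine Finset.sum_le_sum fun i _ => ?_
      rw [h3]
      have hs1 : Real.sin s ^ 2 ≤ 1 := Real.sin_sq_le_one s
      have hs2 : Real.cos s ^ 2 ≤ 1 := Real.cos_sq_le_one s
      have := mul_le_mul_of_nonneg_right hs1 (sq_nonneg (z.1 i))
      have := mul_le_mul_of_nonneg_right hs2 (sq_nonneg (z.2 i))
      nlinarith [sq_nonneg (Real.sin s * z.1 i + Real.cos s * z.2 i)]
  have hBi : Integrable B (μ.prod μ) := by
    refine (integrable_finsetSum _ fun i _ => ?_).const_mul _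
    refine Integrable.const_mul ?_ 2
    exact ((i2 i).comp_fst μ).add ((i2 i).comp_snd μ)
  have hgi : ∀ s, Integrable (fun z => g (Z s z)) (μ.prod μ) := fun s =>
    hBi.mono' (by
      have : Continuous (fun z => g (Z s z)) :=
        hgc.comp (hZc.comp (by fun_prop : Continuous fun z => (s, z)))
      exact this.aestronglyMeasurable) (ae_of_all _ fun z => hB s z)
  have hgrot : ∀ s, ∫ z, g (Z s z) ∂(μ.prod μ) = ∫ z, g z ∂(μ.prod μ) := by
    intro s
    conv_rhs => rw [← hrot s]
    rw [integral_map (by fun_prop) hgc.aestronglyMeasurable]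
    rfl
  have hfin0 : IsFiniteMeasure (volume.restrict (Set.uIoc 0 (π / 2))) := by
    rw [Set.uIoc_of_le (by positivity)]; infer_instance
  have hunc : Integrable (Function.uncurry fun s z => g (Z s z))
      ((volume.restrict (Set.uIoc 0 (π / 2))).prod (μ.prod μ)) := by
    have hB' : Integrable (fun q : ℝ × ((I → ℝ) × (I → ℝ)) => B q.2)
      ((volume.restrict (Set.uIoc 0 (π / 2))).prod (μ.prod μ)) := hBi.comp_snd _
    refine hB'.mono' ?_ (ae_of_all _ fun q => hB q.1 q.2)
    exact (hgc.comp hZc).aestronglyMeasurable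
  have hsw := intervalIntegral_integral_swap hunc
  simp only [hgrot] at hsw
  have hI2 : Integrable (fun z => ∫ s in (0:ℝ)..(π / 2), g (Z s z)) (μ.prod μ) := by
    have := hunc.integral_prod_right
    simp only [Function.uncurry] at this
    refine this.congr (ae_of_all _ fun z => ?_)
    simp only
    rw [intervalIntegral.integral_of_le (by positivity), Set.uIoc_of_le (by positivity)]
  have iff : Integrable (fun x => f x * f x) μ := ifb (by fun_prop) (K * K) fun x => by
      rw [abs_mul]; exact mul_le_mul (hfb x) (hfb x) (abs_nonneg _)
        ((abs_nonneg _).trans (hfb x))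
  have if1 : Integrable f μ := ifb hfc K hfb
  have hfd : Integrable (fun z : (I → ℝ) × (I → ℝ) => (f z.1 - f z.2) ^ 2) (μ.prod μ) := by
    refine Integrable.of_bound (Continuous.aestronglyMeasurable (by fun_prop)) ((2 * K) ^ 2)
      (ae_of_all _ fun z => ?_)
    rw [Real.norm_eq_abs, abs_pow]
    refine pow_le_pow_left₀ (abs_nonneg _) ((abs_sub _ _).trans ?_) 2
    linarith [hfb z.1, hfb z.2]
  have hle := integral_mono hfd (hI2.const_mul (π / 2)) hpt
  rw [integral_const_mul, ← hsw] at hle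
  have hvar : ∫ z, (f z.1 - f z.2) ^ 2 ∂(μ.prod μ) =
      2 * Var[fun ω => f (fun i => X i ω); P] := by
    have e : ∀ z : (I → ℝ) × (I → ℝ), (f z.1 - f z.2) ^ 2 =
      (f z.1 * f z.1 + f z.2 * f z.2) - 2 * (f z.1 * f z.2) := fun z => by ring
    simp only [e]
    have k1 : Integrable (fun z : (I → ℝ) × (I → ℝ) => f z.1 * f z.1 + f z.2 * f z.2)
      (μ.prod μ) := (iff.comp_fst μ).add (iff.comp_snd μ)
    rw [integral_sub k1 ((if1.mul_prod if1).const_mul 2),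
      integral_add (iff.comp_fst μ) (iff.comp_snd μ), integral_const_mul,      integral_prod_mul f f, integral_fun_fst (f := fun x => f x * f x),
      integral_fun_snd (f := fun x => f x * f x)]
    have hfm : Measurable (fun ω => f (fun i => X i ω)) := hfc.measurable.comp mXv
    have v1 : MemLp (fun ω => f (fun i => X i ω)) 2 P := MemLp.of_bound
      hfm.aestronglyMeasurable K (ae_of_all _ fun ω => hfb _)
    rw [variance_eq_sub v1]
    have j1 : ∫ x, f x * f x ∂μ = ∫ ω, ((fun ω => f (fun i => X i ω)) ^ 2) ω ∂P := by
      rw [hμ, integral_map (by fun_prop) (Continuous.aestronglyMeasurable (by fun_prop))]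
      simp [sq]
    have j2 : ∫ x, f x ∂μ = ∫ ω, f (fun i => X i ω) ∂P := by
      rw [hμ, integral_map (by fun_prop) (Continuous.aestronglyMeasurable (by fun_prop))]
    rw [j1, j2]
    simp
    ring
  rw [hvar] at hle
  have hfin : ∫ x, ∑ i, ∑ j, Δ i j * (b i x * b j x) ∂μ =
      ∫ ω, ∑ i, ∑ j, Δ i j * (b i (fun k => X k ω) * b j (fun k => X k ω)) ∂P := by
    rw [hμ, integral_map (by fun_prop) (Continuous.aestronglyMeasurable (by fun_prop))]
  rw [hgint, hfin] at hle
  simp only [intervalIntegral.integral_const, sub_zero, smul_eq_mul] at hle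
  nlinarith

-- part B1
/-! ### Gaussian tails -/

/-- Standard Gaussian tail. -/
noncomputable def Qf (x : ℝ) : ℝ := (gaussianReal 0 1).real (Set.Ioi x)

/-- Standard Gaussian density. -/
noncomputable def gphi (x : ℝ) : ℝ := (√(2 * π))⁻¹ * Real.exp (-x ^ 2 / 2)

lemma Qf_nonneg (x : ℝ) : 0 ≤ Qf x := measureReal_nonneg
lemma Qf_le_one (x : ℝ) : Qf x ≤ 1 := measureReal_le_one
lemma Qf_anti : Antitone Qf := fun _ _ h => measureReal_mono (Set.Ioi_subset_Ioi h)
lemma gphi_pos (x : ℝ) : 0 < gphi x := by unfold gphi; positivity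

lemma Qf_eq (x : ℝ) : Qf x = ∫ t in Set.Ioi x, gphi t := by
  unfold Qf
  rw [measureReal_def, gaussianReal_apply_eq_integral _ (by simp), ENNReal.toReal_ofReal
    (integral_nonneg fun t => gaussianPDFReal_nonneg _ _ _)]
  simp [gaussianPDFReal, gphi]

lemma gphi_int : Integrable gphi := by
  have := integrable_gaussianPDFReal 0 1
  refine this.congr (ae_of_all _ fun t => ?_)
  simp [gaussianPDFReal, gphi]

lemma Qf_pos (x : ℝ) : 0 < Qf x := by
  rw [Qf_eq]
  refine (setIntegral_pos_iff_support_of_nonneg_ae (ae_of_all _ fun t => (gphi_pos t).le)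
    gphi_int.integrableOn).2 ?_
  have : Function.support gphi = Set.univ := by
    ext t; simp [(gphi_pos t).ne']
  rw [this]; simp

lemma gphi_deriv (t : ℝ) : HasDerivAt gphi (-t * gphi t) t := by
  have h1 : HasDerivAt (fun t : ℝ => -t ^ 2 / 2) (-t) t := by
    have := ((hasDerivAt_pow 2 t).neg).div_const 2
    refine this.congr_deriv ?_
    norm_num
    ring
  have := (h1.exp).const_mul (√(2 * π))⁻¹
  refine this.congr_deriv ?_
  unfold gphi; ring

lemma gphi_tendsto : Tendsto gphi atTop (nhds 0) := by
  have h : Tendsto (fun t : ℝ => -t ^ 2 / 2) atTop atBot := by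
    have : Tendsto (fun t : ℝ => t ^ 2 / 2) atTop atTop :=
      (tendsto_pow_atTop two_ne_zero).atTop_div_const two_pos
    refine (tendsto_neg_atTop_atBot.comp this).congr fun t => ?_
    simp [neg_div]
  have := (Real.tendsto_exp_atBot.comp h).const_mul (√(2 * π))⁻¹
  rw [mul_zero] at this
  exact this

lemma mills_aux (x : ℝ) (hx : 0 < x) :
    IntegrableOn (fun t => gphi t * (1 + 1 / t ^ 2)) (Set.Ioi x) ∧
    ∫ t in Set.Ioi x, gphi t * (1 + 1 / t ^ 2) = gphi x / x := by
  have hd : ∀ t ∈ Set.Ici x, HasDerivAt (fun t => -(gphi t / t)) (gphi t * (1 + 1 / t ^ 2)) t := by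
    intro t ht
    have ht0 : t ≠ 0 := (hx.trans_le ht).ne'
    have := ((gphi_deriv t).div (hasDerivAt_id t) ht0).neg
    refine this.congr_deriv ?_
    simp only [id]
    field_simp
    ring
  have hpos : ∀ t ∈ Set.Ioi x, 0 ≤ gphi t * (1 + 1 / t ^ 2) := fun t _ =>
    mul_nonneg (gphi_pos t).le (by positivity)
  have hlim : Tendsto (fun t => -(gphi t / t)) atTop (nhds 0) := by
    have := (gphi_tendsto.mul tendsto_inv_atTop_zero).neg
    simpa [div_eq_mul_inv] using this
  refine ⟨integrableOn_Ioi_deriv_of_nonneg' hd hpos hlim, ?_⟩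
  rw [integral_Ioi_of_hasDerivAt_of_nonneg' hd hpos hlim]
  ring

lemma Qf_le (x : ℝ) (hx : 0 < x) : Qf x ≤ gphi x / x := by
  obtain ⟨h1, h2⟩ := mills_aux x hx
  rw [← h2, Qf_eq]
  refine setIntegral_mono_on gphi_int.integrableOn h1 measurableSet_Ioi fun t ht => ?_
  have := gphi_pos t
  have : 0 ≤ 1 / t ^ 2 := by positivity
  nlinarith

lemma le_Qf (x : ℝ) (hx : 0 < x) : gphi x / x ≤ (1 + 1 / x ^ 2) * Qf x := by
  obtain ⟨h1, h2⟩ := mills_aux x hx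
  rw [← h2, Qf_eq, ← integral_const_mul]
  refine setIntegral_mono_on h1 (gphi_int.integrableOn.const_mul _) measurableSet_Ioi fun t ht => ?_
  have := gphi_pos t
  have h3 : 1 / t ^ 2 ≤ 1 / x ^ 2 := by
    have : x ≤ t := le_of_lt ht
    gcongr
  nlinarith

lemma Qf_le_exp (x : ℝ) (hx : 0 ≤ x) : Qf x ≤ Real.exp (-x ^ 2 / 2) := by
  have h := measure_ge_le_exp_mul_mgf (μ := gaussianReal 0 1) (X := id) x (t := x) hx
    (by simpa using integrable_exp_mul_gaussianReal (μ := 0) (v := 1) x)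
  have h2 : mgf id (gaussianReal 0 1) x = Real.exp (x ^ 2 / 2) := by
    have := mgf_id_gaussianReal (μ := 0) (v := 1)
    rw [this]; simp
  rw [h2, ← Real.exp_add] at h
  refine le_trans ?_ (h.trans (le_of_eq ?_))
  · exact measureReal_mono (fun t (ht : x < t) => (ht.le : x ≤ t))
  · congr 1; ring

/-- comparison of tails at `x * s`, `s ≥ 1` -/
lemma Qf_mul_le (x y : ℝ) (hx : 1 ≤ x) (hy : x ≤ y) :
    Qf y ≤ 2 * Qf x * Real.exp (-(y ^ 2 - x ^ 2) / 2) := by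
  have hx0 : 0 < x := by linarith
  have h1 := Qf_le y (hx0.trans_le hy)
  have h2 := le_Qf x hx0
  have h3 : gphi y / y ≤ gphi x / x * Real.exp (-(y ^ 2 - x ^ 2) / 2) := by
    have e : gphi y = gphi x * Real.exp (-(y ^ 2 - x ^ 2) / 2) := by
      unfold gphi
      rw [mul_assoc, ← Real.exp_add]
      congr 2; ring
    rw [e, div_mul_eq_mul_div]
    exact div_le_div_of_nonneg_left (mul_nonneg (gphi_pos x).le (Real.exp_pos _).le) hx0 hy
  have h4 : 1 + 1 / x ^ 2 ≤ 2 := by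
    have : 1 / x ^ 2 ≤ 1 := by
      rw [div_le_one (by positivity)]; nlinarith
    linarith
  have h5 := Qf_nonneg x
  have h6 : gphi x / x ≤ 2 * Qf x := h2.trans (mul_le_mul_of_nonneg_right h4 h5)
  exact h1.trans (h3.trans (mul_le_mul_of_nonneg_right h6 (Real.exp_pos _).le))

/-- the tail asymptotics -/
lemma Qf_asymp (v : ℝ) :
    Tendsto (fun y : ℝ => √(2 * π) * y * Real.exp (y ^ 2 / 2) * Qf (y + v / y)) atTop
      (nhds (Real.exp (-v))) := by
  have hvy : Tendsto (fun y : ℝ => v / y) atTop (nhds 0) := tendsto_const_nhds.div_atTop tendsto_id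
  have hx : Tendsto (fun y : ℝ => y + v / y) atTop atTop :=
    tendsto_id.atTop_add hvy
  -- main term
  have hm : Tendsto (fun y : ℝ => √(2 * π) * y * Real.exp (y ^ 2 / 2) *
      (gphi (y + v / y) / (y + v / y))) atTop (nhds (Real.exp (-v))) := by
    have h1 : Tendsto (fun y : ℝ => 1 / (1 + v / y * (1 / y)) *
        Real.exp (-v - (v / y) ^ 2 / 2)) atTop (nhds (1 / (1 + 0 * 0) * Real.exp (-v - 0 ^ 2 / 2))) := by
      have h0 : Tendsto (fun y : ℝ => 1 / y) atTop (nhds 0) :=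
        tendsto_const_nhds.div_atTop tendsto_id
      refine (Tendsto.div tendsto_const_nhds (tendsto_const_nhds.add (hvy.mul h0)) (by norm_num)).mul ?_
      exact (Real.continuous_exp.tendsto _).comp (tendsto_const_nhds.sub ((hvy.pow 2).div_const 2))
    have e : (1 / (1 + 0 * 0) * Real.exp (-v - 0 ^ 2 / 2) : ℝ) = Real.exp (-v) := by norm_num
    rw [e] at h1
    refine h1.congr' ?_
    filter_upwards [eventually_gt_atTop 0, hx.eventually_gt_atTop 0] with y hy hxy
    unfold gphi
    have e1 : Real.exp (-v - (v / y) ^ 2 / 2) =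
        Real.exp (y ^ 2 / 2) * Real.exp (-(y + v / y) ^ 2 / 2) := by
      rw [← Real.exp_add]; congr 1; field_simp; ring
    rw [e1]
    have : √(2 * π) ≠ 0 := by positivity
    have h3 : y ^ 2 + v ≠ 0 := by
      have : y * (y + v / y) = y ^ 2 + v := by field_simp
      rw [← this]; positivity
    have h4 : 1 + v / y * (1 / y) = (y ^ 2 + v) / y ^ 2 := by field_simp
    have h5 : y + v / y = (y ^ 2 + v) / y := by field_simp
    rw [h4]
    generalize Real.exp (-(y + v / y) ^ 2 / 2) = E
    rw [h5]
    field_simp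
  have hl : Tendsto (fun y : ℝ => √(2 * π) * y * Real.exp (y ^ 2 / 2) *
      (gphi (y + v / y) / (y + v / y)) * (1 / (1 + 1 / (y + v / y) ^ 2))) atTop
      (nhds (Real.exp (-v))) := by
    have h0 : Tendsto (fun y : ℝ => 1 / (y + v / y) ^ 2) atTop (nhds 0) :=
      tendsto_const_nhds.div_atTop ((tendsto_pow_atTop two_ne_zero).comp hx)
    have h1 := Tendsto.div (tendsto_const_nhds (x := (1:ℝ)))
      (tendsto_const_nhds (x := (1:ℝ)).add h0) (by norm_num)
    have := hm.mul h1
    simpa using this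
  refine tendsto_of_tendsto_of_tendsto_of_le_of_le' hl hm ?_ ?_
  · filter_upwards [eventually_gt_atTop 0, hx.eventually_gt_atTop 0] with y hy hxy
    rw [mul_assoc]
    refine mul_le_mul_of_nonneg_left ?_ (by positivity)
    rw [mul_one_div, div_le_iff₀ (by positivity)]
    have := le_Qf _ hxy
    linarith
  · filter_upwards [eventually_gt_atTop 0, hx.eventually_gt_atTop 0] with y hy hxy
    exact mul_le_mul_of_nonneg_left (Qf_le _ hxy) (by positivity)

lemma gauss_symm : (gaussianReal 0 1).map (fun x => -x) = gaussianReal 0 1 := by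
  rw [gaussianReal_map_neg]; simp

lemma gauss_sq : ∫ x, x ^ 2 ∂(gaussianReal 0 1) = 1 := by
  have := variance_eq_sub (μ := gaussianReal 0 1) (X := id) (memLp_id_gaussianReal 2)
  rw [variance_id_gaussianReal] at this
  simpa using this.symm

lemma gauss_sq_int : Integrable (fun x : ℝ => x ^ 2) (gaussianReal 0 1) :=
  (memLp_id_gaussianReal (μ := 0) (v := 1) 2).integrable_sq

lemma gauss_pos_int : Integrable (fun x : ℝ => max x 0 ^ 2) (gaussianReal 0 1) := by
  refine gauss_sq_int.mono' (Continuous.aestronglyMeasurable (by fun_prop)) (ae_of_all _ fun x => ?_)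
  rw [Real.norm_eq_abs, abs_pow, sq_abs]
  rcases le_total x 0 with h | h
  · rw [max_eq_right h]; nlinarith [sq_nonneg x]
  · rw [max_eq_left h]

lemma gauss_pos_sq : ∫ x, max x 0 ^ 2 ∂(gaussianReal 0 1) = 1 / 2 := by
  have h1 : ∫ x, max (-x) 0 ^ 2 ∂(gaussianReal 0 1) = ∫ x, max x 0 ^ 2 ∂(gaussianReal 0 1) := by
    conv_rhs => rw [← gauss_symm]
    rw [integral_map (by fun_prop) (Continuous.aestronglyMeasurable (by fun_prop))]
  have i2 : Integrable (fun x : ℝ => max (-x) 0 ^ 2) (gaussianReal 0 1) := by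
    have := gauss_pos_int
    rw [← gauss_symm] at this
    exact (integrable_map_measure (Continuous.aestronglyMeasurable (by fun_prop)) (by fun_prop)).1 this
  have h2 := integral_add gauss_pos_int i2
  rw [h1] at h2
  have h3 : (fun x : ℝ => max x 0 ^ 2 + max (-x) 0 ^ 2) = fun x => x ^ 2 := by
    ext x
    rcases le_total x 0 with h | h
    · rw [max_eq_right h, max_eq_left (by linarith)]; ring
    · rw [max_eq_left h, max_eq_right (by linarith)]; ring
  rw [h3, gauss_sq] at h2
  linarith

lemma sum_Qf_eq (f : ℕ → ℝ) (s : Finset ℕ) :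
    ∑ i ∈ s, Qf (f i) = ∫ x, ∑ i ∈ s, (Set.Ioi (f i)).indicator (fun _ => (1:ℝ)) x
      ∂(gaussianReal 0 1) := by
  rw [integral_finsetSum _ fun i _ => (integrable_const (1:ℝ)).indicator measurableSet_Ioi]
  refine Finset.sum_congr rfl fun i _ => ?_
  rw [integral_indicator_const _ measurableSet_Ioi]; simp [Qf]

lemma count_le (q x : ℝ) (hq : 0 < q) (h : ℕ) :
    ∑ i ∈ Icc 1 h, (Set.Ioi (√(q * i))).indicator (fun _ => (1:ℝ)) x ≤ max x 0 ^ 2 / q := by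
  rcases le_or_gt x 0 with hx | hx
  · rw [Finset.sum_eq_zero]
    · positivity
    · intro i _
      refine Set.indicator_of_notMem ?_ _
      simp only [Set.mem_Ioi, not_lt]
      exact hx.trans (Real.sqrt_nonneg _)
  · rw [max_eq_left hx.le]
    have h1 : ∀ i ∈ Icc 1 h, (Set.Ioi (√(q * i))).indicator (fun _ => (1:ℝ)) x ≤
      if i ∈ Icc 1 ⌊x ^ 2 / q⌋₊ then 1 else 0 := by
      intro i hi
      by_cases hm : x ∈ Set.Ioi (√(q * i))
      · rw [Set.indicator_of_mem hm, if_pos]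
        rw [Finset.mem_Icc] at hi ⊢
        refine ⟨hi.1, Nat.le_floor ?_⟩
        rw [le_div_iff₀ hq]
        have := (Real.sqrt_lt' hx).1 hm
        linarith
      · rw [Set.indicator_of_notMem hm]; split_ifs <;> norm_num
    refine (Finset.sum_le_sum h1).trans ?_
    rw [Finset.sum_ite_mem]
    simp only [Finset.sum_const, nsmul_eq_mul, mul_one]
    calc ((Icc 1 h ∩ Icc 1 ⌊x ^ 2 / q⌋₊).card : ℝ) ≤ ((Icc 1 ⌊x ^ 2 / q⌋₊).card : ℝ) := by
          exact_mod_cast Finset.card_le_card Finset.inter_subset_right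
      _ ≤ x ^ 2 / q := by
          simpa using Nat.floor_le (by positivity : 0 ≤ x ^ 2 / q)

lemma le_count (q x : ℝ) (hq : 0 < q) (h : ℕ) :
    min (max x 0 ^ 2) (q * h) / q ≤
    ∑ i ∈ range h, (Set.Ioi (√(q * i))).indicator (fun _ => (1:ℝ)) x := by
  rcases le_or_gt x 0 with hx | hx
  · rw [max_eq_right hx]
    have : (0:ℝ) ≤ q * h := by positivity
    rw [min_eq_left (by simpa using this)]
    simp only [ne_eq, OfNat.ofNat_ne_zero, not_false_eq_true, zero_pow, zero_div]
    exact Finset.sum_nonneg fun i _ => Set.indicator_nonneg (fun _ _ => zero_le_one) _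
  · rw [max_eq_left hx.le]
    have h1 : ∀ i ∈ range h, (if i ∈ range ⌈x ^ 2 / q⌉₊ then (1:ℝ) else 0) ≤
      (Set.Ioi (√(q * i))).indicator (fun _ => (1:ℝ)) x := by
      intro i hi
      split_ifs with hm
      · rw [Set.indicator_of_mem]
        rw [Finset.mem_range, Nat.lt_ceil, lt_div_iff₀ hq] at hm
        rw [Set.mem_Ioi, Real.sqrt_lt' hx]
        linarith
      · exact Set.indicator_nonneg (fun _ _ => zero_le_one) _
    refine le_trans ?_ (Finset.sum_le_sum h1)
    rw [Finset.sum_ite_mem]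
    simp only [Finset.sum_const, nsmul_eq_mul, mul_one]
    have e : range h ∩ range ⌈x ^ 2 / q⌉₊ = range (min h ⌈x ^ 2 / q⌉₊) := by
      ext i; simp
    rw [e, Finset.card_range, div_le_iff₀ hq, Nat.cast_min]
    rcases le_total (h : ℝ) (⌈x ^ 2 / q⌉₊ : ℝ) with h2 | h2
    · rw [min_eq_left h2, mul_comm]; exact min_le_right _ _
    · rw [min_eq_right h2]
      refine (min_le_left _ _).trans ?_
      have := Nat.le_ceil (x ^ 2 / q)
      rwa [div_le_iff₀ hq] at this

lemma sum_Qf_le (q : ℝ) (hq : 0 < q) (h : ℕ) : ∑ i ∈ Icc 1 h, Qf (√(q * i)) ≤ 1 / (2 * q) := by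
  rw [sum_Qf_eq (fun i => √(q * i))]
  have : (1 / (2 * q) : ℝ) = ∫ x, max x 0 ^ 2 / q ∂(gaussianReal 0 1) := by
    rw [integral_div, gauss_pos_sq]; field_simp
  rw [this]
  refine integral_mono ?_ (gauss_pos_int.div_const q) fun x => count_le q x hq h
  exact integrable_finsetSum _ fun i _ => (integrable_const (1:ℝ)).indicator measurableSet_Ioi

lemma le_sum_Qf (ε : ℝ) (hε : 0 < ε) : ∃ A : ℝ, ∀ (q : ℝ) (h : ℕ), 0 < q → A ≤ q * h →
    (1 - ε) / (2 * q) ≤ ∑ i ∈ range h, Qf (√(q * i)) := by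
  have hlim : Tendsto (fun A : ℝ => ∫ x, min (max x 0 ^ 2) A ∂(gaussianReal 0 1)) atTop
      (nhds (1 / 2)) := by
    rw [← gauss_pos_sq]
    refine tendsto_integral_filter_of_dominated_convergence (fun x => max x 0 ^ 2) ?_ ?_
      gauss_pos_int ?_
    · exact Eventually.of_forall fun A => Continuous.aestronglyMeasurable (by fun_prop)
    · filter_upwards [eventually_ge_atTop 0] with A hA
      refine ae_of_all _ fun x => ?_
      rw [Real.norm_eq_abs, abs_of_nonneg (le_min (by positivity) hA)]
      exact min_le_left _ _
    · refine ae_of_all _ fun x => tendsto_const_nhds.congr' ?_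
      filter_upwards [eventually_ge_atTop (max x 0 ^ 2)] with A hA
      rw [min_eq_left hA]
  have := hlim.eventually (eventually_gt_nhds (show (1 - ε) / 2 < 1 / 2 by linarith))
  obtain ⟨A, hA⟩ := (this.and (eventually_ge_atTop 0)).exists_forall_of_atTop
  refine ⟨A, fun q h hq hqh => ?_⟩
  rw [sum_Qf_eq (fun i => √(q * i))]
  have h1 := (hA _ hqh).1
  have i1 : Integrable (fun x : ℝ => min (max x 0 ^ 2) (q * h)) (gaussianReal 0 1) := by
    refine gauss_pos_int.mono' (Continuous.aestronglyMeasurable (by fun_prop))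
      (ae_of_all _ fun x => ?_)
    rw [Real.norm_eq_abs, abs_of_nonneg (le_min (by positivity) (by positivity))]
    exact min_le_left _ _
  have h2 : ∫ x, min (max x 0 ^ 2) (q * h) / q ∂(gaussianReal 0 1) ≤
      ∫ x, ∑ i ∈ range h, (Set.Ioi (√(q * i))).indicator (fun _ => (1:ℝ)) x
      ∂(gaussianReal 0 1) := by
    refine integral_mono (i1.div_const q) ?_ fun x => le_count q x hq h
    exact integrable_finsetSum _ fun i _ => (integrable_const (1:ℝ)).indicator measurableSet_Ioi
  refine le_trans ?_ h2
  rw [integral_div, le_div_iff₀ hq]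
  refine le_trans (le_of_eq ?_) h1.le
  field_simp

lemma GV.tail {Ω : Type*} [MeasurableSpace Ω] {P : Measure Ω} {I : Type*} [Fintype I]
    {X : I → Ω → ℝ} {Δ : I → I → ℝ} (h : GV P X Δ) (i : I) (hp : 0 < Δ i i) (L : ℝ) :
    P.real {ω | L < X i ω} = Qf (L / √(Δ i i)) := by
  have h1 := h.map_eq i
  have h2 : (gaussianReal 0 1).map (fun x => √(Δ i i) * x) = gaussianReal 0 (Δ i i).toNNReal := by
    rw [gaussianReal_map_const_mul]
    simp only [mul_zero, mul_one]
    congr 1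
    ext
    simp [Real.sq_sqrt hp.le, hp.le]
  have h3 : P.real {ω | L < X i ω} = (P.map (X i)).real (Set.Ioi L) := by
    rw [map_measureReal_apply (h.meas i) measurableSet_Ioi]; rfl
  rw [h3, h1, ← h2, map_measureReal_apply (by fun_prop) measurableSet_Ioi, Qf]
  congr 1
  ext x
  simp only [Set.mem_preimage, Set.mem_Ioi]
  rw [div_lt_iff₀ (by positivity), mul_comm]

-- part C1
/-! ### Stationary Gauss-Markov sequences -/

lemma tanh_bound (z : ℝ) (hz : 0 ≤ z) : 2 * (1 - Real.exp (-z)) ≤ z * (1 + Real.exp (-z)) := by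
  let g : ℝ → ℝ := fun z => z * (1 + Real.exp (-z)) - 2 * (1 - Real.exp (-z))
  have hd : ∀ z, HasDerivAt g (1 - Real.exp (-z) * (1 + z)) z := by
    intro z
    have he : HasDerivAt (fun z : ℝ => Real.exp (-z)) (-Real.exp (-z)) z := by
      have := (hasDerivAt_neg z).exp
      simpa using this
    have := ((hasDerivAt_id z).mul (he.const_add 1)).sub ((he.const_sub 1).const_mul 2)
    refine this.congr_deriv ?_
    simp only [id]
    ring
  have hmono : MonotoneOn g (Set.Ici 0) := by
    refine monotoneOn_of_deriv_nonneg (convex_Ici 0)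
      (fun z _ => (hd z).continuousAt.continuousWithinAt)
      (fun z _ => (hd z).differentiableAt.differentiableWithinAt) fun z _ => ?_
    rw [(hd z).deriv]
    have := Real.add_one_le_exp z
    have h2 : Real.exp (-z) * Real.exp z = 1 := by rw [← Real.exp_add]; simp
    have := Real.exp_pos (-z)
    nlinarith
  have := hmono (Set.mem_Ici.2 le_rfl) (Set.mem_Ici.2 hz) hz
  simp only [g, neg_zero, Real.exp_zero] at this
  linarith

section AR
variable {Ω : Type*} [MeasurableSpace Ω] {P : Measure Ω} {Y : ℕ → Ω → ℝ} {N : ℕ} {s k : ℝ}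

/-- Stationary Gauss–Markov covariance. -/
def IsAR (P : Measure Ω) (Y : ℕ → Ω → ℝ) (N : ℕ) (s k : ℝ) : Prop :=
  GV P (fun i : Fin N => Y i) (fun i j => s * Real.exp (-(k * |((i : ℕ) : ℝ) - ((j : ℕ) : ℝ)|)))

lemma IsAR.indep_step (h : IsAR P Y N s k) {i j : ℕ} (hij : j + i < N)
    {S : Set (Fin (j + 1) → ℝ)} (hS : MeasurableSet S) (y : ℝ) :
    P.real ({ω | (fun l : Fin (j + 1) => Y l ω) ∈ S} ∩
      {ω | y < Y (j + i) ω - Real.exp (-(k * i)) * Y j ω}) =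
    P.real {ω | (fun l : Fin (j + 1) => Y l ω) ∈ S} *
      P.real {ω | y < Y (j + i) ω - Real.exp (-(k * i)) * Y j ω} := by
  have hc := h.comb (K := Fin (j + 1) ⊕ Unit)
    (Sum.elim (fun l => ⟨l, by omega⟩) (fun _ => ⟨j + i, hij⟩)) (fun _ => ⟨j, by omega⟩)
    (fun _ => 1) (Sum.elim (fun _ => 0) (fun _ => -Real.exp (-(k * i))))
  have hind := hc.indep (fun l _ => by
    simp only [Sum.elim_inl, Sum.elim_inr]
    have h1 : ((l : ℕ) : ℝ) ≤ j := by exact_mod_cast Nat.lt_succ_iff.1 l.2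
    have h2 : |((l : ℕ) : ℝ) - ((j + i : ℕ) : ℝ)| = (j - l) + i := by
      rw [abs_of_nonpos]
      · push_cast; ring
      · push_cast; have : (0:ℝ) ≤ i := by positivity
        linarith
    have h3 : |((l : ℕ) : ℝ) - ((j : ℕ) : ℝ)| = j - l := by
      rw [abs_of_nonpos (by linarith)]; ring
    rw [h2, h3]
    have : Real.exp (-(k * (j - l + i))) = Real.exp (-(k * i)) * Real.exp (-(k * (j - l))) := by
      rw [← Real.exp_add]; congr 1; ring
    rw [this]; ring)
  have hu : MeasurableSet {w : Unit → ℝ | y < w ()} :=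
    measurableSet_lt measurable_const (measurable_pi_apply ())
  have := hind.measure_inter_preimage_eq_mul S {w : Unit → ℝ | y < w ()} hS hu
  have e1 : {ω | (fun l : Fin (j + 1) => Y l ω) ∈ S} =
    ((fun ω (l : Fin (j + 1)) => (1:ℝ) * Y l ω + 0 * Y j ω) ⁻¹' S) := by
    ext ω; simp
  have e2 : {ω | y < Y (j + i) ω - Real.exp (-(k * i)) * Y j ω} =
    ((fun ω (_ : Unit) => (1:ℝ) * Y (j + i) ω + -Real.exp (-(k * i)) * Y j ω) ⁻¹'
      {w : Unit → ℝ | y < w ()}) := by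
    ext ω; simp [sub_eq_add_neg]
  rw [e1, e2]
  simp only [measureReal_def]
  rw [← ENNReal.toReal_mul]
  exact congrArg _ this

lemma IsAR.noise_tail (h : IsAR P Y N s k) (hs : 0 < s) (hk : 0 < k) {i j : ℕ} (hij : j + i < N)
    (hi : 1 ≤ i) (y : ℝ) :
    P.real {ω | y < Y (j + i) ω - Real.exp (-(k * i)) * Y j ω} =
      Qf (y / √(s * (1 - Real.exp (-(k * i)) ^ 2))) := by
  have hc := h.comb (K := Unit)
    (fun _ => ⟨j + i, hij⟩) (fun _ => ⟨j, by omega⟩)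
    (fun _ => 1) (fun _ => -Real.exp (-(k * i)))
  have hv := hc.congr_cov (Δ' := fun _ _ => s * (1 - Real.exp (-(k * i)) ^ 2)) (by
    intro _ _
    have h2 : |((j + i : ℕ) : ℝ) - ((j : ℕ) : ℝ)| = i := by
      push_cast; rw [add_sub_cancel_left, abs_of_nonneg (by positivity)]
    have h3 : |((j : ℕ) : ℝ) - ((j + i : ℕ) : ℝ)| = i := by rw [abs_sub_comm, h2]
    simp only [h2, h3, sub_self, abs_zero, mul_zero, neg_zero, Real.exp_zero]
    ring)
  have hpos : 0 < s * (1 - Real.exp (-(k * i)) ^ 2) := by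
    have hi' : (0:ℝ) < i := by exact_mod_cast hi
    have : Real.exp (-(k * i)) < 1 := by
      rw [Real.exp_lt_one_iff]; nlinarith
    have := Real.exp_pos (-(k * i))
    have : Real.exp (-(k * i)) ^ 2 < 1 := by nlinarith
    exact mul_pos hs (by linarith)
  rw [← hv.tail () hpos y]
  congr 1
  ext ω
  simp [sub_eq_add_neg]

lemma IsAR.rev_step (h : IsAR P Y N s k) (hs : 0 < s) (hk : 0 < k) {j : ℕ} (hj : j + 1 < N)
    (L y : ℝ) :
    P.real ({ω | L < Y (j + 1) ω} ∩ {ω | y < Real.exp (-k) * Y (j + 1) ω - Y j ω}) =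
    Qf (L / √s) * Qf (y / √(s * (1 - Real.exp (-k) ^ 2))) := by
  have hc := h.comb (K := Unit ⊕ Unit)
    (fun _ => ⟨j + 1, hj⟩) (fun _ => ⟨j, by omega⟩)
    (Sum.elim (fun _ => 1) (fun _ => Real.exp (-k))) (Sum.elim (fun _ => 0) (fun _ => -1))
  have h2 : |((j + 1 : ℕ) : ℝ) - ((j : ℕ) : ℝ)| = 1 := by
      push_cast; rw [add_sub_cancel_left, abs_one]
  have h3 : |((j : ℕ) : ℝ) - ((j + 1 : ℕ) : ℝ)| = 1 := by rw [abs_sub_comm, h2]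
  have hv := hc.congr_cov (Δ' := Sum.elim (fun _ => Sum.elim (fun _ => s) (fun _ => 0))
    (fun _ => Sum.elim (fun _ => 0) (fun _ => s * (1 - Real.exp (-k) ^ 2)))) (by
    rintro (_ | _) (_ | _) <;>
    simp only [h2, h3, sub_self, abs_zero, mul_zero, neg_zero, Real.exp_zero, Sum.elim_inl,
      Sum.elim_inr, mul_one] <;> ring)
  have hind := hv.indep (fun l _ => by simp)
  have hu : ∀ y : ℝ, MeasurableSet {w : Unit → ℝ | y < w ()} := fun y =>
    measurableSet_lt measurable_const (measurable_pi_apply ())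
  have := hind.measure_inter_preimage_eq_mul {w : Unit → ℝ | L < w ()} {w : Unit → ℝ | y < w ()}
    (hu L) (hu y)
  have hpos : 0 < s * (1 - Real.exp (-k) ^ 2) := by
    have : Real.exp (-k) < 1 := by
      rw [Real.exp_lt_one_iff]; linarith
    have := Real.exp_pos (-k)
    have : Real.exp (-k) ^ 2 < 1 := by nlinarith
    exact mul_pos hs (by linarith)
  have t1 := hv.tail (Sum.inl ()) hs L
  have t2 := hv.tail (Sum.inr ()) hpos y
  simp only [Sum.elim_inl, Sum.elim_inr] at t1 t2
  rw [← t1, ← t2]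
  simp only [measureReal_def]
  rw [← ENNReal.toReal_mul]
  refine Eq.trans ?_ (congrArg _ this)
  congr 2
  ext ω
  simp [sub_eq_add_neg]

/-- first passage event -/
def fpe (Y : ℕ → Ω → ℝ) (L : ℝ) (j : ℕ) : Set Ω := {ω | L < Y j ω ∧ ∀ l < j, Y l ω ≤ L}

lemma fpe_union (L : ℝ) (M : ℕ) : {ω | ∃ j < M, L < Y j ω} = ⋃ j ∈ range M, fpe Y L j := by
  classical
  ext ω
  simp only [Set.mem_ofPred_eq, Set.mem_iUnion, Finset.mem_range, fpe, exists_prop]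
  constructor
  · rintro ⟨j, hj, hL⟩
    have hex : ∃ j, L < Y j ω := ⟨j, hL⟩
    refine ⟨Nat.find hex, (Nat.find_min' hex hL).trans_lt hj, Nat.find_spec hex, fun l hl => ?_⟩
    exact not_lt.1 (Nat.find_min hex hl)
  · rintro ⟨j, hj, hL, -⟩
    exact ⟨j, hj, hL⟩

lemma fpe_disj (L : ℝ) : Pairwise (fun i j => Disjoint (fpe Y L i) (fpe Y L j)) := by
  intro i j hij
  rw [Set.disjoint_left]
  rintro ω ⟨h1, h2⟩ ⟨h3, h4⟩
  rcases lt_or_gt_of_ne hij with h | h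
  · exact absurd h1 (not_lt.2 (h4 i h))
  · exact absurd h3 (not_lt.2 (h2 j h))

lemma IsAR.meas (h : IsAR P Y N s k) {j : ℕ} (hj : j < N) : Measurable (Y j) := GV.meas h ⟨j, hj⟩

lemma IsAR.prob (h : IsAR P Y N s k) : IsProbabilityMeasure P := GV.prob h

lemma IsAR.fpe_meas (h : IsAR P Y N s k) (L : ℝ) {j : ℕ} (hj : j < N) :
    MeasurableSet (fpe Y L j) := by
  have : fpe Y L j = {ω | L < Y j ω} ∩ ⋂ l ∈ range j, {ω | Y l ω ≤ L} := by
    ext ω; simp [fpe]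
  rw [this]
  refine (measurableSet_lt measurable_const (h.meas hj)).inter ?_
  refine Finset.measurableSet_biInter _ fun l hl => ?_
  exact measurableSet_le (h.meas ((Finset.mem_range.1 hl).trans hj)) measurable_const

lemma IsAR.sum_fpe (h : IsAR P Y N s k) (L : ℝ) {M : ℕ} (hM : M ≤ N) :
    ∑ j ∈ range M, P.real (fpe Y L j) = P.real {ω | ∃ j < M, L < Y j ω} := by
  have := h.prob
  rw [fpe_union, measureReal_biUnion_finset (fun i _ j _ hij => fpe_disj L hij)
    (fun j hj => h.fpe_meas L ((Finset.mem_range.1 hj).trans_le hM))]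

lemma IsAR.sum_fpe_inter (h : IsAR P Y N s k) (L : ℝ) {M : ℕ} (hM : M ≤ N) {A : Set Ω}
    (hA : MeasurableSet A) : ∑ j ∈ range M, P.real (fpe Y L j ∩ A) ≤ P.real A := by
  have := h.prob
  rw [← measureReal_biUnion_finset (fun i _ j _ hij =>
    (fpe_disj L hij).mono Set.inter_subset_left Set.inter_subset_left)
    (fun j hj => (h.fpe_meas L ((Finset.mem_range.1 hj).trans_le hM)).inter hA)]
  exact measureReal_mono (Set.iUnion₂_subset fun j _ => Set.inter_subset_right)

lemma IsAR.tail (h : IsAR P Y N s k) (hs : 0 < s) {j : ℕ} (hj : j < N) (L : ℝ) :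
    P.real {ω | L < Y j ω} = Qf (L / √s) := by
  have h' : GV P (fun i : Fin N => Y i)
    (fun i j => s * Real.exp (-(k * |((i : ℕ) : ℝ) - ((j : ℕ) : ℝ)|))) := h
  have := h'.tail ⟨j, hj⟩ (by simpa using hs) L
  simpa using this

lemma IsAR.fpe_noise (h : IsAR P Y N s k) {i j : ℕ} (hij : j + i < N)
    (L L' y : ℝ) :
    P.real ((fpe Y L j ∩ {ω | Y j ω ≤ L'}) ∩
      {ω | y < Y (j + i) ω - Real.exp (-(k * i)) * Y j ω}) =
    P.real (fpe Y L j ∩ {ω | Y j ω ≤ L'}) *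
      P.real {ω | y < Y (j + i) ω - Real.exp (-(k * i)) * Y j ω} := by
  let S : Set (Fin (j + 1) → ℝ) := ({w | L < w (Fin.last j)} ∩ ⋂ l : Fin j,
    {w | w l.castSucc ≤ L}) ∩ {w | w (Fin.last j) ≤ L'}
  have hS : MeasurableSet S := by
    refine ((measurableSet_lt measurable_const (measurable_pi_apply _)).inter
      (MeasurableSet.iInter fun l => measurableSet_le (measurable_pi_apply _)
        measurable_const)).inter (measurableSet_le (measurable_pi_apply _) measurable_const)
  have e : fpe Y L j ∩ {ω | Y j ω ≤ L'} = {ω | (fun l : Fin (j + 1) => Y l ω) ∈ S} := by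
    ext ω
    simp only [S, fpe, Set.mem_inter_iff, Set.mem_ofPred_eq, Fin.val_last, Set.mem_iInter,
      Fin.val_castSucc]
    constructor
    · rintro ⟨⟨h1, h2⟩, h3⟩
      exact ⟨⟨h1, fun l => h2 l l.2⟩, h3⟩
    · rintro ⟨⟨h1, h2⟩, h3⟩
      exact ⟨⟨h1, fun l hl => h2 ⟨l, hl⟩⟩, h3⟩
  rw [e]
  exact h.indep_step hij hS y

lemma IsAR.fpe_noise' (h : IsAR P Y N s k) {i j : ℕ} (hij : j + i < N)
    (L y : ℝ) :
    P.real (fpe Y L j ∩ {ω | y < Y (j + i) ω - Real.exp (-(k * i)) * Y j ω}) =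
    P.real (fpe Y L j) *
      P.real {ω | y < Y (j + i) ω - Real.exp (-(k * i)) * Y j ω} := by
  let S : Set (Fin (j + 1) → ℝ) := {w | L < w (Fin.last j)} ∩ ⋂ l : Fin j,
    {w | w l.castSucc ≤ L}
  have hS : MeasurableSet S := by
    refine (measurableSet_lt measurable_const (measurable_pi_apply _)).inter
      (MeasurableSet.iInter fun l => measurableSet_le (measurable_pi_apply _)
        measurable_const)
  have e : fpe Y L j = {ω | (fun l : Fin (j + 1) => Y l ω) ∈ S} := by
    ext ω
    simp only [S, fpe, Set.mem_inter_iff, Set.mem_ofPred_eq, Fin.val_last, Set.mem_iInter,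
      Fin.val_castSucc]
    constructor
    · rintro ⟨h1, h2⟩
      exact ⟨h1, fun l => h2 l l.2⟩
    · rintro ⟨h1, h2⟩
      exact ⟨h1, fun l hl => h2 ⟨l, hl⟩⟩
  rw [e]
  exact h.indep_step hij hS y

lemma IsAR.upper (h : IsAR P Y N s k) (hs : 0 < s) (hk : 0 < k) {L : ℝ} (hL : 0 ≤ L) {M h' : ℕ}
    (hM : M + h' ≤ N) :
    P.real {ω | ∃ j < M, L < Y j ω} * ∑ i ∈ range h', Qf (√(L ^ 2 * k / (2 * s) * i)) ≤
      (M + h') * Qf (L / √s) := by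
  have := h.prob
  have hterm : ∀ j < M, ∀ i < h', P.real (fpe Y L j) * Qf (√(L ^ 2 * k / (2 * s) * i)) ≤
      P.real (fpe Y L j ∩ {ω | L < Y (j + i) ω}) := by
    intro j hj i hi
    rcases Nat.eq_zero_or_pos i with rfl | hi0
    · have : fpe Y L j ∩ {ω | L < Y (j + 0) ω} = fpe Y L j :=
        Set.inter_eq_left.2 fun ω hω => hω.1
      rw [this]
      exact mul_le_of_le_one_right measureReal_nonneg (Qf_le_one _)
    · have hij : j + i < N := by omega
      set b := Real.exp (-(k * i)) with hb
      have hi' : (0:ℝ) < i := by exact_mod_cast hi0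
      have hb1 : b < 1 := by rw [hb, Real.exp_lt_one_iff]; nlinarith
      have hb0 : 0 < b := Real.exp_pos _
      have h1 : P.real (fpe Y L j) * Qf (L * (1 - b) / √(s * (1 - b ^ 2))) ≤
          P.real (fpe Y L j ∩ {ω | L < Y (j + i) ω}) := by
        rw [← h.noise_tail hs hk hij hi0 (L * (1 - b)), ← h.fpe_noise' hij]
        refine measureReal_mono ?_
        rintro ω ⟨h1, h2⟩
        refine ⟨h1, ?_⟩
        have h3 : L < Y j ω := h1.1
        simp only [Set.mem_ofPred_eq, ← hb] at h2 ⊢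
        nlinarith
      refine le_trans (mul_le_mul_of_nonneg_left (Qf_anti ?_) measureReal_nonneg) h1
      have hp : 0 < s * (1 - b ^ 2) := mul_pos hs (by nlinarith)
      refine Real.le_sqrt_of_sq_le ?_
      rw [div_pow, Real.sq_sqrt hp.le, div_le_iff₀ hp]
      have ht := tanh_bound (k * i) (by positivity)
      rw [← hb] at ht
      have : L ^ 2 * k / (2 * s) * i * (s * (1 - b ^ 2)) =
        L ^ 2 * (1 - b) * ((k * i) * (1 + b)) / 2 := by field_simp; ring
      rw [this]
      have h4 : 0 ≤ L ^ 2 * (1 - b) := mul_nonneg (sq_nonneg _) (by linarith)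
      have := mul_le_mul_of_nonneg_left ht h4
      nlinarith
  rw [← h.sum_fpe L (by omega : M ≤ N), Finset.sum_mul_sum]
  calc ∑ j ∈ range M, ∑ i ∈ range h', P.real (fpe Y L j) * Qf (√(L ^ 2 * k / (2 * s) * i))
      ≤ ∑ j ∈ range M, ∑ i ∈ range h', P.real (fpe Y L j ∩ {ω | L < Y (j + i) ω}) :=
        Finset.sum_le_sum fun j hj => Finset.sum_le_sum fun i hi =>
          hterm j (Finset.mem_range.1 hj) i (Finset.mem_range.1 hi)
    _ ≤ ∑ j ∈ range M, ∑ l ∈ range (M + h'), P.real (fpe Y L j ∩ {ω | L < Y l ω}) := by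
        refine Finset.sum_le_sum fun j hj => ?_
        rw [← Finset.sum_image (s := range h') (g := fun i => j + i)
          (f := fun l => P.real (fpe Y L j ∩ {ω | L < Y l ω})) (fun a _ b _ hab => by
            simpa using hab)]
        refine Finset.sum_le_sum_of_subset_of_nonneg ?_ fun _ _ _ => measureReal_nonneg
        intro l hl
        simp only [Finset.mem_image, Finset.mem_range] at hl hj ⊢
        obtain ⟨i, hi, rfl⟩ := hl
        omega
    _ = ∑ l ∈ range (M + h'), ∑ j ∈ range M, P.real (fpe Y L j ∩ {ω | L < Y l ω}) :=
        Finset.sum_comm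
    _ ≤ ∑ l ∈ range (M + h'), Qf (L / √s) := by
        refine Finset.sum_le_sum fun l hl => ?_
        have hl' : l < N := by have := Finset.mem_range.1 hl; omega
        rw [← h.tail hs hl' L]
        exact h.sum_fpe_inter L (by omega) (measurableSet_lt measurable_const (h.meas hl'))
    _ = (M + h') * Qf (L / √s) := by simp

/-- weights in the lower bound -/
noncomputable def arW (s k L K : ℝ) (i : ℕ) : ℝ := if i = 0 then 1 else
  Qf ((L - Real.exp (-(k * i)) * (L + K)) / √(s * (1 - Real.exp (-(k * i)) ^ 2)))

lemma IsAR.lower (h : IsAR P Y N s k) (hs : 0 < s) (hk : 0 < k) {L K : ℝ} (hK : 0 ≤ K)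
    {M : ℕ} (hM : M ≤ N) :
    M * Qf (L / √s) ≤ P.real {ω | ∃ j < M, L < Y j ω} * (∑ i ∈ range M, arW s k L K i) +
      M ^ 2 * (Qf (L / √s) * Qf ((Real.exp (-k) * (L + K) - L) / √(s * (1 - Real.exp (-k) ^ 2)))) +
      ∑ l ∈ range M, P.real ({ω | L < Y 0 ω} ∩ {ω | L < Y l ω}) := by
  have := h.prob
  set tiny := Qf (L / √s) * Qf ((Real.exp (-k) * (L + K) - L) / √(s * (1 - Real.exp (-k) ^ 2)))
    with htiny
  have htiny0 : 0 ≤ tiny := mul_nonneg (Qf_nonneg _) (Qf_nonneg _)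
  have hW0 : ∀ i, 0 ≤ arW s k L K i := fun i => by
    unfold arW; split_ifs
    · exact zero_le_one
    · exact Qf_nonneg _
  have hterm : ∀ j i, j + i < M → P.real (fpe Y L j ∩ {ω | L < Y (j + i) ω}) ≤
      P.real (fpe Y L j) * arW s k L K i + tiny +
      (if j = 0 then P.real ({ω | L < Y 0 ω} ∩ {ω | L < Y (j + i) ω}) else 0) := by
    intro j i hij
    have hij' : j + i < N := by omega
    rcases Nat.eq_zero_or_pos i with rfl | hi0
    · have h1 : P.real (fpe Y L j ∩ {ω | L < Y (j + 0) ω}) ≤ P.real (fpe Y L j) :=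
        measureReal_mono Set.inter_subset_left
      have h2 : (0:ℝ) ≤ (if j = 0 then P.real ({ω | L < Y 0 ω} ∩ {ω | L < Y (j + 0) ω}) else 0) := by
        split_ifs
        · exact measureReal_nonneg
        · exact le_rfl
      have h3 : arW s k L K 0 = 1 := by simp [arW]
      rw [h3]
      linarith
    · set b := Real.exp (-(k * i)) with hb
      have hb0 : 0 < b := Real.exp_pos _
      have hsub : fpe Y L j ∩ {ω | L < Y (j + i) ω} ⊆
          ((fpe Y L j ∩ {ω | Y j ω ≤ L + K}) ∩ {ω | L - b * (L + K) < Y (j + i) ω - b * Y j ω}) ∪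
          (fpe Y L j ∩ {ω | L + K < Y j ω} ∩ {ω | L < Y (j + i) ω}) := by
        rintro ω ⟨h1, h2⟩
        simp only [Set.mem_ofPred_eq] at h2
        rcases le_or_gt (Y j ω) (L + K) with h3 | h3
        · left
          refine ⟨⟨h1, h3⟩, ?_⟩
          simp only [Set.mem_ofPred_eq]
          nlinarith
        · right
          exact ⟨⟨h1, h3⟩, h2⟩
      have h1 := (measureReal_mono (μ := P) hsub).trans (measureReal_union_le _ _)
      have h2 : P.real ((fpe Y L j ∩ {ω | Y j ω ≤ L + K}) ∩
          {ω | L - b * (L + K) < Y (j + i) ω - b * Y j ω}) ≤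
          P.real (fpe Y L j) * arW s k L K i := by
        rw [hb, h.fpe_noise hij', h.noise_tail hs hk hij' hi0]
        have : arW s k L K i = Qf ((L - Real.exp (-(k * i)) * (L + K)) /
          √(s * (1 - Real.exp (-(k * i)) ^ 2))) := by
          unfold arW; rw [if_neg (by omega)]
        rw [this]
        exact mul_le_mul_of_nonneg_right (measureReal_mono Set.inter_subset_left) (Qf_nonneg _)
      have h3 : P.real (fpe Y L j ∩ {ω | L + K < Y j ω} ∩ {ω | L < Y (j + i) ω}) ≤ tiny +
          (if j = 0 then P.real ({ω | L < Y 0 ω} ∩ {ω | L < Y (j + i) ω}) else 0) := by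
        split_ifs with hj
        · subst hj
          have : P.real (fpe Y L 0 ∩ {ω | L + K < Y 0 ω} ∩ {ω | L < Y (0 + i) ω}) ≤
              P.real ({ω | L < Y 0 ω} ∩ {ω | L < Y (0 + i) ω}) :=
            measureReal_mono (Set.inter_subset_inter_left _ fun ω hω => hω.1.1)
          linarith
        · obtain ⟨l, rfl⟩ := Nat.exists_eq_succ_of_ne_zero hj
          rw [add_zero, htiny, ← h.rev_step hs hk (by omega : l + 1 < N)]
          refine measureReal_mono ?_
          rintro ω ⟨⟨⟨h1, h2⟩, h3⟩, -⟩
          refine ⟨h1, ?_⟩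
          have h4 := h2 l (Nat.lt_succ_self l)
          simp only [Set.mem_ofPred_eq, Nat.succ_eq_add_one] at h3 ⊢
          have := Real.exp_pos (-k)
          nlinarith
      linarith
  have hdecomp : ∀ l ∈ range M, Qf (L / √s) ≤ ∑ j ∈ range M,
      (if j ≤ l then P.real (fpe Y L j) * arW s k L K (l - j) else 0) + M * tiny +
      P.real ({ω | L < Y 0 ω} ∩ {ω | L < Y l ω}) := by
    intro l hl
    have hl' := Finset.mem_range.1 hl
    rw [← h.tail hs (by omega : l < N) L]
    have hsub : {ω | L < Y l ω} ⊆ ⋃ j ∈ range (l + 1), (fpe Y L j ∩ {ω | L < Y l ω}) := by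
      intro ω hω
      have : ω ∈ {ω | ∃ j < l + 1, L < Y j ω} := ⟨l, Nat.lt_succ_self l, hω⟩
      rw [fpe_union] at this
      simp only [Set.mem_iUnion] at this ⊢
      obtain ⟨j, hj, h1⟩ := this
      exact ⟨j, hj, h1, hω⟩
    refine (measureReal_mono (μ := P) hsub (measure_ne_top _ _)).trans ((measureReal_biUnion_finset_le _ _).trans ?_)
    have h1 : ∀ j ∈ range (l + 1), P.real (fpe Y L j ∩ {ω | L < Y l ω}) ≤
        P.real (fpe Y L j) * arW s k L K (l - j) + tiny +
        (if j = 0 then P.real ({ω | L < Y 0 ω} ∩ {ω | L < Y l ω}) else 0) := by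
      intro j hj
      have hj' := Finset.mem_range.1 hj
      have := hterm j (l - j) (by omega)
      rwa [Nat.add_sub_cancel' (by omega)] at this
    refine (Finset.sum_le_sum h1).trans ?_
    rw [Finset.sum_add_distrib, Finset.sum_add_distrib]
    refine add_le_add (add_le_add ?_ ?_) ?_
    · rw [← Finset.sum_filter]
      refine le_of_eq (Finset.sum_congr ?_ fun _ _ => rfl)
      ext j; simp; omega
    · simp only [Finset.sum_const, Finset.card_range, nsmul_eq_mul]
      refine mul_le_mul_of_nonneg_right ?_ htiny0
      exact_mod_cast hl'
    · simp
  have hsum := Finset.sum_le_sum hdecomp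
  rw [Finset.sum_const, Finset.card_range, nsmul_eq_mul] at hsum
  refine hsum.trans ?_
  rw [Finset.sum_add_distrib, Finset.sum_add_distrib]
  refine add_le_add (add_le_add ?_ ?_) le_rfl
  · rw [Finset.sum_comm, ← h.sum_fpe L hM, Finset.sum_mul]
    refine Finset.sum_le_sum fun j hj => ?_
    rw [← Finset.sum_filter, ← Finset.mul_sum]
    refine mul_le_mul_of_nonneg_left ?_ measureReal_nonneg
    rw [← Finset.sum_image (s := (range M).filter (fun l => j ≤ l)) (g := fun l => l - j)
      (f := fun i => arW s k L K i) (fun a ha b hb hab => by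
        simp only [Finset.coe_filter, Finset.mem_range, Set.mem_ofPred_eq] at ha hb hab; omega)]
    refine Finset.sum_le_sum_of_subset_of_nonneg ?_ fun i _ _ => hW0 i
    intro i hi
    simp only [Finset.mem_image, Finset.mem_filter, Finset.mem_range] at hi ⊢
    obtain ⟨l, hl, rfl⟩ := hi
    omega
  · simp only [Finset.sum_const, Finset.card_range, nsmul_eq_mul]
    rw [← mul_assoc, ← sq]

end AR

-- part C2
/-- Joint tail of two equal-variance Gaussians. -/
lemma GV.pair_tail {Ω : Type*} [MeasurableSpace Ω] {P : Measure Ω} {I : Type*} [Fintype I]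
    {X : I → Ω → ℝ} {Δ : I → I → ℝ} (h : GV P X Δ) (i j : I)
    (hp : 0 < Δ i i + Δ i j + Δ j i + Δ j j) (L : ℝ) :
    P.real ({ω | L < X i ω} ∩ {ω | L < X j ω}) ≤
      Qf (2 * L / √(Δ i i + Δ i j + Δ j i + Δ j j)) := by
  have := h.prob
  have h2 := h.comb (K := Unit) (fun _ => i) (fun _ => j) (fun _ => 1) (fun _ => 1)
  have h3 := h2.tail () (by simpa using hp) (2 * L)
  simp only [one_mul] at h3
  rw [← h3]
  refine measureReal_mono ?_ (measure_ne_top _ _)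
  rintro ω ⟨h4, h5⟩
  simp only [Set.mem_ofPred_eq] at *
  linarith

noncomputable def arMat (s k : ℝ) (N : ℕ) : Matrix (Fin N) (Fin N) ℝ :=
  Matrix.of fun i j => s * Real.exp (-(k * |((i : ℕ) : ℝ) - ((j : ℕ) : ℝ)|))

lemma arMat_psd (s k : ℝ) (hs : 0 ≤ s) (hk : 0 ≤ k) (N : ℕ) : (arMat s k N).PosSemidef := by
  have h0 := posSemidef_matrix_measure_inter (μ := volume) (s := fun i : Fin N =>
    Set.Icc (0 : ℝ) (Real.exp (2 * k * (i : ℕ)))) (fun _ => measurableSet_Icc)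
    (fun _ => isCompact_Icc.measure_ne_top)
  have h1 := (h0.mul_mul_conjTranspose_same
    (Matrix.diagonal (fun i : Fin N => Real.exp (-(k * (i : ℕ)))))).smul hs
  convert h1 using 1
  ext i j
  simp only [arMat, Matrix.of_apply, Matrix.smul_apply, Matrix.diagonal_conjTranspose,
    Matrix.mul_diagonal, Matrix.diagonal_mul, smul_eq_mul, Set.Icc_inter_Icc, max_self,
    Real.volume_real_Icc, Pi.star_apply, star_trivial]
  congr 1
  have hpos : 0 ≤ min (Real.exp (2 * k * (i : ℕ))) (Real.exp (2 * k * (j : ℕ))) := by positivity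
  simp only [sub_zero]
  have : ∀ a b : ℝ, a ≤ b → Real.exp (-(k * |a - b|)) =
      Real.exp (-(k * a)) * min (Real.exp (2 * k * a)) (Real.exp (2 * k * b)) *
        Real.exp (-(k * b)) := by
    intro a b hab
    rw [min_eq_left (Real.exp_le_exp.2 (by gcongr)), ← Real.exp_add, ← Real.exp_add,
      abs_of_nonpos (by linarith)]
    congr 1; ring
  have h2 : max (min (Real.exp (2 * k * (i : ℕ))) (Real.exp (2 * k * (j : ℕ)))) 0 =
      min (Real.exp (2 * k * (i : ℕ))) (Real.exp (2 * k * (j : ℕ))) := max_eq_left hpos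
  show Real.exp (-(k * |((i : ℕ) : ℝ) - ((j : ℕ) : ℝ)|)) = Real.exp (-(k * (i : ℕ))) *
    max (min (Real.exp (2 * k * (i : ℕ))) (Real.exp (2 * k * (j : ℕ)))) 0 *
      Real.exp (-(k * (j : ℕ)))
  rw [h2]
  rcases le_total ((i : ℕ) : ℝ) ((j : ℕ) : ℝ) with hij | hij
  · exact this _ _ hij
  · rw [abs_sub_comm, this _ _ hij, min_comm]; ring

noncomputable def arY (N : ℕ) (j : ℕ) (x : EuclideanSpace ℝ (Fin N)) : ℝ :=
  if h : j < N then x ⟨j, h⟩ else 0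

lemma isAR_arY (s k : ℝ) (hs : 0 ≤ s) (hk : 0 ≤ k) (N : ℕ) :
    IsAR (multivariateGaussian 0 (arMat s k N)) (arY N) N s k := by
  have h := exists_GV (arMat s k N) (arMat_psd s k hs hk N)
  exact h.congr_fun (fun i ω => by simp [arY])

/-- Exceedance probability of the reference autoregressive process. -/
noncomputable def arProb (s k : ℝ) (M : ℕ) (L : ℝ) : ℝ :=
  (multivariateGaussian 0 (arMat s k (2 * M))).real {x | ∃ j < M, L < arY (2 * M) j x}

lemma arProb_restrict (s k : ℝ) (hs : 0 ≤ s) (hk : 0 ≤ k) (M : ℕ) (L : ℝ) :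
    GV (multivariateGaussian 0 (arMat s k (2 * M))) (fun i : Fin M => arY (2 * M) i)
      (fun i j => s * Real.exp (-(k * |((i : ℕ) : ℝ) - ((j : ℕ) : ℝ)|))) ∧
    arProb s k M L = (multivariateGaussian 0 (arMat s k (2 * M))).real
      {x | ∃ j : Fin M, L < arY (2 * M) j x} := by
  constructor
  · have h : GV _ _ _ := isAR_arY s k hs hk (2 * M)
    exact h.comp (fun i : Fin M => (⟨i, by omega⟩ : Fin (2 * M)))
  · unfold arProb
    congr 1
    ext x
    simp only [Set.mem_ofPred_eq]
    constructor
    · rintro ⟨j, hj, h⟩; exact ⟨⟨j, hj⟩, h⟩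
    · rintro ⟨j, h⟩; exact ⟨j, j.2, h⟩

section
variable {Ω : Type*} [MeasurableSpace Ω] {P : Measure Ω} {M : ℕ} {X : Fin M → Ω → ℝ}
  {Δ : Fin M → Fin M → ℝ} {s k : ℝ}

lemma GV.le_arProb (h : GV P X Δ) (hs : 0 ≤ s) (hk : 0 ≤ k) (hd : ∀ i, Δ i i = s)
    (hle : ∀ i j : Fin M, s * Real.exp (-(k * |((i : ℕ) : ℝ) - ((j : ℕ) : ℝ)|)) ≤ Δ i j) (L : ℝ) :
    P.real {ω | ∃ i, L < X i ω} ≤ arProb s k M L := by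
  obtain ⟨h1, h2⟩ := arProb_restrict s k hs hk M L
  rw [h2]
  exact slepian h h1 (fun i => by simp [hd]) hle L

lemma GV.arProb_le (h : GV P X Δ) (hs : 0 ≤ s) (hk : 0 ≤ k) (hd : ∀ i, Δ i i = s)
    (hle : ∀ i j : Fin M, Δ i j ≤ s * Real.exp (-(k * |((i : ℕ) : ℝ) - ((j : ℕ) : ℝ)|))) (L : ℝ) :
    arProb s k M L ≤ P.real {ω | ∃ i, L < X i ω} := by
  obtain ⟨h1, h2⟩ := arProb_restrict s k hs hk M L
  rw [h2]
  exact slepian h1 h (fun i => by simp [hd]) hle L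
end

-- part C3
/-- The energy threshold. -/
noncomputable def Lf (c v : ℝ) (n : ℕ) : ℝ := γseq c n * n + v / γseq c n

/-- The single-site exceedance probability. -/
noncomputable def q0 (c v : ℝ) (n : ℕ) : ℝ := Qf (Lf c v n / √n)

lemma q0_pos (c v : ℝ) (n : ℕ) : 0 < q0 c v n := Qf_pos _

lemma γ_pos (c : ℝ) {n : ℕ} (hn : 0 < n) : 0 < γseq c n := by
  unfold γseq; positivity

lemma γ_tendsto {c : ℝ} (hc : 0 < c) : Tendsto (γseq c) atTop (nhds 0) :=
  (tendsto_rpow_neg_atTop hc).comp tendsto_natCast_atTop_atTop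

lemma γ_pow (c r : ℝ) (n : ℕ) : (γseq c n) ^ r = (n : ℝ) ^ (-c * r) := by
  unfold γseq; rw [Real.rpow_mul (Nat.cast_nonneg n)]

lemma γ_sq_mul (c : ℝ) {n : ℕ} (hn : 0 < n) : γseq c n ^ 2 * n = (n : ℝ) ^ (1 - 2 * c) := by
  have h : (0 : ℝ) < n := by exact_mod_cast hn
  rw [← Real.rpow_natCast, γ_pow]
  nth_rewrite 2 [← Real.rpow_one (n : ℝ)]
  rw [← Real.rpow_add h]
  congr 1; push_cast; ring

lemma γ_sq_mul_tendsto {c : ℝ} (hc : c < 1 / 2) :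
    Tendsto (fun n : ℕ => γseq c n ^ 2 * n) atTop atTop := by
  have h := (tendsto_rpow_atTop (by linarith : 0 < 1 - 2 * c)).comp tendsto_natCast_atTop_atTop
  refine h.congr' ?_
  filter_upwards [eventually_gt_atTop 0] with n hn
  rw [γ_sq_mul c hn]; rfl

/-- `L/(γ n) → 1`. -/
lemma Lf_ratio {c : ℝ} (hc : c < 1 / 2) (v : ℝ) :
    Tendsto (fun n : ℕ => Lf c v n / (γseq c n * n)) atTop (nhds 1) := by
  have h := (tendsto_const_nhds (x := v)).div_atTop (γ_sq_mul_tendsto hc)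
  have h2 := h.const_add 1
  rw [add_zero] at h2
  refine h2.congr' ?_
  filter_upwards [eventually_gt_atTop 0] with n hn
  have := γ_pos c hn
  have h3 : (0 : ℝ) < n := by exact_mod_cast hn
  unfold Lf
  field_simp

lemma Lf_bounds {c : ℝ} (hc : c < 1 / 2) (v : ℝ) {η : ℝ} (hη : 0 < η) :
    ∀ᶠ n : ℕ in atTop, (1 - η) * (γseq c n * n) ≤ Lf c v n ∧
      Lf c v n ≤ (1 + η) * (γseq c n * n) := by
  have h1 := (Lf_ratio hc v).eventually (Icc_mem_nhds (by linarith : 1 - η < 1)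
    (by linarith : 1 < 1 + η))
  filter_upwards [h1, eventually_gt_atTop 0] with n hn h0
  have := γ_pos c h0
  have h3 : (0 : ℝ) < n := by exact_mod_cast h0
  obtain ⟨h4, h5⟩ := hn
  rw [le_div_iff₀ (by positivity)] at h4
  rw [div_le_iff₀ (by positivity)] at h5
  exact ⟨h4, h5⟩

/-- the scaled threshold tends to infinity -/
lemma Lf_sqrt_tendsto {c : ℝ} (hc : c < 1 / 2) (v : ℝ) :
    Tendsto (fun n : ℕ => Lf c v n / √n) atTop atTop := by
  have h1 : Tendsto (fun n : ℕ => √(γseq c n ^ 2 * n) / 2) atTop atTop :=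
    (Real.tendsto_sqrt_atTop.comp (γ_sq_mul_tendsto hc)).atTop_div_const (by norm_num)
  refine tendsto_atTop_mono' _ ?_ h1
  filter_upwards [Lf_bounds hc v (η := 1 / 2) (by norm_num), eventually_gt_atTop 0] with n hn h0
  have := γ_pos c h0
  have h3 : (0 : ℝ) < n := by exact_mod_cast h0
  rw [Real.sqrt_mul' _ h3.le, Real.sqrt_sq this.le, le_div_iff₀ (by positivity)]
  have := Real.mul_self_sqrt h3.le
  nlinarith [hn.1]

lemma q0_asymp {c : ℝ} (hc : c < 1 / 2) (v : ℝ) :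
    Tendsto (fun n : ℕ => aseq c n * γseq c n ^ 2 * q0 c v n) atTop (nhds (Real.exp (-v))) := by
  have h1 : Tendsto (fun n : ℕ => √(γseq c n ^ 2 * n)) atTop atTop :=
    (Real.tendsto_sqrt_atTop.comp (γ_sq_mul_tendsto hc))
  refine ((Qf_asymp v).comp h1).congr' ?_
  filter_upwards [eventually_gt_atTop 0] with n h0
  have hg := γ_pos c h0
  have h3 : (0 : ℝ) < n := by exact_mod_cast h0
  simp only [Function.comp]
  rw [Real.sq_sqrt (by positivity), Real.sqrt_mul' _ h3.le, Real.sqrt_sq hg.le]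
  unfold aseq q0 Lf
  rw [Real.sqrt_mul' _ h3.le]
  have h4 : (γseq c n * n + v / γseq c n) / √n = γseq c n * √n + v / (γseq c n * √n) := by
    have := Real.mul_self_sqrt h3.le
    have h5 : 0 < √(n : ℝ) := by positivity
    field_simp
    rw [Real.sq_sqrt h3.le]
  rw [h4]
  field_simp

/-- Upper asymptotics for the reference process. -/
lemma arProb_upper {c : ℝ} (hc0 : 0 < c) (hc : c < 1 / 2) (v : ℝ) {κ : ℝ} (hκ : 0 < κ) (M : ℕ → ℕ)
    (hM : Tendsto (fun n => (M n : ℝ) * γseq c n ^ 2) atTop atTop) {ε : ℝ} (hε : 0 < ε) :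
    ∀ᶠ n : ℕ in atTop, arProb n (κ / n) (M n) (Lf c v n) ≤
      (1 + ε) * (κ * M n * γseq c n ^ 2 * q0 c v n) := by
  -- choose η
  have hη : ∃ η : ℝ, 0 < η ∧ η < 1 ∧ (1 + η) ^ 3 / (1 - η) ≤ 1 + ε := by
    have h1 : Tendsto (fun η : ℝ => (1 + η) ^ 3 / (1 - η)) (nhds 0) (nhds 1) := by
      have : ContinuousAt (fun η : ℝ => (1 + η) ^ 3 / (1 - η)) 0 := by
        refine ContinuousAt.div (by fun_prop) (by fun_prop) (by norm_num)
      simpa [ContinuousAt] using this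
    have h2 := (h1.mono_left nhdsWithin_le_nhds).eventually
      (Iic_mem_nhds (by linarith : (1 : ℝ) < 1 + ε)) (l₁ := nhdsWithin 0 (Set.Ioi 0))
    have h3 : ∀ᶠ η : ℝ in nhdsWithin 0 (Set.Ioi 0), η < 1 :=
      nhdsWithin_le_nhds (Iio_mem_nhds (by norm_num))
    obtain ⟨η, h4, h5, h6⟩ := (h2.and (h3.and self_mem_nhdsWithin)).exists
    exact ⟨η, h6, h5, h4⟩
  obtain ⟨η, hη0, hη1, hηε⟩ := hη
  obtain ⟨A, hA⟩ := le_sum_Qf η hη0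
  have hM1 := hM.eventually_ge_atTop (2 * (8 * |A| / (κ * η) + 1 / η))
  filter_upwards [Lf_bounds hc v hη0, Lf_bounds hc v (η := 1 / 2) (by norm_num),
    eventually_gt_atTop 0, hM1, (γ_tendsto hc0).eventually (Iic_mem_nhds (zero_lt_one))]
    with n hn hn2 h0 hMn hgn
  have hg := γ_pos c h0
  have h3 : (0 : ℝ) < n := by exact_mod_cast h0
  set g := γseq c n with hgdef
  set L := Lf c v n with hL
  have hL0 : 0 < L := lt_of_lt_of_le (by norm_num; positivity) hn2.1
  have hAR := isAR_arY (n : ℝ) (κ / n) h3.le (by positivity) (2 * M n)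
  set h' := ⌊η * M n⌋₊ with hh
  have hh1 : (h' : ℝ) ≤ η * M n := Nat.floor_le (by positivity)
  have hh2 : η * M n - 1 ≤ h' := by linarith [Nat.lt_floor_add_one (η * (M n : ℝ))]
  have hle : h' ≤ M n := by
    have : (h' : ℝ) ≤ M n := hh1.trans (by nlinarith [Nat.cast_nonneg (α := ℝ) (M n)])
    exact_mod_cast this
  have hup := hAR.upper h3 (by positivity : 0 < κ / n) (L := L) hL0.le (M := M n) (h' := h')
    (by omega)
  set q := L ^ 2 * (κ / n) / (2 * n) with hq
  have hq0 : 0 < q := by positivity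
  have hqv : q = (L / (g * n)) ^ 2 * (κ * g ^ 2 / 2) := by
    rw [hq]; field_simp
  have hr1 : (1 / 2 : ℝ) ≤ L / (g * n) := by
    rw [le_div_iff₀ (by positivity)]; linarith [hn2.1]
  have hr2 : L / (g * n) ≤ 1 + η := by
    rw [div_le_iff₀ (by positivity)]; linarith [hn.2]
  have hqlow : κ * g ^ 2 / 8 ≤ q := by
    rw [hqv]
    have : (1 / 4 : ℝ) ≤ (L / (g * n)) ^ 2 := by nlinarith
    have h5 : 0 < κ * g ^ 2 := by positivity
    nlinarith
  have hqup : q ≤ (1 + η) ^ 2 * (κ * g ^ 2 / 2) := by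
    rw [hqv]; gcongr
  have hMpos : (0 : ℝ) < M n := by
    have : 0 < (M n : ℝ) * g ^ 2 := lt_of_lt_of_le (by positivity) hMn
    exact (pos_iff_pos_of_mul_pos this).2 (by positivity)
  have hAq : A ≤ q * h' := by
    refine (le_abs_self A).trans ?_
    have hgn' : g ≤ 1 := hgn
    have e1 : g ^ 2 ≤ 1 := pow_le_one₀ hg.le hgn'
    have e2 : κ * g ^ 2 / 8 * (η * M n - 1) ≤ q * h' := by
      have : 0 ≤ η * M n - 1 := by
        have e4 : 1 / η ≤ (M n : ℝ) := by
          calc 1 / η ≤ 2 * (8 * |A| / (κ * η) + 1 / η) := by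
                have : 0 ≤ 8 * |A| / (κ * η) := by positivity
                have : 0 < 1 / η := by positivity
                linarith
            _ ≤ _ := hMn
            _ ≤ M n * 1 := by gcongr
            _ = M n := by ring
        rw [div_le_iff₀ hη0] at e4; linarith
      gcongr
    have e5 : η * (2 * (8 * |A| / (κ * η) + 1 / η)) = 16 * |A| / κ + 2 := by field_simp; ring
    have e6 : 16 * |A| / κ + 2 ≤ η * (M n * g ^ 2) := by
      rw [← e5]; exact mul_le_mul_of_nonneg_left hMn hη0.le
    have e7 : 16 * |A| / κ ≤ η * (M n * g ^ 2) - g ^ 2 := by linarith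
    have e8 : κ / 8 * (16 * |A| / κ) = 2 * |A| := by field_simp; ring
    have e9 : κ / 8 * (16 * |A| / κ) ≤ κ / 8 * (η * (M n * g ^ 2) - g ^ 2) := by gcongr
    have := abs_nonneg A
    nlinarith
  have hS := hA q h' hq0 hAq
  have harp : arProb (n : ℝ) (κ / n) (M n) L * ((1 - η) / (2 * q)) ≤
      (M n + h') * Qf (L / √n) := by
    refine le_trans ?_ hup
    exact mul_le_mul_of_nonneg_left hS measureReal_nonneg
  have hq0' : q0 c v n = Qf (L / √n) := rfl
  rw [hq0']
  set Q := Qf (L / √n) with hQ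
  have hQ0 : 0 < Q := Qf_pos _
  have h1η : 0 < 1 - η := by linarith
  rw [mul_div_assoc', div_le_iff₀ (by positivity)] at harp
  have harp2 : arProb (n : ℝ) (κ / n) (M n) L ≤ (M n + h') * Q * (2 * q) / (1 - η) := by
    rw [le_div_iff₀ h1η]; exact harp
  calc _ ≤ (M n + h') * Q * (2 * q) / (1 - η) := harp2
    _ ≤ (M n + η * M n) * Q * (2 * ((1 + η) ^ 2 * (κ * g ^ 2 / 2))) / (1 - η) := by gcongr
    _ = (1 + η) ^ 3 / (1 - η) * (κ * M n * g ^ 2 * Q) := by field_simp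
    _ ≤ _ := by gcongr

-- part C4
lemma exp_lin_bounds {z : ℝ} (hz : 0 ≤ z) :
    z - z ^ 2 / 2 ≤ 1 - Real.exp (-z) ∧ 1 - Real.exp (-z) ≤ z := by
  constructor
  · have h := Real.quadratic_le_exp_of_nonneg hz
    have h2 : Real.exp (-z) = 1 / Real.exp z := by rw [Real.exp_neg]; ring
    rw [h2]
    have h3 : 1 / Real.exp z ≤ 1 / (1 + z + z ^ 2 / 2) :=
      one_div_le_one_div_of_le (by positivity) h
    have h4 : 1 / (1 + z + z ^ 2 / 2) ≤ 1 - z + z ^ 2 / 2 := by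
      rw [div_le_iff₀ (by positivity)]
      have : 0 ≤ z ^ 4 := by positivity
      nlinarith
    linarith
  · linarith [Real.add_one_le_exp (-z)]

lemma sum_exp_le (q : ℝ) (hq : 0 < q) (M : ℕ) :
    ∑ l ∈ range M, Real.exp (-(q * l)) ≤ 1 + 1 / q := by
  have h1 : ∀ l : ℕ, Real.exp (-(q * l)) = Real.exp (-q) ^ l := by
    intro l; rw [← Real.exp_nat_mul]; congr 1; ring
  simp only [h1]
  have hlt : Real.exp (-q) < 1 := by rw [Real.exp_lt_one_iff]; linarith
  have h2 : ∑ l ∈ range M, Real.exp (-q) ^ l ≤ (1 - Real.exp (-q))⁻¹ := by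
    rw [geom_sum_eq hlt.ne]
    rw [← neg_div_neg_eq, div_eq_mul_inv, neg_sub, neg_sub]
    have : 0 ≤ Real.exp (-q) ^ M := by positivity
    have h3 : 0 ≤ (1 - Real.exp (-q))⁻¹ := inv_nonneg.2 (by linarith)
    nlinarith
  refine h2.trans ?_
  have h4 : Real.exp (-q) ≤ 1 / (1 + q) := by
    rw [Real.exp_neg, inv_eq_one_div]
    exact one_div_le_one_div_of_le (by linarith) (by linarith [Real.add_one_le_exp q])
  have h5 : q / (1 + q) ≤ 1 - Real.exp (-q) := by
    have : q / (1 + q) = 1 - 1 / (1 + q) := by field_simp; ring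
    linarith
  calc (1 - Real.exp (-q))⁻¹ ≤ (q / (1 + q))⁻¹ := inv_anti₀ (by positivity) h5
    _ = 1 + 1 / q := by field_simp; ring

/-- deterministic bound for the return sum -/
lemma sum_arW_le {n L K κ g η : ℝ} {M : ℕ} (hn : 0 < n) (hκ : 0 < κ) (hg : 0 < g) (hη : 0 < η)
    (hη1 : η < 1) (hK : 0 ≤ K) (hL : (1 - η) * (g * n) ≤ L) (hL' : g * n / 2 ≤ L)
    (hz : κ * M / n ≤ η) (hKg : K * g ≤ η * κ * η / 4) :
    ∑ i ∈ range M, arW n (κ / n) L K i ≤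
      (η / g ^ 2 + 1) + 1 / ((1 - η) ^ 6 * κ * g ^ 2) := by
  have hL0 : 0 < L := lt_of_lt_of_le (by positivity) hL'
  have h1η : 0 < 1 - η := by linarith
  set q := (1 - η) ^ 4 * (L ^ 2 * κ / (2 * n ^ 2)) with hq
  have hq0 : 0 < q := by positivity
  have key : ∀ i ∈ range M, arW n (κ / n) L K i ≤
      (if (i : ℝ) < η / g ^ 2 then 1 else 0) + (if i = 0 then 0 else Qf (√(q * i))) := by
    intro i hi
    have hiM := Finset.mem_range.1 hi
    by_cases hi0 : i = 0
    · subst hi0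
      have : (0 : ℝ) < η / g ^ 2 := by positivity
      simp [arW, this]
    by_cases hil : (i : ℝ) < η / g ^ 2
    · simp only [arW, hi0, hil, if_true, if_false]
      linarith [Qf_le_one ((L - Real.exp (-(κ / n * i)) * (L + K)) /
        √(n * (1 - Real.exp (-(κ / n * i)) ^ 2))), Qf_nonneg (√(q * i))]
    · simp only [arW, hi0, hil, if_false, zero_add]
      apply Qf_anti
      push Not at hil
      have hip : (0 : ℝ) < i := by exact_mod_cast Nat.pos_of_ne_zero hi0
      set z := κ / n * i with hzd
      have hz0 : 0 < z := by positivity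
      have hzη : z ≤ η := by
        refine le_trans ?_ hz
        rw [hzd]
        have : (i : ℝ) ≤ M := by exact_mod_cast hiM.le
        calc κ / n * i ≤ κ / n * M := by gcongr
          _ = κ * M / n := by ring
      obtain ⟨hb1, hb2⟩ := exp_lin_bounds hz0.le
      set a := Real.exp (-z) with ha
      have ha0 : 0 < a := Real.exp_pos _
      have ha1 : a < 1 := by rw [Real.exp_lt_one_iff]; linarith
      have hKL : K ≤ η * (L * (1 - a)) := by
        have e1 : z / 2 ≤ 1 - a := by nlinarith
        have e2 : κ * η / (4 * g) ≤ L * (1 - a) := by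
          calc κ * η / (4 * g) = (g * n / 2) * ((κ / n * (η / g ^ 2)) / 2) := by field_simp; norm_num
            _ ≤ (g * n / 2) * (z / 2) := by rw [hzd]; gcongr
            _ ≤ L * (1 - a) := by gcongr
        calc K = K * g / g := by field_simp
          _ ≤ (η * κ * η / 4) / g := by gcongr
          _ = η * (κ * η / (4 * g)) := by field_simp
          _ ≤ _ := by gcongr
      have hnum : (1 - η) * (L * (1 - a)) ≤ L - a * (L + K) := by nlinarith
      have hden : 0 < n * (1 - a ^ 2) := by
        have : a ^ 2 < 1 := by nlinarith
        have : 0 < 1 - a ^ 2 := by linarith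
        positivity
      have h1a : 0 < 1 - a := by linarith
      refine le_trans ?_ (div_le_div_of_nonneg_right hnum (Real.sqrt_nonneg _))
      rw [le_div_iff₀ (Real.sqrt_pos.2 hden), ← Real.sqrt_mul (by positivity)]
      apply Real.sqrt_le_iff.2
      refine ⟨by positivity, ?_⟩
      have e3 : (1 - η) ^ 2 * z * (1 + a) ≤ 2 * (1 - a) := by
        have : (1 - η) ^ 2 ≤ 1 - z / 2 := by nlinarith
        have e4 : (1 - η) ^ 2 * z ≤ z - z ^ 2 / 2 := by nlinarith
        nlinarith
      have e5 : q * i * (n * (1 - a ^ 2)) = (1 - η) ^ 2 * L ^ 2 * (1 - a) / 2 *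
          ((1 - η) ^ 2 * z * (1 + a)) := by
        rw [hq, hzd]; field_simp; ring
      rw [e5]
      calc (1 - η) ^ 2 * L ^ 2 * (1 - a) / 2 * ((1 - η) ^ 2 * z * (1 + a))
          ≤ (1 - η) ^ 2 * L ^ 2 * (1 - a) / 2 * (2 * (1 - a)) := by gcongr
        _ = ((1 - η) * (L * (1 - a))) ^ 2 := by ring
  refine (Finset.sum_le_sum key).trans ?_
  rw [Finset.sum_add_distrib]
  gcongr
  · rw [← Finset.sum_filter, Finset.sum_const, nsmul_eq_mul, mul_one]
    have : (range M).filter (fun i : ℕ => (i : ℝ) < η / g ^ 2) ⊆ range ⌈η / g ^ 2⌉₊ := by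
      intro i hi
      simp only [Finset.mem_filter, Finset.mem_range] at hi ⊢
      exact Nat.lt_ceil.2 hi.2
    have h2 := Finset.card_le_card this
    rw [Finset.card_range] at h2
    have h3 : (⌈η / g ^ 2⌉₊ : ℝ) < η / g ^ 2 + 1 := Nat.ceil_lt_add_one (by positivity)
    have h4 : (((range M).filter (fun i : ℕ => (i : ℝ) < η / g ^ 2)).card : ℝ) ≤ ⌈η / g ^ 2⌉₊ := by
      exact_mod_cast h2
    linarith
  · have h2 : ∑ i ∈ range M, (if i = 0 then 0 else Qf (√(q * i))) ≤
        ∑ i ∈ Icc 1 M, Qf (√(q * i)) := by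
      have : ∑ i ∈ range M, (if i = 0 then 0 else Qf (√(q * i))) =
          ∑ i ∈ (range M).filter (fun i => ¬ i = 0), Qf (√(q * i)) := by
        rw [Finset.sum_filter]
        refine Finset.sum_congr rfl fun i _ => ?_
        by_cases h : i = 0 <;> simp [h]
      rw [this]
      refine Finset.sum_le_sum_of_subset_of_nonneg ?_ (fun _ _ _ => Qf_nonneg _)
      intro i hi
      simp only [Finset.mem_filter, Finset.mem_range, Finset.mem_Icc] at hi ⊢
      omega
    refine h2.trans ((sum_Qf_le q hq0 M).trans ?_)
    apply one_div_le_one_div_of_le (by positivity)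
    have : ((1 - η) * (g * n)) ^ 2 ≤ L ^ 2 := by gcongr
    calc (1 - η) ^ 6 * κ * g ^ 2 = 2 * ((1 - η) ^ 4 * (((1 - η) * (g * n)) ^ 2 * κ / (2 * n ^ 2))) := by
          field_simp
      _ ≤ 2 * q := by rw [hq]; gcongr

/-- bound on the contribution of the start -/
lemma ar_start {Ω : Type*} [MeasurableSpace Ω] {P : Measure Ω} {Y : ℕ → Ω → ℝ} {N M : ℕ}
    {n κ L : ℝ} (h : IsAR P Y N n (κ / n)) (hn : 0 < n) (hκ : 0 < κ) (hMN : M ≤ N)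
    (hL : 1 ≤ L / √n) (hz : κ * M / n ≤ 1) :
    ∑ l ∈ range M, P.real ({ω | L < Y 0 ω} ∩ {ω | L < Y l ω}) ≤
      2 * Qf (L / √n) * (1 + 1 / (L ^ 2 * κ / (8 * n ^ 2))) := by
  have hsn : 0 < √n := Real.sqrt_pos.2 hn
  have hL0 : 0 < L := by
    rw [le_div_iff₀ hsn] at hL; linarith
  have hq : 0 < L ^ 2 * κ / (8 * n ^ 2) := by positivity
  refine le_trans ?_ (mul_le_mul_of_nonneg_left (sum_exp_le _ hq M)
    (mul_nonneg zero_le_two (Qf_nonneg _)))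
  rw [Finset.mul_sum]
  refine Finset.sum_le_sum fun l hl => ?_
  have hl := Finset.mem_range.1 hl
  have h' : GV P _ _ := h
  set z := κ / n * l with hzd
  have hz0 : 0 ≤ z := by positivity
  have hz1 : z ≤ 1 := by
    refine le_trans ?_ hz
    rw [hzd]
    have : (l : ℝ) ≤ M := by exact_mod_cast hl.le
    calc κ / n * l ≤ κ / n * M := by gcongr
      _ = κ * M / n := by ring
  obtain ⟨hb1, hb2⟩ := exp_lin_bounds hz0
  set a := Real.exp (-z) with ha
  have ha0 : 0 < a := Real.exp_pos _
  have ha1 : a ≤ 1 := Real.exp_le_one_iff.2 (by linarith)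
  have hsum : n + n * a + n * a + n = 2 * n * (1 + a) := by ring
  have hpt := h'.pair_tail ⟨0, by omega⟩ ⟨l, by omega⟩ (by simp; positivity) L
  simp only [Nat.cast_zero, zero_sub, sub_zero, abs_neg, Nat.abs_cast, sub_self, abs_zero,
    mul_zero, neg_zero, Real.exp_zero, mul_one, ← hzd, ← ha, hsum] at hpt
  refine hpt.trans ?_
  have hy : L / √n ≤ 2 * L / √(2 * n * (1 + a)) := by
    rw [div_le_div_iff₀ hsn (Real.sqrt_pos.2 (by positivity))]
    have : √(2 * n * (1 + a)) ≤ 2 * √n := by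
      apply Real.sqrt_le_iff.2
      refine ⟨by positivity, ?_⟩
      rw [mul_pow, Real.sq_sqrt hn.le]; nlinarith
    nlinarith
  refine (Qf_mul_le _ _ hL hy).trans ?_
  gcongr
  · exact mul_nonneg zero_le_two (Qf_nonneg _)
  rw [div_pow, div_pow, Real.sq_sqrt hn.le, Real.sq_sqrt (by positivity)]
  have e1 : -((2 * L) ^ 2 / (2 * n * (1 + a)) - L ^ 2 / n) / 2 =
      -(L ^ 2 / (2 * n) * ((1 - a) / (1 + a))) := by
    field_simp; ring
  rw [e1, neg_le_neg_iff]
  have e2 : z / 4 ≤ (1 - a) / (1 + a) := by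
    rw [le_div_iff₀ (by positivity)]; nlinarith
  calc L ^ 2 * κ / (8 * n ^ 2) * l = L ^ 2 / (2 * n) * (z / 4) := by
        rw [hzd]; field_simp; ring
    _ ≤ _ := by gcongr


lemma ar_tiny {n κ g L K : ℝ} (hn : 0 < n) (hκ : 0 < κ) (hg : 0 < g) (hK : K = 1 / √g)
    (hL0 : 0 ≤ L) (hLup : L ≤ 2 * (g * n)) (f4 : κ / n ≤ 1 / 4) (f5 : g * √g ≤ 1 / (8 * κ)) :
    Qf ((Real.exp (-(κ / n)) * (L + K) - L) / √(n * (1 - Real.exp (-(κ / n)) ^ 2))) ≤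
      Real.exp (-(1 / (16 * κ)) * K ^ 2) := by
  have hsg : 0 < √g := Real.sqrt_pos.2 hg
  have hK0 : 0 < K := by rw [hK]; positivity
  have hk0 : 0 < κ / n := by positivity
  obtain ⟨b1, b2⟩ := exp_lin_bounds hk0.le
  have ha0 : 0 < Real.exp (-(κ / n)) := Real.exp_pos _
  have ha1 : Real.exp (-(κ / n)) < 1 := by rw [Real.exp_lt_one_iff]; linarith
  generalize Real.exp (-(κ / n)) = a at *
  have hnum : K / 2 ≤ a * (L + K) - L := by
    have e1 : L * (κ / n) ≤ K / 4 := by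
      calc L * (κ / n) ≤ 2 * (g * n) * (κ / n) := by gcongr
        _ = 2 * κ * ((g * √g) * K) := by rw [hK]; field_simp
        _ ≤ 2 * κ * ((1 / (8 * κ)) * K) := by gcongr
        _ = K / 4 := by field_simp; norm_num
    have e2 : L * (1 - a) ≤ L * (κ / n) := by gcongr
    have e3 : 3 / 4 * K ≤ a * K := by
      have : 3 / 4 ≤ a := by linarith
      gcongr
    linarith
  have hden : √(n * (1 - a ^ 2)) ≤ √(2 * κ) := by
    apply Real.sqrt_le_sqrt
    have : 1 - a ^ 2 ≤ 2 * (κ / n) := by nlinarith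
    calc n * (1 - a ^ 2) ≤ n * (2 * (κ / n)) := by gcongr
      _ = 2 * κ := by field_simp
  have hden0 : 0 < √(n * (1 - a ^ 2)) := by
    apply Real.sqrt_pos.2
    have : 0 < 1 - a ^ 2 := by nlinarith
    positivity
  have hK2 : 0 ≤ K / 2 := by positivity
  have harg : K / 2 / √(2 * κ) ≤ (a * (L + K) - L) / √(n * (1 - a ^ 2)) :=
    div_le_div₀ (hK2.trans hnum) hnum hden0 hden
  refine (Qf_anti harg).trans ((Qf_le_exp _ (by positivity)).trans ?_)
  apply Real.exp_le_exp.2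
  rw [div_pow, div_pow, Real.sq_sqrt (by positivity)]
  apply le_of_eq
  field_simp; norm_num

lemma ar_final {n κ g L η ε M T W Q p S : ℝ} (hn : 0 < n) (hκ : 0 < κ) (hg : 0 < g)
    (hη0 : 0 < η) (hη1 : η < 1) (hηε : (1 - ε) * (2 * η * κ + 1 / (1 - η) ^ 6) ≤ 1 - 2 * η)
    (hL0 : g * n / 2 ≤ L) (hM : 0 < M) (hQ : 0 < Q) (hp : 0 ≤ p) (f3 : g ^ 2 ≤ η)
    (f7 : 2 / η * (1 + 32 / κ) ≤ M * g ^ 2) (hMT : M * T ≤ η)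
    (hW : W ≤ (η / g ^ 2 + 1) + 1 / ((1 - η) ^ 6 * κ * g ^ 2))
    (hst : S ≤ 2 * Q * (1 + 1 / (L ^ 2 * κ / (8 * n ^ 2))))
    (hlow : M * Q ≤ p * W + M ^ 2 * (Q * T) + S) :
    (1 - ε) * (κ * M * g ^ 2 * Q) ≤ p := by
  have h1η : 0 < 1 - η := by linarith
  set E := 2 * η * κ + 1 / (1 - η) ^ 6 with hE
  have hE0 : 0 < E := by positivity
  have hg2 : 0 < g ^ 2 := by positivity
  have hWE : W ≤ E / (κ * g ^ 2) := by
    refine hW.trans ?_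
    have : 1 ≤ η / g ^ 2 := by rw [le_div_iff₀ hg2]; linarith
    have e : E / (κ * g ^ 2) = (η / g ^ 2 + η / g ^ 2) + 1 / ((1 - η) ^ 6 * κ * g ^ 2) := by
      rw [hE]; field_simp; ring
    rw [e]; gcongr
  have hS : S ≤ η * M * Q := by
    refine hst.trans ?_
    have e1 : κ * g ^ 2 / 32 ≤ L ^ 2 * κ / (8 * n ^ 2) := by
      calc κ * g ^ 2 / 32 = (g * n / 2) ^ 2 * κ / (8 * n ^ 2) := by field_simp; norm_num
        _ ≤ _ := by gcongr
    have e2 : 1 / (L ^ 2 * κ / (8 * n ^ 2)) ≤ 1 / (κ * g ^ 2 / 32) :=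
      one_div_le_one_div_of_le (by positivity) e1
    have e3 : 2 * (1 + 1 / (κ * g ^ 2 / 32)) ≤ η * M := by
      have e4 : 2 * (1 + 1 / (κ * g ^ 2 / 32)) = (2 * (g ^ 2 + 32 / κ)) / g ^ 2 := by field_simp
      rw [e4, div_le_iff₀ hg2]
      have e5 : η * (2 / η * (1 + 32 / κ)) ≤ η * (M * g ^ 2) := by gcongr
      have e6 : η * (2 / η * (1 + 32 / κ)) = 2 * (1 + 32 / κ) := by field_simp
      linarith
    calc _ ≤ 2 * Q * (1 + 1 / (κ * g ^ 2 / 32)) := by gcongr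
      _ = Q * (2 * (1 + 1 / (κ * g ^ 2 / 32))) := by ring
      _ ≤ Q * (η * M) := by gcongr
      _ = _ := by ring
  have hT : M ^ 2 * (Q * T) ≤ η * M * Q := by
    calc M ^ 2 * (Q * T) = M * Q * (M * T) := by ring
      _ ≤ M * Q * η := by gcongr
      _ = _ := by ring
  have h1 : (1 - 2 * η) * (M * Q) ≤ p * (E / (κ * g ^ 2)) := by
    have : p * W ≤ p * (E / (κ * g ^ 2)) := by gcongr
    linarith
  rw [mul_div_assoc', le_div_iff₀ (by positivity)] at h1
  have h2 : (1 - ε) * E * (M * Q * (κ * g ^ 2)) ≤ (1 - 2 * η) * (M * Q * (κ * g ^ 2)) := by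
    gcongr
  refine le_of_mul_le_mul_right ?_ hE0
  linarith

set_option maxHeartbeats 400000 in
/-- Lower asymptotics for the reference process. -/
lemma arProb_lower {c : ℝ} (hc0 : 0 < c) (hc : c < 1 / 2) (v : ℝ) {κ : ℝ} (hκ : 0 < κ) (M : ℕ → ℕ)
    (hM : Tendsto (fun n => (M n : ℝ) * γseq c n ^ 2) atTop atTop)
    (hMn : Tendsto (fun n => (M n : ℝ) / n) atTop (nhds 0)) {ε : ℝ} (hε : 0 < ε) :
    ∀ᶠ n : ℕ in atTop, (1 - ε) * (κ * M n * γseq c n ^ 2 * q0 c v n) ≤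
      arProb n (κ / n) (M n) (Lf c v n) := by
  have hη : ∃ η : ℝ, 0 < η ∧ η < 1 ∧ (1 - ε) * (2 * η * κ + 1 / (1 - η) ^ 6) ≤ 1 - 2 * η := by
    have h1 : Tendsto (fun η : ℝ => (1 - ε) * (2 * η * κ + 1 / (1 - η) ^ 6) - (1 - 2 * η)) (nhds 0)
        (nhds (-ε)) := by
      have : ContinuousAt (fun η : ℝ => (1 - ε) * (2 * η * κ + 1 / (1 - η) ^ 6) - (1 - 2 * η)) 0 := by
        have : ContinuousAt (fun η : ℝ => 1 / (1 - η) ^ 6) 0 :=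
          ContinuousAt.div (by fun_prop) (by fun_prop) (by norm_num)
        fun_prop
      simpa [ContinuousAt] using this
    have h2 := (h1.mono_left nhdsWithin_le_nhds).eventually
      (Iic_mem_nhds (by linarith : -ε < 0)) (l₁ := nhdsWithin 0 (Set.Ioi 0))
    have h3 : ∀ᶠ η : ℝ in nhdsWithin 0 (Set.Ioi 0), η < 1 :=
      nhdsWithin_le_nhds (Iio_mem_nhds (by norm_num))
    obtain ⟨η, h4, h5, h6⟩ := (h2.and (h3.and self_mem_nhdsWithin)).exists
    exact ⟨η, h6, h5, by have h4 : _ ≤ _ := h4; linarith⟩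
  obtain ⟨η, hη0, hη1, hηε⟩ := hη
  -- eventual facts
  have hγ := γ_tendsto hc0
  have hsq : Tendsto (fun n => √(γseq c n)) atTop (nhds 0) := by
    have := (Real.continuous_sqrt.tendsto 0).comp hγ
    rw [Real.sqrt_zero] at this
    exact this
  have f1 : ∀ᶠ n : ℕ in atTop, κ * M n / n ≤ η := by
    have := (hMn.const_mul κ).eventually (Iic_mem_nhds (by simpa using hη0 : κ * 0 < η))
    filter_upwards [this] with n h
    rw [mul_div_assoc]; exact h
  have f2 : ∀ᶠ n : ℕ in atTop, √(γseq c n) ≤ η * κ * η / 4 :=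
    hsq.eventually (Iic_mem_nhds (by positivity))
  have f3 : ∀ᶠ n : ℕ in atTop, γseq c n ^ 2 ≤ η := by
    have := (hγ.pow 2).eventually (Iic_mem_nhds (by simpa using hη0 : (0:ℝ) ^ 2 < η))
    exact this
  have f4 : ∀ᶠ n : ℕ in atTop, κ / n ≤ 1 / 4 :=
    (tendsto_const_nhds.div_atTop tendsto_natCast_atTop_atTop).eventually
      (Iic_mem_nhds (by norm_num))
  have f5 : ∀ᶠ n : ℕ in atTop, γseq c n * √(γseq c n) ≤ 1 / (8 * κ) := by
    have := (hγ.mul hsq).eventually (Iic_mem_nhds (by simp; positivity : (0:ℝ) * 0 < 1 / (8 * κ)))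
    exact this
  have f6 : ∀ᶠ n : ℕ in atTop, (n : ℝ) * Real.exp (-(1 / (16 * κ)) * (n : ℝ) ^ c) ≤ η * κ := by
    have h1 : Tendsto (fun x : ℝ => x ^ (1 / c) * Real.exp (-(1 / (16 * κ)) * x)) atTop (nhds 0) :=
      tendsto_rpow_mul_exp_neg_mul_atTop_nhds_zero _ _ (by positivity)
    have h2 := h1.comp ((tendsto_rpow_atTop hc0).comp tendsto_natCast_atTop_atTop)
    have h3 := h2.eventually (Iic_mem_nhds (by positivity : 0 < η * κ))
    filter_upwards [h3] with n h
    replace h : _ ≤ _ := h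
    simp only [Function.comp] at h
    rwa [← Real.rpow_mul (Nat.cast_nonneg n), mul_one_div_cancel hc0.ne', Real.rpow_one] at h
  have f7 := hM.eventually_ge_atTop (2 / η * (1 + 32 / κ))
  filter_upwards [Lf_bounds hc v hη0, Lf_bounds hc v (η := 1 / 2) (by norm_num),
    eventually_gt_atTop 0, f1, f2, f3, f4, f5, f6, f7,
    (Lf_sqrt_tendsto hc v).eventually_ge_atTop 1] with n hn hn2 h0 f1 f2 f3 f4 f5 f6 f7 f8
  have hg := γ_pos c h0
  have h3 : (0 : ℝ) < n := by exact_mod_cast h0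
  have hKval : (1 / √(γseq c n)) ^ 2 = (n : ℝ) ^ c := by
    rw [div_pow, Real.sq_sqrt hg.le, one_pow]
    unfold γseq
    rw [Real.rpow_neg h3.le]; field_simp
  set g := γseq c n with hgdef
  set L := Lf c v n with hL
  have hL0 : g * n / 2 ≤ L := by linarith [hn2.1]
  have hLup : L ≤ 2 * (g * n) := by
    have : 0 < g * n := by positivity
    linarith [hn2.2]
  have hsg : 0 < √g := Real.sqrt_pos.2 hg
  have hAR := isAR_arY (n : ℝ) (κ / n) h3.le (by positivity) (2 * M n)
  set K := 1 / √g with hK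
  have hK0 : 0 < K := by positivity
  have hKg : K * g ≤ η * κ * η / 4 := by
    have : K * g = √g := by
      rw [hK, one_div, inv_mul_eq_iff_eq_mul₀ hsg.ne']; exact (Real.mul_self_sqrt hg.le).symm
    rw [this]; exact f2
  have hlow := hAR.lower h3 (by positivity : 0 < κ / n) (L := L) hK0.le (M := M n) (by omega)
  have hW := sum_arW_le h3 hκ hg hη0 hη1 hK0.le hn.1 hL0 f1 hKg
  have hst := ar_start hAR h3 hκ (M := M n) (by omega) f8 (f1.trans hη1.le)
  -- tiny term
  have hT : Qf ((Real.exp (-(κ / n)) * (L + K) - L) / √(n * (1 - Real.exp (-(κ / n)) ^ 2))) ≤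
      Real.exp (-(1 / (16 * κ)) * (n : ℝ) ^ c) := by
    rw [← hKval]
    exact ar_tiny h3 hκ hg rfl (le_trans (by positivity) hL0) hLup f4 f5
  set T := Qf ((Real.exp (-(κ / n)) * (L + K) - L) / √(n * (1 - Real.exp (-(κ / n)) ^ 2)))
  set W := ∑ i ∈ range (M n), arW n (κ / n) L K i
  have hq0' : q0 c v n = Qf (L / √n) := rfl
  rw [hq0']
  set Q := Qf (L / √n) with hQ
  have hQ0 : 0 < Q := Qf_pos _
  have hPi : arProb n (κ / n) (M n) L = (multivariateGaussian 0 (arMat n (κ / n) (2 * M n))).real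
      {x | ∃ j < M n, L < arY (2 * M n) j x} := rfl
  rw [← hPi] at hlow
  have hMpos : (0 : ℝ) < M n := by
    have : 0 < (M n : ℝ) * g ^ 2 := lt_of_lt_of_le (by positivity) f7
    exact (pos_iff_pos_of_mul_pos this).2 (by positivity)
  have hMle : (M n : ℝ) * κ ≤ n := by
    rw [div_le_iff₀ h3, mul_comm κ] at f1
    exact f1.trans (mul_le_of_le_one_left h3.le hη1.le)
  have hMT : M n * T ≤ η := by
    have hE := Real.exp_pos (-(1 / (16 * κ)) * (n : ℝ) ^ c)
    have e1 : M n * T ≤ M n * Real.exp (-(1 / (16 * κ)) * (n : ℝ) ^ c) := by gcongr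
    refine e1.trans (le_of_mul_le_mul_right ?_ hκ)
    calc _ = (M n * κ) * Real.exp (-(1 / (16 * κ)) * (n : ℝ) ^ c) := by ring
      _ ≤ n * Real.exp (-(1 / (16 * κ)) * (n : ℝ) ^ c) := by gcongr
      _ ≤ _ := f6
  exact ar_final h3 hκ hg hη0 hη1 hηε hL0 hMpos hQ0 measureReal_nonneg f3 f7 hMT hW hst hlow

-- part D1
/-- Flip one coordinate. -/
def flipc {n : ℕ} (x : V n) (c : Fin n) : V n := Function.update x c (!x c)

lemma flipc_flipc {n : ℕ} (x : V n) (c : Fin n) : flipc (flipc x c) c = x := by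
  ext d
  by_cases h : d = c
  · subst h; simp [flipc]
  · simp [flipc, Function.update_of_ne h]

lemma dist_eq_one_iff {n : ℕ} (x y : V n) : hammingDist x y = 1 ↔ ∃ c, y = flipc x c := by
  constructor
  · intro h
    unfold hammingDist at h
    obtain ⟨c, hc⟩ := Finset.card_eq_one.1 h
    refine ⟨c, ?_⟩
    ext d
    have hd := Finset.ext_iff.1 hc d
    simp only [Finset.mem_filter, Finset.mem_univ, true_and, Finset.mem_singleton] at hd
    by_cases hdc : d = c
    · subst hdc
      have := hd.2 rfl
      simp only [flipc, Function.update_self]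
      revert this; cases x d <;> cases y d <;> simp
    · have : ¬ (x d ≠ y d) := fun h => hdc (hd.1 h)
      simp only [flipc, Function.update_of_ne hdc]
      push Not at this; rw [this]
  · rintro ⟨c, rfl⟩
    unfold hammingDist
    apply Finset.card_eq_one.2
    refine ⟨c, ?_⟩
    ext d
    simp only [Finset.mem_filter, Finset.mem_univ, true_and, Finset.mem_singleton]
    by_cases hdc : d = c
    · subst hdc; simp [flipc]
    · simp [flipc, Function.update_of_ne hdc, hdc]

lemma flipc_inj {n : ℕ} (x : V n) : Function.Injective (flipc x) := by
  intro c d h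
  by_contra hne
  have h1 := congrFun h c
  simp [flipc, Function.update_of_ne hne] at h1

lemma sum_nbr {n : ℕ} (x : V n) (f : V n → ℝ) :
    ∑ y, (if hammingDist x y = 1 then (n : ℝ)⁻¹ else 0) * f y = (n : ℝ)⁻¹ * ∑ c, f (flipc x c) := by
  classical
  rw [Finset.mul_sum]
  have : ∑ c, (n : ℝ)⁻¹ * f (flipc x c) = ∑ y ∈ univ.image (flipc x), (n : ℝ)⁻¹ * f y := by
    rw [Finset.sum_image (fun a _ b _ h => flipc_inj x h)]
  rw [this, ← Finset.sum_subset (Finset.subset_univ (univ.image (flipc x)))]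
  · refine Finset.sum_congr rfl fun y hy => ?_
    obtain ⟨c, -, rfl⟩ := Finset.mem_image.1 hy
    rw [if_pos ((dist_eq_one_iff _ _).2 ⟨c, rfl⟩)]
  · intro y _ hy
    rw [if_neg, zero_mul]
    intro h
    obtain ⟨c, rfl⟩ := (dist_eq_one_iff _ _).1 h
    exact hy (Finset.mem_image_of_mem _ (Finset.mem_univ c))

/-- Path weight. -/
noncomputable def wt (n m : ℕ) (xs : Fin (m + 1) → V n) : ℝ := ((2 : ℝ) ^ n)⁻¹ *
        ∏ k : Fin m, (if hammingDist (xs k.castSucc) (xs k.succ) = 1 then (n : ℝ)⁻¹ else 0)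

lemma wt_nonneg (n m : ℕ) (xs : Fin (m + 1) → V n) : 0 ≤ wt n m xs := by
  unfold wt
  refine mul_nonneg (by positivity) (Finset.prod_nonneg fun k _ => ?_)
  split_ifs <;> positivity

lemma wt_snoc (n m : ℕ) (xs : Fin (m + 1) → V n) (y : V n) :
    wt n (m + 1) (Fin.snoc (α := fun _ => V n) xs y) = wt n m xs *
      (if hammingDist (xs (Fin.last m)) y = 1 then (n : ℝ)⁻¹ else 0) := by
  unfold wt
  rw [Fin.prod_univ_castSucc, ← mul_assoc]
  congr 1
  · congr 1
    refine Finset.prod_congr rfl fun k _ => ?_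
    rw [Fin.succ_castSucc, Fin.snoc_castSucc, Fin.snoc_castSucc]
  · rw [Fin.succ_last, Fin.snoc_last, Fin.snoc_castSucc]

lemma sum_wt_succ (n m : ℕ) (f : (Fin (m + 2) → V n) → ℝ) :
    ∑ xs, wt n (m + 1) xs * f xs = ∑ xs : Fin (m + 1) → V n, wt n m xs *
      ((n : ℝ)⁻¹ * ∑ c, f (Fin.snoc (α := fun _ => V n) xs (flipc (xs (Fin.last m)) c))) := by
  rw [← (Fin.snocEquiv (fun _ : Fin (m + 2) => V n)).sum_comp, Fintype.sum_prod_type,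
    Finset.sum_comm]
  refine Finset.sum_congr rfl fun xs _ => ?_
  rw [← sum_nbr (xs (Fin.last m)) (fun y => f (Fin.snoc (α := fun _ => V n) xs y)), Finset.mul_sum]
  refine Finset.sum_congr rfl fun y _ => ?_
  have : (Fin.snocEquiv (fun _ : Fin (m + 2) => V n)) (y, xs) =
      Fin.snoc (α := fun _ => V n) xs y := rfl
  rw [this, wt_snoc]; ring

lemma sum_wt (n m : ℕ) (hn : 0 < n) : ∑ xs, wt n m xs = 1 := by
  induction m with
  | zero =>
    have : ∀ xs : Fin 1 → V n, wt n 0 xs = ((2 : ℝ) ^ n)⁻¹ := by intro xs; simp [wt]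
    simp only [this, Finset.sum_const, Finset.card_univ, Fintype.card_pi, Fintype.card_bool,
      Finset.prod_const, Fintype.card_fin, pow_one, nsmul_eq_mul]
    push_cast; field_simp
  | succ m ih =>
    have := sum_wt_succ n m (fun _ => 1)
    simp only [mul_one, Finset.sum_const, Finset.card_univ, Fintype.card_fin, nsmul_eq_mul] at this
    rw [this, ← ih]
    have h : (n : ℝ) ≠ 0 := by positivity
    simp [h]

/-- `J` is a simple random walk on the hypercube, uniformly started. -/
structure WK {Ω' : Type*} [MeasurableSpace Ω'] (Pw : Measure Ω') (n : ℕ) (J : ℕ → Ω' → V n) :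
    Prop where
  pos : 0 < n
  prob : IsProbabilityMeasure Pw
  meas : ∀ i, Measurable (J i)
  path : ∀ m (xs : Fin (m + 1) → V n),
    Pw.real {ω' | ∀ k : Fin (m + 1), J k ω' = xs k} = wt n m xs

section
variable {Ω' : Type*} [MeasurableSpace Ω'] {Pw : Measure Ω'} {n : ℕ} {J : ℕ → Ω' → V n}

lemma meas_path {e : ℕ → Ω' → ℝ} (hJ : ∀ i, Measurable (J i)) (he : ∀ i, Measurable (e i)) (m : ℕ)
    (xs : Fin (m + 1) → V n) (y : ℝ) : MeasurableSet
      {ω' | (∀ k : Fin (m + 1), J k ω' = xs k) ∧ (∀ k : Fin (m + 1), y < e k ω')} := by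
  have h1 : MeasurableSet {ω' | ∀ k : Fin (m + 1), J k ω' = xs k} := by
    rw [Set.ofPred_forall]
    exact MeasurableSet.iInter fun k => hJ k (measurableSet_singleton (xs k))
  have h2 : MeasurableSet {ω' | ∀ k : Fin (m + 1), y < e k ω'} := by
    rw [Set.ofPred_forall]
    exact MeasurableSet.iInter fun k => measurableSet_lt measurable_const (he k)
  exact h1.inter h2

/-- integral over paths -/
lemma integral_paths [IsProbabilityMeasure Pw] (hJ : ∀ i, Measurable (J i)) (m : ℕ)
    (F : (Fin (m + 1) → V n) → ℝ) :
    Integrable (fun ω' => F (fun k => J k ω')) Pw ∧ ∫ ω', F (fun k => J k ω') ∂Pw =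
      ∑ xs, Pw.real {ω' | ∀ k : Fin (m + 1), J k ω' = xs k} * F xs := by
  have hX : Measurable (fun ω' (k : Fin (m + 1)) => J k ω') := measurable_pi_lambda _ fun k => hJ k
  have hF : Measurable F := measurable_of_finite F
  have := Measure.isProbabilityMeasure_map (μ := Pw) hX.aemeasurable
  have hintg : Integrable F (Pw.map (fun ω' (k : Fin (m + 1)) => J k ω')) := Integrable.of_finite
  refine ⟨(integrable_map_measure hF.aestronglyMeasurable hX.aemeasurable).1 hintg, ?_⟩
  rw [← integral_map (f := F) hX.aemeasurable hF.aestronglyMeasurable, integral_fintype hintg]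
  refine Finset.sum_congr rfl fun xs _ => ?_
  rw [smul_eq_mul, map_measureReal_apply hX (measurableSet_singleton xs)]
  congr 2
  ext ω'
  simp [funext_iff]

end

lemma WK_of_law {Ω' : Type*} [MeasurableSpace Ω'] (Pw : Measure Ω') [IsProbabilityMeasure Pw]
    (J : (n : ℕ) → ℕ → Ω' → V n) (e : ℕ → ℕ → Ω' → ℝ)
    (hJmeas : ∀ n i, Measurable (J n i)) (hemeas : ∀ n i, Measurable (e n i))
    (hlaw : WalkExpLaw Pw J e) (n : ℕ) (hn : 0 < n) : WK Pw n (J n) := by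
  refine ⟨hn, inferInstance, hJmeas n, fun m => ?_⟩
  have h1 : ∀ xs : Fin (m + 1) → V n, wt n m xs ≤
      Pw.real {ω' | ∀ k : Fin (m + 1), J n k ω' = xs k} := by
    intro xs
    have := hlaw n m xs (fun _ => 0) (fun _ => le_rfl)
    simp only [Finset.sum_const_zero, neg_zero, Real.exp_zero, ENNReal.ofReal_one, mul_one] at this
    have h2 : wt n m xs = Pw.real {ω' | (∀ k : Fin (m + 1), J n k ω' = xs k) ∧
        (∀ k : Fin (m + 1), 0 < e n k ω')} := by
      rw [Measure.real, this, ENNReal.toReal_ofReal]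
      · rfl
      · exact wt_nonneg n m xs
    rw [h2]
    exact measureReal_mono (fun ω' h => h.1)
  have h2 := (integral_paths (Pw := Pw) (hJmeas n) m (fun _ => 1)).2
  simp only [mul_one, integral_const, probReal_univ, smul_eq_mul] at h2
  have h3 := sum_wt n m hn
  intro xs
  have h4 := (Finset.sum_eq_sum_iff_of_le (fun xs (_ : xs ∈ univ) => h1 xs)).1 (h3.trans h2)
  exact (h4 xs (Finset.mem_univ _)).symm

/-- law of the exponentials jointly with the path -/
lemma law_exp {Ω' : Type*} [MeasurableSpace Ω'] (Pw : Measure Ω') [IsProbabilityMeasure Pw]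
    (J : (n : ℕ) → ℕ → Ω' → V n) (e : ℕ → ℕ → Ω' → ℝ)
    (hlaw : WalkExpLaw Pw J e) (n m : ℕ) (xs : Fin (m + 1) → V n) (ys : Fin (m + 1) → ℝ)
    (hy : ∀ k, 0 ≤ ys k) :
    Pw.real {ω' | (∀ k : Fin (m + 1), J n k ω' = xs k) ∧
      (∀ k : Fin (m + 1), ys k < e n k ω')} = wt n m xs * Real.exp (-∑ k, ys k) := by
  rw [Measure.real, hlaw n m xs ys hy, ENNReal.toReal_mul, ENNReal.toReal_ofReal,
    ENNReal.toReal_ofReal (Real.exp_pos _).le]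
  · rfl
  · exact wt_nonneg n m xs

namespace WK
variable {Ω' : Type*} [MeasurableSpace Ω'] {Pw : Measure Ω'} {n : ℕ} {J : ℕ → Ω' → V n}

lemma integrable (h : WK Pw n J) (m : ℕ) (F : (Fin (m + 1) → V n) → ℝ) :
    Integrable (fun ω' => F (fun k => J k ω')) Pw :=
  have := h.prob
  (integral_paths h.meas m F).1

lemma integral_eq (h : WK Pw n J) (m : ℕ) (F : (Fin (m + 1) → V n) → ℝ) :
    ∫ ω', F (fun k => J k ω') ∂Pw = ∑ xs, wt n m xs * F xs := by
  have := h.prob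
  rw [(integral_paths h.meas m F).2]
  exact Finset.sum_congr rfl fun xs _ => by rw [h.path]

lemma integrable2 (h : WK Pw n J) (i j : ℕ) (F : V n → V n → ℝ) :
    Integrable (fun ω' => F (J i ω') (J j ω')) Pw :=
  h.integrable (max i j) (fun xs => F (xs ⟨i, by omega⟩) (xs ⟨j, by omega⟩))

lemma step (h : WK Pw n J) (i m : ℕ) (him : i ≤ m) (F : V n → V n → ℝ) :
    ∫ ω', F (J i ω') (J (m + 1) ω') ∂Pw =
      ∫ ω', (n : ℝ)⁻¹ * ∑ c, F (J i ω') (flipc (J m ω') c) ∂Pw := by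
  have h1 := h.integral_eq (m + 1) (fun xs => F (xs ⟨i, by omega⟩) (xs (Fin.last _)))
  have h2 := h.integral_eq m (fun xs => (n : ℝ)⁻¹ * ∑ c, F (xs ⟨i, by omega⟩)
    (flipc (xs (Fin.last _)) c))
  have e1 : ∫ ω', F (J i ω') (J (m + 1) ω') ∂Pw = _ := h1
  have e2 : ∫ ω', (n : ℝ)⁻¹ * ∑ c, F (J i ω') (flipc (J m ω') c) ∂Pw = _ := h2
  rw [e1, e2, sum_wt_succ]
  refine Finset.sum_congr rfl fun xs _ => ?_
  congr 2
  refine Finset.sum_congr rfl fun c _ => ?_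
  rw [Fin.snoc_last]
  have : (⟨i, by omega⟩ : Fin (m + 2)) = Fin.castSucc (⟨i, by omega⟩ : Fin (m + 1)) := rfl
  rw [this, Fin.snoc_castSucc]

lemma marg (h : WK Pw n J) (j : ℕ) (x : V n) : Pw.real {ω' | J j ω' = x} = ((2 : ℝ) ^ n)⁻¹ := by
  classical
  have := h.prob
  have key : ∀ j x, Pw.real {ω' | J j ω' = x} = ∫ ω', (if J j ω' = x then (1 : ℝ) else 0) ∂Pw := by
    intro j x
    have hm : MeasurableSet {ω' | J j ω' = x} := h.meas j (measurableSet_singleton x)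
    rw [← integral_indicator_one hm]
    congr 1
    ext ω'
    simp [Set.indicator_apply]
  induction j generalizing x with
  | zero =>
    have h1 := h.path 0 (fun _ => x)
    simp only [wt, Finset.univ_eq_empty, Finset.prod_empty, mul_one] at h1
    rw [← h1]
    congr 1
    ext ω'
    simp
  | succ j ih =>
    rw [key, h.step j j le_rfl (fun _ y => if y = x then (1 : ℝ) else 0), integral_const_mul,
      integral_finsetSum _ (fun c _ => h.integrable2 j j
        (fun _ y => if flipc y c = x then (1 : ℝ) else 0))]
    have : ∀ c, ∫ ω', (if flipc (J j ω') c = x then (1 : ℝ) else 0) ∂Pw = ((2 : ℝ) ^ n)⁻¹ := by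
      intro c
      rw [← ih (flipc x c), key]
      congr 1; ext ω'
      congr 1
      apply propext
      constructor
      · rintro rfl; rw [flipc_flipc]
      · intro h; rw [h, flipc_flipc]
    simp only [this, Finset.sum_const, Finset.card_univ, Fintype.card_fin, nsmul_eq_mul]
    have : (n : ℝ) ≠ 0 := by have := h.pos; positivity
    field_simp

end WK

-- part D2
lemma dist_flipc {n : ℕ} (x z : V n) (c : Fin n) :
    hammingDist x (flipc z c) = if x c = z c then hammingDist x z + 1 else hammingDist x z - 1 := by
  classical
  unfold hammingDist
  by_cases h : x c = z c
  · rw [if_pos h]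
    have : univ.filter (fun i => x i ≠ flipc z c i) = insert c (univ.filter (fun i => x i ≠ z i)) := by
      ext d
      simp only [Finset.mem_filter, Finset.mem_univ, true_and, Finset.mem_insert]
      by_cases hdc : d = c
      · subst hdc; simp [flipc, h]
      · simp [flipc, Function.update_of_ne hdc, hdc]
    rw [this, Finset.card_insert_of_notMem (by simp [h])]
  · rw [if_neg h]
    have : univ.filter (fun i => x i ≠ flipc z c i) = (univ.filter (fun i => x i ≠ z i)).erase c := by
      ext d
      simp only [Finset.mem_filter, Finset.mem_univ, true_and, Finset.mem_erase]
      by_cases hdc : d = c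
      · subst hdc
        simp only [flipc, Function.update_self, ne_eq, not_true_eq_false, false_and, iff_false,
          not_not]
        revert h; cases x d <;> cases z d <;> simp
      · simp [flipc, Function.update_of_ne hdc, hdc]
    rw [this, Finset.card_erase_of_mem (by simp [h])]

lemma hd_le {n : ℕ} (x z : V n) : hammingDist x z ≤ n := by
  simpa using hammingDist_le_card_fintype (x := x) (y := z)

lemma sum_dist_flipc {n : ℕ} (hn : 0 < n) (x z : V n) (g : ℕ → ℝ) :
    (n : ℝ)⁻¹ * ∑ c, g (hammingDist x (flipc z c)) =
      (1 - (hammingDist x z : ℝ) / n) * g (hammingDist x z + 1) +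
        (hammingDist x z : ℝ) / n * g (hammingDist x z - 1) := by
  classical
  have hn' : (n : ℝ) ≠ 0 := by positivity
  have h1 : ∀ c, g (hammingDist x (flipc z c)) = if x c ≠ z c then g (hammingDist x z - 1) else
      g (hammingDist x z + 1) := by
    intro c; rw [dist_flipc]; by_cases h : x c = z c <;> simp [h]
  simp only [h1]
  rw [Finset.sum_ite, Finset.sum_const, Finset.sum_const]
  have h2 : (univ.filter (fun c => x c ≠ z c)).card = hammingDist x z := rfl
  have h3 : (univ.filter (fun c => ¬ (x c ≠ z c))).card = n - hammingDist x z := by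
    have := Finset.card_filter_add_card_filter_not (s := (univ : Finset (Fin n)))
      (fun c => x c ≠ z c)
    rw [h2, Finset.card_univ, Fintype.card_fin] at this
    omega
  rw [h2, h3, nsmul_eq_mul, nsmul_eq_mul, Nat.cast_sub (hd_le x z)]
  field_simp
  ring

namespace WK
variable {Ω' : Type*} [MeasurableSpace Ω'] {Pw : Measure Ω'} {n : ℕ} {J : ℕ → Ω' → V n}

lemma int_dist (h : WK Pw n J) (i j : ℕ) (g : ℕ → ℝ) :
    Integrable (fun ω' => g (hammingDist (J i ω') (J j ω'))) Pw :=
  h.integrable2 i j (fun x y => g (hammingDist x y))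

lemma step_dist (h : WK Pw n J) (i k : ℕ) (g : ℕ → ℝ) :
    ∫ ω', g (hammingDist (J i ω') (J (i + (k + 1)) ω')) ∂Pw =
      ∫ ω', ((1 - (hammingDist (J i ω') (J (i + k) ω') : ℝ) / n) *
          g (hammingDist (J i ω') (J (i + k) ω') + 1) +
        (hammingDist (J i ω') (J (i + k) ω') : ℝ) / n *
          g (hammingDist (J i ω') (J (i + k) ω') - 1)) ∂Pw := by
  rw [← add_assoc, h.step i (i + k) (by omega) (fun x y => g (hammingDist x y))]
  congr 1; ext ω'
  exact sum_dist_flipc h.pos _ _ g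

lemma adj (h : WK Pw n J) : ∀ᵐ ω' ∂Pw, ∀ m, hammingDist (J m ω') (J (m + 1) ω') = 1 := by
  rw [ae_all_iff]
  intro m
  have h1 := h.step_dist m 0 (fun d => if d = 1 then 0 else 1)
  simp only [zero_add, add_zero, hammingDist_self, if_true, Nat.cast_zero, zero_div,
    zero_mul, mul_zero, integral_zero] at h1
  have h2 := (integral_eq_zero_iff_of_nonneg (fun ω' => by positivity)
    (h.int_dist m (m + 1) (fun d => if d = 1 then 0 else 1))).1 h1
  filter_upwards [h2] with ω' hω
  by_contra hne
  simp [hne] at hω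

lemma dist_le (h : WK Pw n J) : ∀ᵐ ω' ∂Pw, ∀ i k, hammingDist (J i ω') (J (i + k) ω') ≤ k := by
  filter_upwards [h.adj] with ω' hω i k
  induction k with
  | zero => simp
  | succ k ih =>
    have := hammingDist_triangle (J i ω') (J (i + k) ω') (J (i + (k + 1)) ω')
    have h2 := hω (i + k)
    rw [add_assoc] at h2
    omega

end WK

lemma mgf_factor {μ t : ℝ} (hμ : 0 ≤ μ) (hμ1 : μ ≤ 1 / 4) (ht0 : 0 ≤ t) (ht : t ≤ 1 / 4) :
    (1 - t) * Real.exp (-μ) + t * Real.exp μ ≤ 1 - μ / 4 := by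
  have h1 : Real.exp (-μ) ≤ 1 - μ + μ ^ 2 / 2 := by linarith [(exp_lin_bounds hμ).1]
  have h2 : Real.exp μ ≤ 1 + μ + μ ^ 2 := by
    have := Real.abs_exp_sub_one_sub_id_le (x := μ) (by rw [abs_of_nonneg hμ]; linarith)
    have := (abs_le.1 this).2
    linarith
  have h3 : Real.exp (-μ) ≤ Real.exp μ := Real.exp_le_exp.2 (by linarith)
  nlinarith

lemma mgf_factor2 {μ t : ℝ} (hμ : 0 ≤ μ) (hμ1 : μ ≤ 1 / 4) (ht0 : 0 ≤ t) (ht : t ≤ 1) :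
    (1 - t) * Real.exp (-μ) + t * Real.exp μ ≤ 2 := by
  have h2 : Real.exp μ ≤ 1 + μ + μ ^ 2 := by
    have := Real.abs_exp_sub_one_sub_id_le (x := μ) (by rw [abs_of_nonneg hμ]; linarith)
    have := (abs_le.1 this).2
    linarith
  have h3 : Real.exp (-μ) ≤ Real.exp μ := Real.exp_le_exp.2 (by linarith)
  nlinarith

/-- one-step drift inequality -/
lemma drift {μ N d : ℝ} (hμ : 0 ≤ μ) (hμ1 : μ ≤ 1 / 4) (hN : 0 < N) (hd : 0 ≤ d) (hdN : d ≤ N) :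
    (1 - d / N) * Real.exp (-(μ * (d + 1))) + d / N * Real.exp (-(μ * (d - 1))) ≤
      (1 - μ / 4) * Real.exp (-(μ * d)) + 2 * Real.exp (-(μ * N / 4)) := by
  have e : (1 - d / N) * Real.exp (-(μ * (d + 1))) + d / N * Real.exp (-(μ * (d - 1))) =
      Real.exp (-(μ * d)) * ((1 - d / N) * Real.exp (-μ) + d / N * Real.exp μ) := by
    rw [show -(μ * (d + 1)) = -(μ * d) + -μ by ring, show -(μ * (d - 1)) = -(μ * d) + μ by ring,
      Real.exp_add, Real.exp_add]; ring
  rw [e]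
  have hE := Real.exp_pos (-(μ * d))
  have hE2 := Real.exp_pos (-(μ * N / 4))
  have ht0 : 0 ≤ d / N := by positivity
  have ht1 : d / N ≤ 1 := (div_le_one hN).2 hdN
  rcases le_total (d / N) (1 / 4) with ht | ht
  · have := mgf_factor hμ hμ1 ht0 ht
    nlinarith
  · have h1 := mgf_factor2 hμ hμ1 ht0 ht1
    have h2 : Real.exp (-(μ * d)) ≤ Real.exp (-(μ * N / 4)) := by
      apply Real.exp_le_exp.2
      rw [le_div_iff₀ hN] at ht
      nlinarith
    have : 0 ≤ (1 - μ / 4) * Real.exp (-(μ * d)) := mul_nonneg (by linarith) hE.le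
    nlinarith

lemma rec_bound {μ E : ℝ} (hμ : 0 < μ) (hμ1 : μ ≤ 1 / 4) (u : ℕ → ℝ) (h0 : u 0 ≤ 1)
    (hE : 0 ≤ E) (hs : ∀ k, u (k + 1) ≤ (1 - μ / 4) * u k + 2 * E) (k : ℕ) :
    u k ≤ Real.exp (-(μ * k / 4)) + 8 / μ * E := by
  have h1 : ∀ k, u k ≤ (1 - μ / 4) ^ k + 8 / μ * E := by
    intro k
    induction k with
    | zero =>
      have : 0 ≤ 8 / μ * E := by positivity
      simp; linarith
    | succ k ih =>
      refine (hs k).trans ?_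
      have h2 : (1 - μ / 4) * u k ≤ (1 - μ / 4) * ((1 - μ / 4) ^ k + 8 / μ * E) :=
        mul_le_mul_of_nonneg_left ih (by linarith)
      have h3 : (1 - μ / 4) * ((1 - μ / 4) ^ k + 8 / μ * E) + 2 * E =
          (1 - μ / 4) ^ (k + 1) + 8 / μ * E := by field_simp; ring
      linarith
  refine (h1 k).trans ?_
  gcongr
  have : 1 - μ / 4 ≤ Real.exp (-(μ / 4)) := by linarith [Real.add_one_le_exp (-(μ / 4))]
  calc (1 - μ / 4) ^ k ≤ Real.exp (-(μ / 4)) ^ k := pow_le_pow_left₀ (by linarith) this k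
    _ = _ := by rw [← Real.exp_nat_mul]; congr 1; ring

namespace WK
variable {Ω' : Type*} [MeasurableSpace Ω'] {Pw : Measure Ω'} {n : ℕ} {J : ℕ → Ω' → V n}

lemma mgf_near (h : WK Pw n J) {μ : ℝ} (hμ : 0 < μ) (hμ1 : μ ≤ 1 / 4) (i k : ℕ) :
    ∫ ω', Real.exp (-(μ * hammingDist (J i ω') (J (i + k) ω'))) ∂Pw ≤
      Real.exp (-(μ * k / 4)) + 8 / μ * Real.exp (-(μ * n / 4)) := by
  have := h.prob
  have hn : (0 : ℝ) < n := by exact_mod_cast h.pos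
  refine rec_bound hμ hμ1
    (fun k => ∫ ω', Real.exp (-(μ * hammingDist (J i ω') (J (i + k) ω'))) ∂Pw) ?_
    (Real.exp_pos _).le (fun k => ?_) k
  · simp
  · rw [h.step_dist i k (fun d => Real.exp (-(μ * d)))]
    have e : (1 - μ / 4) * ∫ ω', Real.exp (-(μ * hammingDist (J i ω') (J (i + k) ω'))) ∂Pw +
        2 * Real.exp (-(μ * n / 4)) =
        ∫ ω', ((1 - μ / 4) * Real.exp (-(μ * hammingDist (J i ω') (J (i + k) ω'))) +
        2 * Real.exp (-(μ * n / 4))) ∂Pw := by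
      rw [integral_add ((h.int_dist i (i + k) (fun d => Real.exp (-(μ * d)))).const_mul _)
        (integrable_const _), integral_const_mul]
      simp
    rw [e]
    refine integral_mono (h.int_dist i (i + k) (fun d => (1 - (d : ℝ) / n) *
      Real.exp (-(μ * (d + 1 : ℕ))) + (d : ℝ) / n * Real.exp (-(μ * (d - 1 : ℕ)))))
      (h.int_dist i (i + k) (fun d => (1 - μ / 4) * Real.exp (-(μ * d)) +
        2 * Real.exp (-(μ * n / 4)))) (fun ω' => ?_)
    have hd := hd_le (J i ω') (J (i + k) ω')
    generalize hammingDist (J i ω') (J (i + k) ω') = d at hd ⊢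
    have hd' : (d : ℝ) ≤ n := by exact_mod_cast hd
    refine le_trans (le_of_eq ?_) (drift hμ.le hμ1 hn (Nat.cast_nonneg d) hd')
    rcases Nat.eq_zero_or_pos d with h0 | h0
    · subst h0; simp
    · push_cast [Nat.cast_sub (Nat.succ_le_of_lt h0)]; simp

lemma mgf_far (h : WK Pw n J) {μ : ℝ} (hμ : 0 < μ) (hμ1 : μ ≤ 1 / 4) (i k : ℕ) :
    ∫ ω', Real.exp (-(μ * ((n : ℝ) - hammingDist (J i ω') (J (i + k) ω')))) ∂Pw ≤
      Real.exp (-(μ * k / 4)) + 8 / μ * Real.exp (-(μ * n / 4)) := by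
  have := h.prob
  have hn : (0 : ℝ) < n := by exact_mod_cast h.pos
  refine rec_bound hμ hμ1
    (fun k => ∫ ω', Real.exp (-(μ * ((n : ℝ) - hammingDist (J i ω') (J (i + k) ω')))) ∂Pw) ?_
    (Real.exp_pos _).le (fun k => ?_) k
  · simp; positivity
  · rw [h.step_dist i k (fun d => Real.exp (-(μ * ((n : ℝ) - d))))]
    have e : (1 - μ / 4) * ∫ ω', Real.exp (-(μ * ((n : ℝ) - hammingDist (J i ω') (J (i + k) ω')))) ∂Pw +
        2 * Real.exp (-(μ * n / 4)) =
        ∫ ω', ((1 - μ / 4) * Real.exp (-(μ * ((n : ℝ) - hammingDist (J i ω') (J (i + k) ω')))) +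
        2 * Real.exp (-(μ * n / 4))) ∂Pw := by
      rw [integral_add ((h.int_dist i (i + k) (fun d => Real.exp (-(μ * ((n : ℝ) - d))))).const_mul _)
        (integrable_const _), integral_const_mul]
      simp
    rw [e]
    refine integral_mono (h.int_dist i (i + k) (fun d => (1 - (d : ℝ) / n) *
      Real.exp (-(μ * ((n : ℝ) - (d + 1 : ℕ)))) + (d : ℝ) / n *
        Real.exp (-(μ * ((n : ℝ) - (d - 1 : ℕ))))))
      (h.int_dist i (i + k) (fun d => (1 - μ / 4) * Real.exp (-(μ * ((n : ℝ) - d))) +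
        2 * Real.exp (-(μ * n / 4)))) (fun ω' => ?_)
    have hd := hd_le (J i ω') (J (i + k) ω')
    generalize hammingDist (J i ω') (J (i + k) ω') = d at hd ⊢
    have hd' : (d : ℝ) ≤ n := by exact_mod_cast hd
    have hd0 : (0 : ℝ) ≤ d := Nat.cast_nonneg d
    refine le_trans (le_of_eq ?_) (drift hμ.le hμ1 hn (d := (n : ℝ) - d) (by linarith) (by linarith))
    have e1 : 1 - ((n : ℝ) - d) / n = d / n := by field_simp; ring
    have e2 : ((n : ℝ) - d) / n = 1 - d / n := by field_simp
    rw [e1, e2, add_comm]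
    rcases Nat.eq_zero_or_pos d with h0 | h0
    · subst h0; simp
    · push_cast [Nat.cast_sub (Nat.succ_le_of_lt h0)]
      congr 3 <;> ring_nf

/-- short-time moment generating function -/
lemma mgf_short (h : WK Pw n J) {lam : ℝ} (m : ℕ) (i k : ℕ) (hk : k ≤ m) (hl : 0 ≤ lam) :
    ∫ ω', Real.exp (-(lam * hammingDist (J i ω') (J (i + k) ω'))) ∂Pw ≤
      (Real.exp (-lam) + m / n * Real.exp lam) ^ k := by
  have := h.prob
  have hn : (0 : ℝ) < n := by exact_mod_cast h.pos
  induction k with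
  | zero => simp
  | succ k ih =>
    rw [h.step_dist i k (fun d => Real.exp (-(lam * d))), pow_succ]
    refine le_trans ?_ (mul_le_mul_of_nonneg_right (ih (by omega)) (by positivity))
    rw [← integral_mul_const]
    refine integral_mono_ae (h.int_dist i (i + k) (fun d => (1 - (d : ℝ) / n) *
      Real.exp (-(lam * (d + 1 : ℕ))) + (d : ℝ) / n * Real.exp (-(lam * (d - 1 : ℕ)))))
      ((h.int_dist i (i + k) (fun d => Real.exp (-(lam * d)))).mul_const _) ?_
    filter_upwards [h.dist_le] with ω' hω
    have hd := hω i k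
    have hdn := hd_le (J i ω') (J (i + k) ω')
    generalize hammingDist (J i ω') (J (i + k) ω') = d at hd hdn ⊢
    have hd' : (d : ℝ) ≤ m := by exact_mod_cast (by omega : d ≤ m)
    have e : (1 - (d : ℝ) / n) * Real.exp (-(lam * (d + 1 : ℕ))) +
        (d : ℝ) / n * Real.exp (-(lam * (d - 1 : ℕ))) =
        Real.exp (-(lam * d)) * ((1 - d / n) * Real.exp (-lam) + d / n * Real.exp lam) := by
      rcases Nat.eq_zero_or_pos d with h0 | h0
      · subst h0; simp
      · push_cast [Nat.cast_sub (Nat.succ_le_of_lt h0)]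
        rw [show -(lam * ((d : ℝ) + 1)) = -(lam * d) + -lam by ring,
          show -(lam * ((d : ℝ) - 1)) = -(lam * d) + lam by ring, Real.exp_add, Real.exp_add]; ring
    rw [e]
    gcongr
    have h1 : (1 - (d : ℝ) / n) ≤ 1 := by
      have : 0 ≤ (d : ℝ) / n := by positivity
      linarith
    exact mul_le_of_le_one_left (Real.exp_pos _).le h1

lemma short_tail (h : WK Pw n J) {lam ε : ℝ} (m : ℕ) (i k : ℕ) (hk : k ≤ m) (hl : 0 ≤ lam)
    (hm : (m : ℝ) * Real.exp (2 * lam) ≤ n) :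
    Pw.real {ω' | (hammingDist (J i ω') (J (i + k) ω') : ℝ) < (1 - ε) * k} ≤
      (2 * Real.exp (-(lam * ε))) ^ k := by
  have := h.prob
  have hn : (0 : ℝ) < n := by exact_mod_cast h.pos
  have hintg := h.int_dist i (i + k) (fun d => Real.exp (-(lam * d)))
  have h1 := mul_meas_ge_le_integral_of_nonneg (μ := Pw)
    (f := fun ω' => Real.exp (-(lam * hammingDist (J i ω') (J (i + k) ω'))))
    (Eventually.of_forall fun ω' => (Real.exp_pos _).le) hintg (Real.exp (-(lam * ((1 - ε) * k))))
  have h2 := h1.trans (h.mgf_short m i k hk hl)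
  have h3 : Real.exp (-lam) + m / n * Real.exp lam ≤ 2 * Real.exp (-lam) := by
    have : (m : ℝ) / n * Real.exp lam ≤ Real.exp (-lam) := by
      rw [div_mul_eq_mul_div, div_le_iff₀ hn]
      calc (m : ℝ) * Real.exp lam = Real.exp (-lam) * (m * Real.exp (2 * lam)) := by
            rw [show 2 * lam = lam + lam by ring, Real.exp_add]
            have : Real.exp (-lam) * Real.exp lam = 1 := by rw [← Real.exp_add]; simp
            linear_combination (-(m : ℝ) * Real.exp lam) * this
        _ ≤ _ := by gcongr
    linarith
  have h4 := h2.trans (pow_le_pow_left₀ (by positivity) h3 k)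
  have h5 : Pw.real {ω' | (hammingDist (J i ω') (J (i + k) ω') : ℝ) < (1 - ε) * k} ≤
      Pw.real {ω' | Real.exp (-(lam * ((1 - ε) * k))) ≤
        Real.exp (-(lam * hammingDist (J i ω') (J (i + k) ω')))} := by
    refine measureReal_mono (fun ω' hω => ?_)
    simp only [Set.mem_ofPred_eq] at hω ⊢
    apply Real.exp_le_exp.2
    have := mul_le_mul_of_nonneg_left hω.le hl
    linarith
  refine h5.trans ?_
  have hE := Real.exp_pos (-(lam * ((1 - ε) * k)))
  refine le_of_mul_le_mul_left (h4.trans (le_of_eq ?_)) hE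
  rw [mul_pow, mul_pow, ← Real.exp_nat_mul, ← Real.exp_nat_mul, mul_left_comm, ← Real.exp_add]
  congr 2; ring

end WK

-- part E1
lemma overlap_self {n : ℕ} (x : V n) : overlap n x x = 1 := by simp [overlap]

lemma overlap_comm {n : ℕ} (x y : V n) : overlap n x y = overlap n y x := by
  simp [overlap, hammingDist_comm]

lemma abs_overlap_le {n : ℕ} (x y : V n) : |overlap n x y| ≤ 1 := by
  unfold overlap
  rcases Nat.eq_zero_or_pos n with h | h
  · subst h; simp
  have hn : (0 : ℝ) < n := by exact_mod_cast h
  have h1 : (hammingDist x y : ℝ) ≤ n := by exact_mod_cast hd_le x y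
  have h2 : 2 * (hammingDist x y : ℝ) / n ≤ 2 := by rw [div_le_iff₀ hn]; linarith
  have h3 : 0 ≤ 2 * (hammingDist x y : ℝ) / n := by positivity
  rw [abs_le]; constructor <;> linarith

lemma overlap_pow_le {n : ℕ} (p : ℕ) (x y : V n) : |overlap n x y ^ p| ≤ 1 := by
  rw [abs_pow]; exact pow_le_one₀ (abs_nonneg _) (abs_overlap_le x y)

/-- The environment is a centered Gaussian vector. -/
lemma env_GV {Ω : Type*} [MeasurableSpace Ω] (Pe : Measure Ω) [IsProbabilityMeasure Pe] (p : ℕ)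
    (H : (n : ℕ) → V n → Ω → ℝ) (hHmeas : ∀ n x, Measurable (H n x))
    (hH : ∀ n : ℕ, IsCenteredGaussianVector Pe (H n)
      (fun x y => (n : ℝ) * overlap n x y ^ p)) (n : ℕ) :
    GV Pe (H n) (fun x y => (n : ℝ) * overlap n x y ^ p) := by
  refine GV_of_isCentered (hHmeas n) (hH n) (fun x y => by rw [overlap_comm]) (fun x y => ?_)
    (fun x y => ?_)
  · rw [overlap_self, overlap_self, one_pow]
    have := (abs_le.1 (overlap_pow_le p x y)).1
    have hn : (0 : ℝ) ≤ n := Nat.cast_nonneg n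
    nlinarith
  · rw [overlap_self, overlap_self, one_pow]
    have := (abs_le.1 (overlap_pow_le p x y)).2
    have hn : (0 : ℝ) ≤ n := Nat.cast_nonneg n
    nlinarith

lemma one_sub_ge_exp {u ε : ℝ} (hu : 0 ≤ u) (hε : 0 < ε) (h : u ≤ ε / (1 + ε)) :
    Real.exp (-((1 + ε) * u)) ≤ 1 - u := by
  rw [le_div_iff₀ (by linarith)] at h
  rw [Real.exp_neg, inv_eq_one_div]
  have h1 : 1 + (1 + ε) * u ≤ Real.exp ((1 + ε) * u) := by
    linarith [Real.add_one_le_exp ((1 + ε) * u)]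
  have h2 : 0 < 1 + (1 + ε) * u := by positivity
  refine (one_div_le_one_div_of_le h2 h1).trans ?_
  rw [div_le_iff₀ h2]
  nlinarith

lemma cov_ge {n p : ℕ} (hn : 0 < n) {x y : V n} {k ε : ℝ} (hε : 0 < ε)
    (hd : (hammingDist x y : ℝ) ≤ k) (hk : 2 * k / n ≤ ε / (1 + ε)) :
    (n : ℝ) * Real.exp (-((2 * p * (1 + ε)) / n * k)) ≤ n * overlap n x y ^ p := by
  have hn' : (0 : ℝ) < n := by exact_mod_cast hn
  have hk0 : 0 ≤ k := le_trans (Nat.cast_nonneg _) hd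
  have h1 := one_sub_ge_exp (u := 2 * k / n) (by positivity) hε hk
  have h2 : Real.exp (-((1 + ε) * (2 * k / n))) ≤ overlap n x y := by
    refine h1.trans ?_
    unfold overlap
    gcongr
  gcongr
  calc Real.exp (-((2 * p * (1 + ε)) / n * k)) = Real.exp (-((1 + ε) * (2 * k / n))) ^ p := by
        rw [← Real.exp_nat_mul]; congr 1; ring
    _ ≤ _ := pow_le_pow_left₀ (Real.exp_pos _).le h2 p

lemma cov_le {n p : ℕ} (hn : 0 < n) {x y : V n} {k : ℝ}
    (hd : k ≤ hammingDist x y) (hd2 : 2 * (hammingDist x y : ℝ) ≤ n) :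
    n * overlap n x y ^ p ≤ (n : ℝ) * Real.exp (-((2 * p) / n * k)) := by
  have hn' : (0 : ℝ) < n := by exact_mod_cast hn
  have h0 : 0 ≤ overlap n x y := by
    unfold overlap
    have : 2 * (hammingDist x y : ℝ) / n ≤ 1 := (div_le_one hn').2 hd2
    linarith
  have h2 : overlap n x y ≤ Real.exp (-(2 * k / n)) := by
    unfold overlap
    have h3 : 2 * k / n ≤ 2 * (hammingDist x y : ℝ) / n := by gcongr
    linarith [Real.add_one_le_exp (-(2 * k / n))]
  gcongr
  calc overlap n x y ^ p ≤ Real.exp (-(2 * k / n)) ^ p := pow_le_pow_left₀ h0 h2 p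
    _ = _ := by rw [← Real.exp_nat_mul]; congr 1; ring

/-- quenched exceedance probability -/
noncomputable def Mx {Ω' : Type*} [MeasurableSpace Ω'] (Pw : Measure Ω') {n : ℕ}
    (J : ℕ → Ω' → V n) (θ : ℕ) (L : ℝ) (h : V n → ℝ) : ℝ :=
  Pw.real {ω' | ∃ j ∈ Icc 1 θ, L < h (J j ω')}

/-- conditional exceedance probability given the path -/
noncomputable def Gx {Ω : Type*} [MeasurableSpace Ω] (Pe : Measure Ω) {n : ℕ}
    (H : V n → Ω → ℝ) (L : ℝ) {θ : ℕ} (xs : Fin (θ + 1) → V n) : ℝ :=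
  Pe.real {ω | ∃ j : Fin (θ + 1), 1 ≤ (j : ℕ) ∧ L < H (xs j) ω}

lemma Mx_eq {Ω' : Type*} [MeasurableSpace Ω'] {Pw : Measure Ω'} {n : ℕ}
    {J : ℕ → Ω' → V n} (hW : WK Pw n J) (θ : ℕ) (L : ℝ) (h : V n → ℝ) :
    Mx Pw J θ L h = ∑ xs : Fin (θ + 1) → V n, wt n θ xs *
      Set.indicator {xs : Fin (θ + 1) → V n | ∃ j : Fin (θ + 1), 1 ≤ (j : ℕ) ∧ L < h (xs j)} 1 xs := by
  have := hW.prob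
  rw [← hW.integral_eq]
  have hm : MeasurableSet {ω' | ∃ j ∈ Icc 1 θ, L < h (J j ω')} := by
    have : {ω' | ∃ j ∈ Icc 1 θ, L < h (J j ω')} = ⋃ j ∈ Icc 1 θ, {ω' | L < h (J j ω')} := by
      ext; simp
    rw [this]
    refine Finset.measurableSet_biUnion _ fun j _ => ?_
    exact measurableSet_lt measurable_const ((measurable_of_finite h).comp (hW.meas j))
  unfold Mx
  rw [← integral_indicator_one hm]
  congr 1
  ext ω'
  have hiff : ω' ∈ {ω' | ∃ j ∈ Icc 1 θ, L < h (J j ω')} ↔ (fun k : Fin (θ + 1) => J k ω') ∈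
      {xs : Fin (θ + 1) → V n | ∃ j : Fin (θ + 1), 1 ≤ (j : ℕ) ∧ L < h (xs j)} := by
    simp only [Set.mem_ofPred_eq, Finset.mem_Icc]
    constructor
    · rintro ⟨j, ⟨h1, h2⟩, h3⟩; exact ⟨⟨j, by omega⟩, h1, h3⟩
    · rintro ⟨j, h1, h3⟩; exact ⟨j, ⟨h1, by omega⟩, h3⟩
  by_cases hh : ω' ∈ {ω' | ∃ j ∈ Icc 1 θ, L < h (J j ω')}
  · rw [Set.indicator_of_mem hh, Set.indicator_of_mem (hiff.1 hh)]; rfl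
  · rw [Set.indicator_of_notMem hh, Set.indicator_of_notMem (fun h' => hh (hiff.2 h'))]

section
variable {Ω : Type*} [MeasurableSpace Ω] {Pe : Measure Ω} {n : ℕ} {H : V n → Ω → ℝ}
  {Δ : V n → V n → ℝ} {Ω' : Type*} [MeasurableSpace Ω'] {Pw : Measure Ω'} {J : ℕ → Ω' → V n}

lemma meas_Gx (hH : ∀ x, Measurable (H x)) (L : ℝ) {θ : ℕ} (xs : Fin (θ + 1) → V n) :
    MeasurableSet {ω | ∃ j : Fin (θ + 1), 1 ≤ (j : ℕ) ∧ L < H (xs j) ω} := by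
  have : {ω | ∃ j : Fin (θ + 1), 1 ≤ (j : ℕ) ∧ L < H (xs j) ω} =
      ⋃ j ∈ univ.filter (fun j : Fin (θ + 1) => 1 ≤ (j : ℕ)), {ω | L < H (xs j) ω} := by
    ext; simp
  rw [this]
  exact Finset.measurableSet_biUnion _ fun j _ => measurableSet_lt measurable_const (hH _)

/-- annealed mean = average over paths -/
lemma integral_Mx (hG : GV Pe H Δ) (hW : WK Pw n J) (θ : ℕ) (L : ℝ) :
    ∫ ω, Mx Pw J θ L (fun x => H x ω) ∂Pe = ∫ ω', Gx Pe H L (θ := θ) (fun k => J k ω') ∂Pw := by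
  have := hG.prob
  have hi : ∀ xs : Fin (θ + 1) → V n,
      (fun ω => wt n θ xs * Set.indicator {xs : Fin (θ + 1) → V n |
        ∃ j : Fin (θ + 1), 1 ≤ (j : ℕ) ∧ L < H (xs j) ω} (1 : (Fin (θ + 1) → V n) → ℝ) xs) =
      fun ω => wt n θ xs * Set.indicator {ω | ∃ j : Fin (θ + 1), 1 ≤ (j : ℕ) ∧ L < H (xs j) ω}
        (1 : Ω → ℝ) ω := by
    intro xs; ext ω; simp [Set.indicator_apply]
  rw [hW.integral_eq]
  simp only [Mx_eq hW]
  rw [integral_finsetSum]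
  · refine Finset.sum_congr rfl fun xs _ => ?_
    rw [hi, integral_const_mul, integral_indicator_one (meas_Gx hG.meas L xs)]
    rfl
  · intro xs _
    rw [hi]
    exact (IntegrableOn.integrable_indicator (integrable_const (1 : ℝ)).integrableOn
      (meas_Gx hG.meas L xs)).const_mul _

/-- Windowed union bound along a path with Slepian comparison. -/
lemma Gx_upper {p : ℕ} (hn : 0 < n) (hG : GV Pe H (fun x y => (n : ℝ) * overlap n x y ^ p))
    (L : ℝ) {θ m : ℕ} (hm : 0 < m) {ε : ℝ} (hε : 0 < ε)
    (hmn : 2 * (m : ℝ) / n ≤ ε / (1 + ε)) (X : ℕ → V n)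
    (hX : ∀ i k, hammingDist (X i) (X (i + k)) ≤ k) :
    Gx Pe H L (θ := θ) (fun k => X k) ≤ (θ / m + 1 : ℕ) * arProb n (2 * p * (1 + ε) / n) m L := by
  have := hG.prob
  have hn' : (0 : ℝ) < n := by exact_mod_cast hn
  have hsub : {ω | ∃ j : Fin (θ + 1), 1 ≤ (j : ℕ) ∧ L < H (X j) ω} ⊆
      ⋃ w ∈ range (θ / m + 1), {ω | ∃ i : Fin m, L < H (X (w * m + i)) ω} := by
    rintro ω ⟨j, -, hj⟩
    simp only [Set.mem_iUnion, Finset.mem_range]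
    refine ⟨j / m, Nat.lt_succ_of_le (Nat.div_le_div_right (by omega)), ⟨j % m, Nat.mod_lt _ hm⟩, ?_⟩
    simp only
    rwa [Nat.div_add_mod']
  unfold Gx
  refine (measureReal_mono hsub (measure_ne_top _ _)).trans
    ((measureReal_biUnion_finset_le _ _).trans ?_)
  have hwin : ∀ w ∈ range (θ / m + 1), Pe.real {ω | ∃ i : Fin m, L < H (X (w * m + i)) ω} ≤
      arProb n (2 * p * (1 + ε) / n) m L := by
    intro w _
    have hc := hG.comp (fun i : Fin m => X (w * m + i))
    refine hc.le_arProb hn'.le (by positivity) (fun i => by rw [overlap_self]; simp) ?_ L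
    have key : ∀ i j : Fin m, (i : ℕ) ≤ j → (n : ℝ) * Real.exp (-(2 * p * (1 + ε) / n *
        |((i : ℕ) : ℝ) - ((j : ℕ) : ℝ)|)) ≤ n * overlap n (X (w * m + i)) (X (w * m + j)) ^ p := by
      intro i j hij
      have hd := hX (w * m + i) (j - i)
      rw [add_assoc, Nat.add_sub_cancel' hij] at hd
      have hab : |((i : ℕ) : ℝ) - ((j : ℕ) : ℝ)| = ((j - i : ℕ) : ℝ) := by
        rw [Nat.cast_sub hij, abs_sub_comm, abs_of_nonneg]
        have : ((i : ℕ) : ℝ) ≤ (j : ℕ) := by exact_mod_cast hij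
        linarith
      rw [hab]
      refine cov_ge hn hε (by exact_mod_cast hd) (le_trans ?_ hmn)
      have : ((j - i : ℕ) : ℝ) ≤ m := by exact_mod_cast (by omega)
      gcongr
    intro i j
    rcases le_total (i : ℕ) (j : ℕ) with hij | hij
    · exact key i j hij
    · rw [abs_sub_comm, overlap_comm]; exact key j i hij
  refine (Finset.sum_le_sum hwin).trans ?_
  simp
end

-- part E2
/-- window size `⌈n^b⌉` -/
noncomputable def win (b : ℝ) (n : ℕ) : ℕ := ⌈(n : ℝ) ^ b⌉₊

lemma win_ge (b : ℝ) (n : ℕ) : (n : ℝ) ^ b ≤ win b n := Nat.le_ceil _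

lemma win_le (b : ℝ) (n : ℕ) : (win b n : ℝ) ≤ (n : ℝ) ^ b + 1 :=
  (Nat.ceil_lt_add_one (by positivity)).le

lemma win_pos (b : ℝ) {n : ℕ} (hn : 0 < n) : 0 < win b n := by
  have hn' : (0 : ℝ) < n := by exact_mod_cast hn
  have := Real.rpow_pos_of_pos hn' b
  exact Nat.ceil_pos.2 this

lemma win_le2 {b : ℝ} (hb : 0 ≤ b) {n : ℕ} (hn : 0 < n) : (win b n : ℝ) ≤ 2 * (n : ℝ) ^ b := by
  have hn' : (1 : ℝ) ≤ n := by exact_mod_cast hn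
  have := Real.one_le_rpow hn' hb
  linarith [win_le b n]

lemma win_tendsto {b : ℝ} (hb : 0 < b) : Tendsto (fun n => (win b n : ℝ)) atTop atTop :=
  tendsto_atTop_mono (win_ge b) ((tendsto_rpow_atTop hb).comp tendsto_natCast_atTop_atTop)

lemma win_div {b d : ℝ} (hb : 0 < b) (hd : b < d) :
    Tendsto (fun n => (win b n : ℝ) / (n : ℝ) ^ d) atTop (nhds 0) := by
  have h1 : Tendsto (fun n : ℕ => 2 * (n : ℝ) ^ (-(d - b))) atTop (nhds (2 * 0)) :=
    ((tendsto_rpow_neg_atTop (by linarith : 0 < d - b)).comp tendsto_natCast_atTop_atTop).const_mul 2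
  rw [mul_zero] at h1
  refine tendsto_of_tendsto_of_tendsto_of_le_of_le' tendsto_const_nhds h1 ?_ ?_
  · exact Eventually.of_forall fun n => by positivity
  · filter_upwards [eventually_gt_atTop 0] with n hn
    have hn' : (0 : ℝ) < n := by exact_mod_cast hn
    rw [div_le_iff₀ (by positivity), mul_assoc, ← Real.rpow_add hn']
    rw [show -(d - b) + d = b by ring]
    exact win_le2 hb.le hn

lemma win_div_n {b : ℝ} (hb : 0 < b) (hd : b < 1) :
    Tendsto (fun n => (win b n : ℝ) / n) atTop (nhds 0) := by
  simpa using win_div hb hd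

lemma win_γ {b c : ℝ} (hb : 2 * c < b) :
    Tendsto (fun n => (win b n : ℝ) * γseq c n ^ 2) atTop atTop := by
  have h1 : Tendsto (fun n : ℕ => (n : ℝ) ^ (b - 2 * c)) atTop atTop :=
    (tendsto_rpow_atTop (by linarith)).comp tendsto_natCast_atTop_atTop
  refine tendsto_atTop_mono' _ ?_ h1
  filter_upwards [eventually_gt_atTop 0] with n hn
  have hn' : (0 : ℝ) < n := by exact_mod_cast hn
  have : (n : ℝ) ^ (b - 2 * c) = (n : ℝ) ^ b * γseq c n ^ 2 := by
    rw [γseq, ← Real.rpow_natCast ((n : ℝ) ^ (-c)), ← Real.rpow_mul hn'.le, ← Real.rpow_add hn']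
    congr 1; push_cast; ring
  rw [this]
  have := win_ge b n
  gcongr

section
variable {Ω : Type*} [MeasurableSpace Ω] {Pe : Measure Ω}  {H : (n : ℕ) → V n → Ω → ℝ}
  {Ω' : Type*} [MeasurableSpace Ω'] {Pw : Measure Ω'} {J : (n : ℕ) → ℕ → Ω' → V n} {p : ℕ} {c : ℝ}

lemma mean_upper (hp : 0 < p) (hc0 : 0 < c) (hc : c < 1 / 2) (v : ℝ)
    (hG : ∀ n : ℕ, GV Pe (H n) (fun x y => (n : ℝ) * overlap n x y ^ p))
    (hW : ∀ n, 0 < n → WK Pw n (J n)) {ε : ℝ} (hε : 0 < ε) :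
    ∀ᶠ n : ℕ in atTop, ∫ ω, Mx Pw (J n) (θseq n) (Lf c v n) (fun x => H n x ω) ∂Pe ≤
      (1 + ε) * (2 * p * θseq n * γseq c n ^ 2 * q0 c v n) := by
  obtain ⟨η, hη, hη1, hηε⟩ : ∃ η : ℝ, 0 < η ∧ η ≤ 1 ∧ (1 + η) ^ 3 ≤ 1 + ε := by
    refine ⟨min 1 (ε / 7), by positivity, min_le_left _ _, ?_⟩
    have h1 : min 1 (ε / 7) ≤ 1 := min_le_left _ _
    have h2 : min 1 (ε / 7) ≤ ε / 7 := min_le_right _ _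
    have h0 : 0 < min 1 (ε / 7) := by positivity
    set η := min 1 (ε / 7)
    nlinarith [mul_pos h0 h0, mul_nonneg h0.le (sub_nonneg.2 h1)]
  set b : ℝ := (1 + 2 * c) / 2 with hb
  have hb0 : 0 < b := by rw [hb]; linarith
  have hb1 : b < 1 := by rw [hb]; linarith
  have hp' : (0 : ℝ) < p := by exact_mod_cast hp
  have hκ : 0 < 2 * p * (1 + η) := by positivity
  have hmn := win_div_n hb0 hb1
  filter_upwards [eventually_gt_atTop 0,
    arProb_upper hc0 hc v hκ (win b) (win_γ (by rw [hb]; linarith)) hη,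
    hmn.eventually (ge_mem_nhds (show (0 : ℝ) < η / (1 + η) / 2 by positivity)),
    hmn.eventually (ge_mem_nhds hη)] with n hn hup h1 h2
  have hn' : (0 : ℝ) < n := by exact_mod_cast hn
  have hn1 : (1 : ℝ) ≤ n := by exact_mod_cast hn
  have hprob := (hW n hn).prob
  rw [integral_Mx (hG n) (hW n hn)]
  have hm := win_pos b hn
  have hm' : (0 : ℝ) < win b n := by exact_mod_cast hm
  have hq := q0_pos c v n
  have hγ := γ_pos c hn
  have hle : ∀ᵐ ω' ∂Pw, Gx Pe (H n) (Lf c v n) (θ := θseq n) (fun k => J n k ω') ≤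
      (1 + ε) * (2 * p * θseq n * γseq c n ^ 2 * q0 c v n) := by
    filter_upwards [(hW n hn).dist_le] with ω' hω'
    refine (Gx_upper hn (hG n) (Lf c v n) hm hη ?_ (fun k => J n k ω') hω').trans ?_
    · rw [mul_div_assoc]; linarith
    have h3 : ((θseq n / win b n + 1 : ℕ) : ℝ) * win b n ≤ (1 + η) * θseq n := by
      have h4 : ((θseq n / win b n : ℕ) : ℝ) * win b n ≤ θseq n := by
        exact_mod_cast Nat.div_mul_le_self _ _
      have h5 : (win b n : ℝ) ≤ η * θseq n := by
        rw [div_le_iff₀ hn'] at h2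
        refine h2.trans ?_
        gcongr
        simp only [θseq]
        nlinarith
      push_cast at h4 ⊢
      linarith
    calc ((θseq n / win b n + 1 : ℕ) : ℝ) * arProb n (2 * p * (1 + η) / n) (win b n) (Lf c v n)
        ≤ ((θseq n / win b n + 1 : ℕ) : ℝ) *
          ((1 + η) * (2 * p * (1 + η) * win b n * γseq c n ^ 2 * q0 c v n)) := by gcongr
      _ = (((θseq n / win b n + 1 : ℕ) : ℝ) * win b n) *
          ((1 + η) ^ 2 * (2 * p  * γseq c n ^ 2 * q0 c v n)) := by ring
      _ ≤ ((1 + η) * θseq n) * ((1 + η) ^ 2 * (2 * p  * γseq c n ^ 2 * q0 c v n)) := by gcongr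
      _ = (1 + η) ^ 3 * (2 * p * θseq n * γseq c n ^ 2 * q0 c v n) := by ring
      _ ≤ _ := by gcongr
  refine (integral_mono_ae ((hW n hn).integrable _ _) (integrable_const _) hle).trans ?_
  simp
end

-- part E3
lemma bonferroni {Ω : Type*} [MeasurableSpace Ω] (P : Measure Ω) [IsProbabilityMeasure P]
    (A : ℕ → Set Ω) (hA : ∀ w, MeasurableSet (A w)) (W : ℕ) :
    ∑ w ∈ range W, P.real (A w) - ∑ w ∈ range W, ∑ w' ∈ range w, P.real (A w ∩ A w') ≤
      P.real (⋃ w ∈ range W, A w) := by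
  induction W with
  | zero => simp
  | succ W ih =>
    rw [Finset.sum_range_succ, Finset.sum_range_succ]
    have hU : (⋃ w ∈ range (W + 1), A w) = (⋃ w ∈ range W, A w) ∪ A W := by
      ext ω; simp only [Set.mem_iUnion, Set.mem_union, Finset.mem_range, exists_prop]
      constructor
      · rintro ⟨w, hw, h⟩
        rcases Nat.lt_succ_iff_lt_or_eq.1 hw with h' | h'
        · exact Or.inl ⟨w, h', h⟩
        · subst h'; exact Or.inr h
      · rintro (⟨w, hw, h⟩ | h)
        · exact ⟨w, by omega, h⟩
        · exact ⟨W, by omega, h⟩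
    have h1 := measureReal_union_add_inter (μ := P) (s := ⋃ w ∈ range W, A w) (t := A W) (hA W)
      (h₁ := measure_ne_top _ _) (h₂ := measure_ne_top _ _)
    have h2 : P.real ((⋃ w ∈ range W, A w) ∩ A W) ≤ ∑ w' ∈ range W, P.real (A W ∩ A w') := by
      have : (⋃ w ∈ range W, A w) ∩ A W = ⋃ w ∈ range W, A W ∩ A w := by
        ext ω; simp only [Set.mem_iUnion, Set.mem_inter_iff, exists_prop]; tauto
      rw [this]
      exact measureReal_biUnion_finset_le _ _
    rw [hU]
    linarith

section
variable {Ω : Type*} [MeasurableSpace Ω] {Pe : Measure Ω} {n : ℕ} {H : V n → Ω → ℝ}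
  {Ω' : Type*} [MeasurableSpace Ω'] {Pw : Measure Ω'} {J : ℕ → Ω' → V n}

/-- two-point exceedance -/
noncomputable def P2 (Pe : Measure Ω) (H : V n → Ω → ℝ) (L : ℝ) (x y : V n) : ℝ :=
  Pe.real ({ω | L < H x ω} ∩ {ω | L < H y ω})

lemma pair_bound {p : ℕ} (hp : 0 < p) (hn : 0 < n)
    (hG : GV Pe H (fun x y => (n : ℝ) * overlap n x y ^ p)) {L : ℝ} (hL : 0 < L) (x y : V n) :
    P2 Pe H L x y ≤ Real.exp (-(L ^ 2 / (2 * n))) *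
      (Real.exp (-(L ^ 2 / (2 * n ^ 2) * (hammingDist x y : ℝ))) +
       Real.exp (-(L ^ 2 / (2 * n ^ 2) * ((n : ℝ) - hammingDist x y)))) := by
  have := hG.prob
  have hn' : (0 : ℝ) < n := by exact_mod_cast hn
  set D : ℝ := ((hammingDist x y : ℕ) : ℝ) with hD
  set R := overlap n x y with hR
  have hRD : R = 1 - 2 * D / n := rfl
  have habs := abs_le.1 (abs_overlap_le x y)
  rw [← hR] at habs
  have main : 0 < 1 + R ^ p → ∀ d : ℝ, 2 * d / n ≤ 1 - R ^ p →
      P2 Pe H L x y ≤ Real.exp (-(L ^ 2 / (2 * n))) * Real.exp (-(L ^ 2 / (2 * n ^ 2) * d)) := by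
    intro h1 d hd
    have hS : (n : ℝ) * overlap n x x ^ p + n * overlap n x y ^ p + n * overlap n y x ^ p +
        n * overlap n y y ^ p = 2 * n * (1 + R ^ p) := by
      rw [overlap_self, overlap_self, overlap_comm y x, ← hR, one_pow]; ring
    have h2 := hG.pair_tail x y (by rw [hS]; positivity) L
    rw [hS] at h2
    refine h2.trans ((Qf_le_exp _ (by positivity)).trans ?_)
    rw [← Real.exp_add, Real.exp_le_exp, div_pow, Real.sq_sqrt (by positivity)]
    have h3 : 1 / 2 + (1 - R ^ p) / 4 ≤ 1 / (1 + R ^ p) := by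
      rw [le_div_iff₀ h1]; nlinarith [sq_nonneg (1 - R ^ p)]
    have h4 : (2 * L) ^ 2 / (2 * n * (1 + R ^ p)) / 2 = L ^ 2 / n * (1 / (1 + R ^ p)) := by
      field_simp
    have h5 : L ^ 2 / (2 * n) + L ^ 2 / (2 * n ^ 2) * d = L ^ 2 / n * (1 / 2 + (2 * d / n) / 4) := by
      field_simp; ring
    have h6 : L ^ 2 / n * (1 / 2 + (2 * d / n) / 4) ≤ L ^ 2 / n * (1 / (1 + R ^ p)) := by
      gcongr; linarith
    rw [neg_div, h4]; linarith
  have e1 := Real.exp_pos (-(L ^ 2 / (2 * n)))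
  have e2 := Real.exp_pos (-(L ^ 2 / (2 * n ^ 2) * D))
  have e3 := Real.exp_pos (-(L ^ 2 / (2 * n ^ 2) * ((n : ℝ) - D)))
  rw [mul_add]
  rcases le_or_gt 0 R with h0 | h0
  · have hr : R ^ p ≤ R := pow_le_of_le_one h0 habs.2 hp.ne'
    have := main (by positivity) D (by rw [hRD] at hr ⊢; linarith)
    nlinarith
  · have hr : |R| ^ p ≤ |R| := pow_le_of_le_one (abs_nonneg _) (abs_overlap_le x y) hp.ne'
    rw [← abs_pow, abs_of_neg h0] at hr
    have hr2 := abs_le.1 hr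
    have hnd : 2 * (n - D) / n = 1 + R := by rw [hRD]; field_simp; ring
    rcases lt_or_ge 0 (1 + R ^ p) with h1 | h1
    · have := main h1 (n - D) (by rw [hnd]; linarith)
      nlinarith
    · have hR1 : R ≤ -1 := by linarith
      have hd0 : (n : ℝ) - D ≤ 0 := by
        have : 2 * (n - D) / n ≤ 0 := by rw [hnd]; linarith
        rw [div_le_iff₀ hn'] at this; linarith
      have he : 1 ≤ Real.exp (-(L ^ 2 / (2 * n ^ 2) * ((n : ℝ) - D))) := by
        apply Real.one_le_exp
        have : 0 ≤ L ^ 2 / (2 * (n : ℝ) ^ 2) := by positivity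
        nlinarith
      have hP : P2 Pe H L x y ≤ Real.exp (-(L ^ 2 / (2 * n))) := by
        refine (measureReal_mono Set.inter_subset_left (measure_ne_top _ _)).trans ?_
        rw [hG.tail x (by rw [overlap_self]; simpa using hn')]
        refine (Qf_le_exp _ (by positivity)).trans ?_
        rw [Real.exp_le_exp, overlap_self, one_pow, mul_one, div_pow, Real.sq_sqrt hn'.le]
        apply le_of_eq; field_simp
      nlinarith

lemma pair_mean {p : ℕ} (hp : 0 < p) (hn : 0 < n)
    (hG : GV Pe H (fun x y => (n : ℝ) * overlap n x y ^ p)) (hW : WK Pw n J)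
    {L : ℝ} (hL : 0 < L) {μ : ℝ} (hμ : μ = L ^ 2 / (2 * n ^ 2)) (hμ1 : μ ≤ 1 / 4) (i k : ℕ) :
    ∫ ω', P2 Pe H L (J i ω') (J (i + k) ω') ∂Pw ≤ Real.exp (-(L ^ 2 / (2 * n))) *
      (2 * (Real.exp (-(μ * k / 4)) + 8 / μ * Real.exp (-(μ * n / 4)))) := by
  have hn' : (0 : ℝ) < n := by exact_mod_cast hn
  have hμ0 : 0 < μ := by rw [hμ]; positivity
  have h1 := hW.mgf_near hμ0 hμ1 i k
  have h2 := hW.mgf_far hμ0 hμ1 i k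
  have i1 := hW.integrable2 i (i + k) (fun x y => Real.exp (-(μ * (hammingDist x y : ℝ))))
  have i2 := hW.integrable2 i (i + k) (fun x y => Real.exp (-(μ * ((n : ℝ) - hammingDist x y))))
  refine (integral_mono (hW.integrable2 i (i + k) (P2 Pe H L)) ((i1.add i2).const_mul
    (Real.exp (-(L ^ 2 / (2 * n))))) (fun ω' => ?_)).trans ?_
  · simp only [Pi.add_apply]
    rw [hμ]; exact pair_bound hp hn hG hL _ _
  · rw [integral_const_mul]
    gcongr
    simp only [Pi.add_apply]
    rw [integral_add i1 i2]
    linarith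
end

-- part E4
lemma arProb_nonneg (s k : ℝ) (M : ℕ) (L : ℝ) : 0 ≤ arProb s k M L := measureReal_nonneg

section
variable {Ω : Type*} [MeasurableSpace Ω] {Pe : Measure Ω} {n : ℕ} {H : V n → Ω → ℝ}
  {Ω' : Type*} [MeasurableSpace Ω'] {Pw : Measure Ω'} {J : ℕ → Ω' → V n}

/-- the walk moves too slowly somewhere in the window starting at `a` -/
def badW (J : ℕ → Ω' → V n) (ε : ℝ) (s M a : ℕ) : Set Ω' :=
  ⋃ i ∈ range M, ⋃ k ∈ Icc 1 M, {ω' | (hammingDist (J (a + s * i) ω') (J (a + s * i + s * k) ω') : ℝ) <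
    (1 - ε) * (s * k : ℕ)}

lemma meas_badW (hW : WK Pw n J) (ε : ℝ) (s M a : ℕ) : MeasurableSet (badW J ε s M a) := by
  refine Finset.measurableSet_biUnion _ fun i _ => Finset.measurableSet_biUnion _ fun k _ => ?_
  have hm : Measurable (fun ω' => ((hammingDist (J (a + s * i) ω') (J (a + s * i + s * k) ω') : ℕ) : ℝ)) := by
    have h2 : Measurable (fun q : V n × V n => ((hammingDist q.1 q.2 : ℕ) : ℝ)) :=
      measurable_of_finite _
    have h3 : Measurable (fun ω' => (J (a + s * i) ω', J (a + s * i + s * k) ω')) :=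
      (hW.meas _).prodMk (hW.meas _)
    have h4 := h2.comp h3
    exact h4
  exact measurableSet_lt hm measurable_const

lemma prob_badW (hW : WK Pw n J) {ε lam : ℝ} (s M a : ℕ) (hl : 0 ≤ lam)
    (hm : ((s * M : ℕ) : ℝ) * Real.exp (2 * lam) ≤ n) (hr : 2 * Real.exp (-(lam * ε)) ≤ 1) :
    Pw.real (badW J ε s M a) ≤ (M : ℝ) ^ 2 * (2 * Real.exp (-(lam * ε))) ^ s := by
  have := hW.prob
  unfold badW
  refine (measureReal_biUnion_finset_le _ _).trans ?_
  have h1 : ∀ i ∈ range M, Pw.real (⋃ k ∈ Icc 1 M, {ω' | (hammingDist (J (a + s * i) ω')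
      (J (a + s * i + s * k) ω') : ℝ) < (1 - ε) * (s * k : ℕ)}) ≤
      M * (2 * Real.exp (-(lam * ε))) ^ s := by
    intro i _
    refine (measureReal_biUnion_finset_le _ _).trans ?_
    have h2 : ∀ k ∈ Icc 1 M, Pw.real {ω' | (hammingDist (J (a + s * i) ω')
      (J (a + s * i + s * k) ω') : ℝ) < (1 - ε) * (s * k : ℕ)} ≤ (2 * Real.exp (-(lam * ε))) ^ s := by
      intro k hk
      rw [Finset.mem_Icc] at hk
      refine (hW.short_tail (s * M) (a + s * i) (s * k) (Nat.mul_le_mul_left _ hk.2) hl hm).trans ?_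
      exact pow_le_pow_of_le_one (by positivity) hr (Nat.le_mul_of_pos_right _ hk.1)
    refine (Finset.sum_le_sum h2).trans ?_
    simp
  refine (Finset.sum_le_sum h1).trans ?_
  simp only [Finset.sum_const, Finset.card_range, nsmul_eq_mul]
  apply le_of_eq; ring

lemma window_lower {p : ℕ} (hn : 0 < n) (hG : GV Pe H (fun x y => (n : ℝ) * overlap n x y ^ p))
    (L : ℝ) {ε : ℝ} (hε : ε ≤ 1) {s M a : ℕ} (hsM : 2 * (s * M) ≤ n) {ω' : Ω'}
    (hd : ∀ i k, hammingDist (J i ω') (J (i + k) ω') ≤ k) (hb : ω' ∉ badW J ε s M a) :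
    arProb n (2 * p * (1 - ε) * s / n) M L ≤
      Pe.real {ω | ∃ i : Fin M, L < H (J (a + s * i) ω') ω} := by
  have hn' : (0 : ℝ) < n := by exact_mod_cast hn
  have hc := hG.comp (fun i : Fin M => J (a + s * i) ω')
  have hε' : 0 ≤ 1 - ε := by linarith
  refine hc.arProb_le hn'.le (by positivity) (fun i => by rw [overlap_self]; simp) ?_ L
  have key : ∀ i j : Fin M, (i : ℕ) ≤ j → n * overlap n (J (a + s * i) ω') (J (a + s * j) ω') ^ p ≤
      (n : ℝ) * Real.exp (-(2 * p * (1 - ε) * s / n * |((i : ℕ) : ℝ) - ((j : ℕ) : ℝ)|)) := by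
    intro i j hij
    have hab : |((i : ℕ) : ℝ) - ((j : ℕ) : ℝ)| = ((j - i : ℕ) : ℝ) := by
      rw [Nat.cast_sub hij, abs_sub_comm, abs_of_nonneg]
      have : ((i : ℕ) : ℝ) ≤ (j : ℕ) := by exact_mod_cast hij
      linarith
    have hadd : a + s * j = a + s * i + s * (j - i : ℕ) := by
      rw [add_assoc, ← mul_add, Nat.add_sub_cancel' hij]
    rw [hab, hadd]
    have hdd := hd (a + s * i) (s * (j - i : ℕ))
    have hk : (1 - ε) * (s * (j - i : ℕ) : ℕ) ≤
        hammingDist (J (a + s * i) ω') (J (a + s * i + s * (j - i : ℕ)) ω') := by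
      rcases Nat.eq_zero_or_pos (j - i : ℕ) with h0 | h0
      · rw [h0]; simp
      by_contra hcon
      push Not at hcon
      apply hb
      simp only [badW, Set.mem_iUnion, Finset.mem_range, Finset.mem_Icc]
      exact ⟨i, i.2, (j - i : ℕ), ⟨h0, by omega⟩, hcon⟩
    have h2d : 2 * (hammingDist (J (a + s * i) ω') (J (a + s * i + s * (j - i : ℕ)) ω') : ℝ) ≤ n := by
      have : s * (j - i : ℕ) ≤ s * M := Nat.mul_le_mul_left _ (by omega)
      exact_mod_cast (by omega)
    refine (cov_le hn hk h2d).trans (le_of_eq ?_)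
    congr 3
    push_cast
    ring
  intro i j
  rcases le_total (i : ℕ) (j : ℕ) with hij | hij
  · exact key i j hij
  · rw [abs_sub_comm, overlap_comm]; exact key j i hij

lemma meas_winEv (hG : ∀ x, Measurable (H x)) (L : ℝ) (s M a : ℕ) (ω' : Ω') :
    MeasurableSet {ω | ∃ i : Fin M, L < H (J (a + s * i) ω') ω} := by
  have : {ω | ∃ i : Fin M, L < H (J (a + s * i) ω') ω} =
      ⋃ i ∈ (univ : Finset (Fin M)), {ω | L < H (J (a + s * i) ω') ω} := by
    ext; simp
  rw [this]
  exact Finset.measurableSet_biUnion _ fun j _ => measurableSet_lt measurable_const (hG _)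

/-- Pathwise Bonferroni lower bound. -/
lemma Gx_lower {Δ : V n → V n → ℝ} (hG : GV Pe H Δ) (L : ℝ) {s M l W θ : ℕ} (hs : 1 ≤ s)
    (hθ : W * (s * M + l) ≤ θ) (ω' : Ω') :
    ∑ w ∈ range W, Pe.real {ω | ∃ i : Fin M, L < H (J (1 + w * (s * M + l) + s * i) ω') ω} -
      ∑ w ∈ range W, ∑ w' ∈ range w, ∑ i ∈ range M, ∑ j ∈ range M,
        P2 Pe H L (J (1 + w' * (s * M + l) + s * j) ω') (J (1 + w * (s * M + l) + s * i) ω') ≤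
      Gx Pe H L (θ := θ) (fun k => J k ω') := by
  have := hG.prob
  have hb := bonferroni Pe (fun w => {ω | ∃ i : Fin M, L < H (J (1 + w * (s * M + l) + s * i) ω') ω})
    (fun w => meas_winEv hG.meas L s M _ ω') W
  have h1 : Pe.real (⋃ w ∈ range W, {ω | ∃ i : Fin M, L < H (J (1 + w * (s * M + l) + s * i) ω') ω}) ≤
      Gx Pe H L (θ := θ) (fun k => J k ω') := by
    refine measureReal_mono ?_ (measure_ne_top _ _)
    intro ω hω
    simp only [Set.mem_iUnion, Finset.mem_range] at hω
    obtain ⟨w, hw, i, hi⟩ := hω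
    have hle : 1 + w * (s * M + l) + s * i ≤ θ := by
      have h2 : (w + 1) * (s * M + l) ≤ W * (s * M + l) := Nat.mul_le_mul_right _ hw
      have h3 : s * (i + 1) ≤ s * M := Nat.mul_le_mul_left _ i.2
      rw [add_mul, one_mul] at h2
      rw [mul_add, mul_one] at h3
      omega
    exact ⟨⟨1 + w * (s * M + l) + s * i, by omega⟩, by simp only; omega, hi⟩
  have h2 : ∑ w ∈ range W, ∑ w' ∈ range w, Pe.real
      ({ω | ∃ i : Fin M, L < H (J (1 + w * (s * M + l) + s * i) ω') ω} ∩
        {ω | ∃ i : Fin M, L < H (J (1 + w' * (s * M + l) + s * i) ω') ω}) ≤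
      ∑ w ∈ range W, ∑ w' ∈ range w, ∑ i ∈ range M, ∑ j ∈ range M,
        P2 Pe H L (J (1 + w' * (s * M + l) + s * j) ω') (J (1 + w * (s * M + l) + s * i) ω') := by
    refine Finset.sum_le_sum fun w _ => Finset.sum_le_sum fun w' _ => ?_
    have hsub : ({ω | ∃ i : Fin M, L < H (J (1 + w * (s * M + l) + s * i) ω') ω} ∩
        {ω | ∃ i : Fin M, L < H (J (1 + w' * (s * M + l) + s * i) ω') ω}) ⊆
        ⋃ i ∈ range M, ⋃ j ∈ range M, ({ω | L < H (J (1 + w' * (s * M + l) + s * j) ω') ω} ∩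
          {ω | L < H (J (1 + w * (s * M + l) + s * i) ω') ω}) := by
      rintro ω ⟨⟨i, hi⟩, ⟨j, hj⟩⟩
      simp only [Set.mem_iUnion, Finset.mem_range]
      exact ⟨i, i.2, j, j.2, hj, hi⟩
    refine (measureReal_mono hsub (measure_ne_top _ _)).trans
      ((measureReal_biUnion_finset_le _ _).trans ?_)
    exact Finset.sum_le_sum fun i _ => measureReal_biUnion_finset_le _ _
  linarith

/-- Lower bound on the annealed mean at fixed `n`. -/
lemma mean_lower_fixed {p : ℕ} (hn : 0 < n) (hG : GV Pe H (fun x y => (n : ℝ) * overlap n x y ^ p))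
    (hW : WK Pw n J) (L : ℝ) {ε : ℝ} (hε : ε ≤ 1) {s M l W θ : ℕ} (hs : 1 ≤ s)
    (hθ : W * (s * M + l) ≤ θ) (hsM : 2 * (s * M) ≤ n) {δ τ : ℝ}
    (hδ : ∀ a, Pw.real (badW J ε s M a) ≤ δ)
    (hτ : ∀ i k, l ≤ k → ∫ ω', P2 Pe H L (J i ω') (J (i + k) ω') ∂Pw ≤ τ) :
    W * ((1 - δ) * arProb n (2 * p * (1 - ε) * s / n) M L) - (W * M) ^ 2 * τ ≤
      ∫ ω', Gx Pe H L (θ := θ) (fun k => J k ω') ∂Pw := by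
  have := hW.prob
  have hτ0 : 0 ≤ τ := le_trans (integral_nonneg fun _ => measureReal_nonneg) (hτ 0 l le_rfl)
  set A := arProb n (2 * p * (1 - ε) * s / n) M L with hA
  have hA0 : 0 ≤ A := arProb_nonneg _ _ _ _
  set F1 : Ω' → ℝ := fun ω' => ∑ w ∈ range W,
    (badW J ε s M (1 + w * (s * M + l)))ᶜ.indicator (fun _ => A) ω' with hF1
  set F2 : Ω' → ℝ := fun ω' => ∑ w ∈ range W, ∑ w' ∈ range w, ∑ i ∈ range M, ∑ j ∈ range M,
        P2 Pe H L (J (1 + w' * (s * M + l) + s * j) ω') (J (1 + w * (s * M + l) + s * i) ω') with hF2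
  have iP : ∀ i j, Integrable (fun ω' => P2 Pe H L (J i ω') (J j ω')) Pw :=
    fun i j => hW.integrable2 i j (P2 Pe H L)
  have i1w : ∀ w, Integrable ((badW J ε s M (1 + w * (s * M + l)))ᶜ.indicator (fun _ => A)) Pw :=
    fun w => (integrable_const A).indicator (meas_badW hW ε s M _).compl
  have i1 : Integrable F1 Pw := integrable_finsetSum _ fun w _ => i1w w
  have i2 : Integrable F2 Pw := integrable_finsetSum _ fun w _ => integrable_finsetSum _ fun w' _ =>
    integrable_finsetSum _ fun i _ => integrable_finsetSum _ fun j _ => iP _ _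
  have hle : ∀ᵐ ω' ∂Pw, F1 ω' - F2 ω' ≤ Gx Pe H L (θ := θ) (fun k => J k ω') := by
    filter_upwards [hW.dist_le] with ω' hω'
    refine le_trans ?_ (Gx_lower hG L hs hθ ω')
    refine sub_le_sub_right (Finset.sum_le_sum fun w _ => ?_) _
    by_cases hb : ω' ∈ badW J ε s M (1 + w * (s * M + l))
    · rw [Set.indicator_of_notMem (by simpa using hb)]; exact measureReal_nonneg
    · rw [Set.indicator_of_mem (by simpa using hb)]
      exact window_lower hn hG L hε hsM hω' hb
  have hI := integral_mono_ae (i1.sub i2) (hW.integrable θ (Gx Pe H L)) hle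
  simp only [Pi.sub_apply] at hI
  rw [integral_sub i1 i2] at hI
  refine le_trans (sub_le_sub ?_ ?_) hI
  · rw [hF1, integral_finsetSum _ fun w _ => i1w w]
    have : ∀ w ∈ range W, (1 - δ) * A ≤
        ∫ ω', (badW J ε s M (1 + w * (s * M + l)))ᶜ.indicator (fun _ => A) ω' ∂Pw := by
      intro w _
      rw [integral_indicator_const _ (meas_badW hW ε s M _).compl,
        probReal_compl_eq_one_sub (meas_badW hW ε s M _), smul_eq_mul]
      have := hδ (1 + w * (s * M + l))
      gcongr
    refine le_trans (le_of_eq ?_) (Finset.sum_le_sum this)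
    simp
  · have e1 : ∫ ω', F2 ω' ∂Pw = ∑ w ∈ range W, ∑ w' ∈ range w, ∑ i ∈ range M, ∑ j ∈ range M,
        ∫ ω', P2 Pe H L (J (1 + w' * (s * M + l) + s * j) ω')
          (J (1 + w * (s * M + l) + s * i) ω') ∂Pw := by
      rw [hF2, integral_finsetSum]
      swap
      · exact fun w _ => integrable_finsetSum _ fun w' _ =>
          integrable_finsetSum _ fun i _ => integrable_finsetSum _ fun j _ => iP _ _
      refine Finset.sum_congr rfl fun w _ => ?_
      rw [integral_finsetSum]
      swap
      · exact fun w _ => integrable_finsetSum _ fun i _ => integrable_finsetSum _ fun j _ => iP _ _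
      refine Finset.sum_congr rfl fun w _ => ?_
      rw [integral_finsetSum]
      swap
      · exact fun w _ => integrable_finsetSum _ fun j _ => iP _ _
      refine Finset.sum_congr rfl fun w _ => ?_
      rw [integral_finsetSum]
      exact fun j _ => iP _ _
    rw [e1]
    have e2 : ∀ w ∈ range W, ∑ w' ∈ range w, ∑ i ∈ range M, ∑ j ∈ range M,
        ∫ ω', P2 Pe H L (J (1 + w' * (s * M + l) + s * j) ω')
          (J (1 + w * (s * M + l) + s * i) ω') ∂Pw ≤ W * (M * (M * τ)) := by
      intro w hw
      rw [Finset.mem_range] at hw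
      have e3 : ∀ w' ∈ range w, ∑ i ∈ range M, ∑ j ∈ range M,
        ∫ ω', P2 Pe H L (J (1 + w' * (s * M + l) + s * j) ω')
          (J (1 + w * (s * M + l) + s * i) ω') ∂Pw ≤ (M * (M * τ)) := by
        intro w' hw'
        rw [Finset.mem_range] at hw'
        have e4 : ∀ i ∈ range M, ∀ j ∈ range M,
          ∫ ω', P2 Pe H L (J (1 + w' * (s * M + l) + s * j) ω')
            (J (1 + w * (s * M + l) + s * i) ω') ∂Pw ≤ τ := by
          intro i hi j hj
          rw [Finset.mem_range] at hi hj
          have h2 : (w' + 1) * (s * M + l) ≤ w * (s * M + l) := Nat.mul_le_mul_right _ hw'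
          have h3 : s * (j + 1) ≤ s * M := Nat.mul_le_mul_left _ hj
          rw [add_mul, one_mul] at h2
          rw [mul_add, mul_one] at h3
          obtain ⟨k, hk⟩ : ∃ k, 1 + w * (s * M + l) + s * i = 1 + w' * (s * M + l) + s * j + k :=
            ⟨1 + w * (s * M + l) + s * i - (1 + w' * (s * M + l) + s * j), by omega⟩
          rw [hk]
          exact hτ _ _ (by omega)
        refine (Finset.sum_le_sum fun i hi => Finset.sum_le_sum (e4 i hi)).trans ?_
        simp
      refine (Finset.sum_le_sum e3).trans ?_
      simp only [Finset.sum_const, Finset.card_range, nsmul_eq_mul]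
      have : (w : ℝ) ≤ W := by exact_mod_cast hw.le
      gcongr
    refine (Finset.sum_le_sum e2).trans (le_of_eq ?_)
    simp only [Finset.sum_const, Finset.card_range, nsmul_eq_mul]
    ring
end

-- part E5
lemma poly_exp {a K : ℝ} (q : ℝ) (ha : 0 < a) (hK : 0 < K) :
    Tendsto (fun n : ℕ => (n : ℝ) ^ q * Real.exp (-(K * (n : ℝ) ^ a))) atTop (nhds 0) := by
  have h := (tendsto_rpow_mul_exp_neg_mul_atTop_nhds_zero (q / a) K hK).comp
    ((tendsto_rpow_atTop ha).comp tendsto_natCast_atTop_atTop)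
  refine h.congr fun n => ?_
  simp only [Function.comp]
  rw [← Real.rpow_mul (Nat.cast_nonneg n), mul_div_cancel₀ _ ha.ne', neg_mul]

lemma exp_le_q0 {c : ℝ} (hc : c < 1 / 2) (hc0 : 0 < c) (v : ℝ) :
    ∀ᶠ n : ℕ in atTop, Real.exp (-(Lf c v n ^ 2 / (2 * n))) ≤ 6 * n * q0 c v n := by
  filter_upwards [eventually_gt_atTop 0, Lf_bounds hc v (show (0 : ℝ) < 1 by norm_num),
    (Lf_sqrt_tendsto hc v).eventually_ge_atTop 1,
    (γ_tendsto hc0).eventually (ge_mem_nhds (show (0 : ℝ) < 1 / 4 by norm_num))] with n hn hL hx hγ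
  have hn' : (0 : ℝ) < n := by exact_mod_cast hn
  have hn1 : (1 : ℝ) ≤ n := by exact_mod_cast hn
  set x := Lf c v n / √n with hxdef
  have hx0 : 0 < x := by linarith
  have h1 := le_Qf _ hx0
  have h2 : 1 / x ^ 2 ≤ 1 := by
    rw [div_le_one (by positivity)]; nlinarith
  have hQ : 0 < Qf x := Qf_pos _
  have h3 : gphi x ≤ 2 * Qf x * x := by
    rw [div_le_iff₀ hx0] at h1
    have : (1 + 1 / x ^ 2) * Qf x * x ≤ 2 * Qf x * x := by gcongr; linarith
    linarith
  have hsq : √(2 * π) ≤ 3 := by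
    rw [Real.sqrt_le_left (by norm_num)]
    nlinarith [Real.pi_lt_four]
  have hs0 : 0 < √(2 * π) := by positivity
  have h4 : Real.exp (-(Lf c v n ^ 2 / (2 * n))) = √(2 * π) * gphi x := by
    rw [gphi, ← mul_assoc, mul_inv_cancel₀ hs0.ne', one_mul, hxdef, div_pow, Real.sq_sqrt hn'.le]
    congr 1; field_simp
  have hxn : x ≤ n := by
    have hs1 : 1 ≤ √(n : ℝ) := by rw [Real.one_le_sqrt]; exact hn1
    have : x ≤ Lf c v n := by
      have hLx : x * √n = Lf c v n := by rw [hxdef]; field_simp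
      nlinarith
    nlinarith [hL.2]
  have hg : 0 < gphi x := gphi_pos _
  rw [h4]
  change _ ≤ 6 * n * Qf x
  calc √(2 * π) * gphi x ≤ 3 * (2 * Qf x * x) := by gcongr
    _ ≤ 3 * (2 * Qf x * n) := by gcongr
    _ = _ := by ring

lemma tau_small {c b : ℝ} (hc : c < 1 / 2) (hc0 : 0 < c) (hb : 2 * c < b) (hb1 : b < 1) (v : ℝ)
    {ε : ℝ} (hε : 0 < ε) :
    ∀ᶠ n : ℕ in atTop, 0 < Lf c v n ∧ Lf c v n ^ 2 / (2 * n ^ 2) ≤ 1 / 4 ∧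
      (θseq n : ℝ) ^ 2 * (Real.exp (-(Lf c v n ^ 2 / (2 * n))) *
      (2 * (Real.exp (-(Lf c v n ^ 2 / (2 * n ^ 2) * win b n / 4)) +
        8 / (Lf c v n ^ 2 / (2 * n ^ 2)) * Real.exp (-(Lf c v n ^ 2 / (2 * n ^ 2) * n / 4))))) ≤
      ε * (θseq n * γseq c n ^ 2 * q0 c v n) := by
  filter_upwards [eventually_gt_atTop 0, Lf_bounds hc v (show (0 : ℝ) < 1 / 2 by norm_num),
    (γ_tendsto hc0).eventually (ge_mem_nhds (show (0 : ℝ) < 1 / 4 by norm_num)),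
    exp_le_q0 hc hc0 v, (γ_sq_mul_tendsto hc).eventually_ge_atTop 1,
    (poly_exp 5 (show 0 < b - 2 * c by linarith) (show (0 : ℝ) < 1 / 32 by norm_num)).eventually
      (ge_mem_nhds (show (0 : ℝ) < ε / 2340 by positivity))] with n hn hL hγ1 hq hγn hX
  have hn' : (0 : ℝ) < n := by exact_mod_cast hn
  have hn1 : (1 : ℝ) ≤ n := by exact_mod_cast hn
  have hγ := γ_pos c hn
  have hq0 := q0_pos c v n
  set g := γseq c n with hg
  set L := Lf c v n with hLdef
  have hL0 : 0 < L := by nlinarith [hL.1, mul_pos hγ hn']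
  set μ := L ^ 2 / (2 * (n : ℝ) ^ 2) with hμ
  have hμl : g ^ 2 / 8 ≤ μ := by
    rw [hμ, le_div_iff₀ (by positivity)]
    nlinarith [hL.1, mul_pos hγ hn']
  have hμu : μ ≤ 1 / 4 := by
    rw [hμ, div_le_iff₀ (by positivity)]
    have h1 : L ≤ n / 2 := by nlinarith [hL.2]
    nlinarith
  have hμ0 : 0 < μ := by positivity
  refine ⟨hL0, hμu, ?_⟩
  set X := Real.exp (-(1 / 32 * (n : ℝ) ^ (b - 2 * c))) with hXdef
  have hX0 : 0 < X := Real.exp_pos _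
  have hna : (n : ℝ) ^ (b - 2 * c) = (n : ℝ) ^ b * g ^ 2 := by
    rw [hg, γseq, ← Real.rpow_natCast ((n : ℝ) ^ (-c)), ← Real.rpow_mul hn'.le, ← Real.rpow_add hn']
    congr 1; push_cast; ring
  have hE : ∀ k : ℝ, (n : ℝ) ^ b ≤ k → Real.exp (-(μ * k / 4)) ≤ X := by
    intro k hk
    rw [hXdef, Real.exp_le_exp, hna]
    have : g ^ 2 / 8 * (n : ℝ) ^ b ≤ μ * k := by gcongr
    linarith
  have hE1 := hE _ (win_ge b n)
  have hE2 := hE n (by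
    calc (n : ℝ) ^ b ≤ (n : ℝ) ^ (1 : ℝ) := Real.rpow_le_rpow_of_exponent_le hn1 hb1.le
      _ = n := Real.rpow_one _)
  have h8 : 8 / μ ≤ 64 * n := by
    rw [div_le_iff₀ hμ0]
    nlinarith
  have hX' : (n : ℝ) ^ 5 * X ≤ ε / 2340 := by exact_mod_cast hX
  have hθ : (θseq n : ℝ) = 3 * (n : ℝ) ^ 2 := by simp [θseq]
  have hin : Real.exp (-(μ * win b n / 4)) + 8 / μ * Real.exp (-(μ * n / 4)) ≤ 65 * n * X := by
    have : 8 / μ * Real.exp (-(μ * n / 4)) ≤ 64 * n * X := by gcongr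
    nlinarith
  calc (θseq n : ℝ) ^ 2 * (Real.exp (-(L ^ 2 / (2 * n))) *
      (2 * (Real.exp (-(μ * win b n / 4)) + 8 / μ * Real.exp (-(μ * n / 4)))))
      ≤ (θseq n : ℝ) ^ 2 * ((6 * n * q0 c v n) * (2 * (65 * n * X))) := by gcongr
    _ = (7020 * n * q0 c v n) * ((n : ℝ) ^ 5 * X) := by rw [hθ]; ring
    _ ≤ (7020 * n * q0 c v n) * (ε / 2340) := by gcongr
    _ = ε * (3 * n * 1 * q0 c v n) := by ring
    _ ≤ ε * (3 * n * (g ^ 2 * n) * q0 c v n) := by gcongr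
    _ = _ := by rw [hθ]; ring

lemma lower_arith {ε n p s M l W Q T θ A : ℝ} (hε : 0 < ε) (hε1 : ε < 1) (hn1 : 1 ≤ n) (hp' : 1 ≤ p)
    (hs' : 1 ≤ s) (hM0 : 0 ≤ M) (hl0 : 0 ≤ l) (hW0 : 0 ≤ W) (hQ0 : 0 < Q) (hT0 : 0 ≤ T)
    (hθ3 : θ = 3 * n ^ 2) (hsM : 2 * (s * M) ≤ n) (hlM : l ≤ ε * (s * M)) (h6 : 1 / ε ≤ n)
    (c1 : W * (s * M + l) ≤ θ) (c2 : θ ≤ (W + 1) * (s * M + l))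
    (hA : (1 - ε) * (2 * p * (1 - ε) * s * M * Q) ≤ A) (hT : θ ^ 2 * T ≤ ε * (θ * Q)) :
    (1 - 6 * ε) * (2 * p * θ * Q) ≤ W * ((1 - ε) * A) - (W * M) ^ 2 * T := by
  have hθ0 : 0 < θ := by rw [hθ3]; positivity
  have he : 0 < 1 - ε := by linarith
  have hsM0 : 0 ≤ s * M := by positivity
  have hMsM : M ≤ s * M := le_mul_of_one_le_left hM0 hs'
  have c3 : s * M + l ≤ ε * θ := by
    rw [div_le_iff₀ hε] at h6
    have h1 : l ≤ s * M := hlM.trans (mul_le_of_le_one_left hsM0 hε1.le)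
    have h2 : s * M + l ≤ n := by linarith
    have h3 : n * 1 ≤ n * (n * ε) := by gcongr
    have h4 : 0 ≤ n * (n * ε) := by positivity
    rw [hθ3]
    calc s * M + l ≤ n := h2
      _ ≤ n * (n * ε) := by linarith
      _ ≤ 3 * (n * (n * ε)) := by linarith
      _ = _ := by ring
  have c4 : (1 - ε) * θ ≤ (1 + ε) * (W * (s * M)) := by
    have h1 : W * l ≤ W * (ε * (s * M)) := by gcongr
    have h2 : (W + 1) * (s * M + l) = W * (s * M) + W * l + (s * M + l) := by ring
    have h3 : W * (ε * (s * M)) = ε * (W * (s * M)) := by ring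
    linarith
  have c5 : (1 - ε) ^ 2 * θ ≤ W * (s * M) := by
    have h0 : (1 - ε) ^ 2 * θ * (1 + ε) ≤ (1 - ε) * θ := by
      have h1 : 0 ≤ (1 - ε) * θ * ε ^ 2 := by positivity
      have h2 : (1 - ε) ^ 2 * θ * (1 + ε) = (1 - ε) * θ - (1 - ε) * θ * ε ^ 2 := by ring
      linarith
    have h7 : (1 - ε) ^ 2 * θ * (1 + ε) ≤ W * (s * M) * (1 + ε) := by linarith
    exact le_of_mul_le_mul_right h7 (by linarith)
  have c6 : (W * M) ^ 2 * T ≤ ε * (θ * Q) := by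
    have h1 : W * M ≤ W * (s * M + l) := by
      gcongr; linarith
    have h2 : W * M ≤ θ := by linarith
    have h8 : (W * M) ^ 2 * T ≤ θ ^ 2 * T := by gcongr
    exact h8.trans hT
  have c7 : W * ((1 - ε) * ((1 - ε) * (2 * p * (1 - ε) * s * M * Q))) ≤ W * ((1 - ε) * A) := by
    gcongr
  have c8 : (1 - ε) ^ 5 * (2 * p * θ * Q) ≤
      W * ((1 - ε) * ((1 - ε) * (2 * p * (1 - ε) * s * M * Q))) := by
    calc (1 - ε) ^ 5 * (2 * p * θ * Q) = ((1 - ε) ^ 2 * θ) * ((1 - ε) ^ 3 * (2 * p * Q)) := by ring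
      _ ≤ (W * (s * M)) * ((1 - ε) ^ 3 * (2 * p * Q)) := by gcongr
      _ = _ := by ring
  have c9 : 1 - 5 * ε ≤ (1 - ε) ^ 5 := by
    have := one_add_mul_le_pow (show (-2 : ℝ) ≤ -ε by linarith) 5
    push_cast at this
    rw [← sub_eq_add_neg] at this
    linarith
  have c10 : (1 - 5 * ε) * (2 * p * θ * Q) ≤ (1 - ε) ^ 5 * (2 * p * θ * Q) := by gcongr
  have c11 : ε * (θ * Q) ≤ ε * (2 * p * θ * Q) := by
    have h1 : 0 < ε * (θ * Q) := by positivity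
    have h2 : ε * (2 * p * θ * Q) = 2 * p * (ε * (θ * Q)) := by ring
    rw [h2]
    exact le_mul_of_one_le_left h1.le (by linarith)
  have c13 : (1 - 6 * ε) * (2 * p * θ * Q) = (1 - 5 * ε) * (2 * p * θ * Q) - ε * (2 * p * θ * Q) := by
    ring
  rw [c13]
  linarith

section
variable {Ω : Type*} [MeasurableSpace Ω] {Pe : Measure Ω}  {H : (n : ℕ) → V n → Ω → ℝ}
  {Ω' : Type*} [MeasurableSpace Ω'] {Pw : Measure Ω'} {J : (n : ℕ) → ℕ → Ω' → V n} {p : ℕ} {c : ℝ}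

set_option maxHeartbeats 2000000 in
lemma mean_lower_aux (hp : 0 < p) (hc0 : 0 < c) (hc : c < 1 / 2) (v : ℝ)
    (hG : ∀ n : ℕ, GV Pe (H n) (fun x y => (n : ℝ) * overlap n x y ^ p))
    (hW : ∀ n, 0 < n → WK Pw n (J n)) {ε : ℝ} (hε : 0 < ε) (hε1 : ε < 1) :
    ∀ᶠ n : ℕ in atTop, (1 - 6 * ε) * (2 * p * θseq n * γseq c n ^ 2 * q0 c v n) ≤
      ∫ ω, Mx Pw (J n) (θseq n) (Lf c v n) (fun x => H n x ω) ∂Pe := by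
  set b : ℝ := (2 + 2 * c) / 3 with hb
  set b' : ℝ := (1 + 4 * c) / 3 with hb'
  have hb0 : 0 < b := by rw [hb]; linarith
  have hb1 : b < 1 := by rw [hb]; linarith
  have hb0' : 0 < b' := by rw [hb']; linarith
  have hbb : b' < b := by rw [hb, hb']; linarith
  have hbc : 2 * c < b' := by rw [hb']; linarith
  have hp' : (1 : ℝ) ≤ p := by exact_mod_cast hp
  have he : 0 < 1 - ε := by linarith
  set a : ℝ := (1 - b) / 4 * ε with ha
  have ha0 : 0 < a := by rw [ha]; have : 0 < 1 - b := by linarith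
                         positivity
  obtain ⟨s, hs1, hsa⟩ : ∃ s : ℕ, 1 ≤ s ∧ 3 ≤ a * s := by
    refine ⟨⌈3 / a⌉₊ + 1, by omega, ?_⟩
    have := Nat.le_ceil (3 / a)
    rw [div_le_iff₀ ha0] at this
    push_cast
    nlinarith
  have hs' : (1 : ℝ) ≤ s := by exact_mod_cast hs1
  have hκ : 0 < 2 * p * (1 - ε) * s := by positivity
  have hmn := win_div_n hb0 hb1
  have hna : Tendsto (fun n : ℕ => (n : ℝ) ^ (-a)) atTop (nhds 0) :=
    (tendsto_rpow_neg_atTop ha0).comp tendsto_natCast_atTop_atTop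
  have hninv : Tendsto (fun n : ℕ => (2 : ℝ) ^ s * ((n : ℝ))⁻¹) atTop (nhds ((2 : ℝ) ^ s * 0)) :=
    (tendsto_inv_atTop_zero.comp tendsto_natCast_atTop_atTop).const_mul _
  rw [mul_zero] at hninv
  filter_upwards [eventually_gt_atTop 0,
    arProb_lower hc0 hc v hκ (win b) (win_γ (by linarith)) hmn hε,
    hmn.eventually (ge_mem_nhds (show (0 : ℝ) < 1 / (2 * s) by positivity)),
    (win_div hb0 (show b < (1 + b) / 2 by linarith)).eventually
      (ge_mem_nhds (show (0 : ℝ) < 1 / s by positivity)),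
    hna.eventually (ge_mem_nhds (show (0 : ℝ) < 1 / 2 by norm_num)),
    hninv.eventually (ge_mem_nhds hε),
    (win_div hb0' hbb).eventually (ge_mem_nhds hε),
    tendsto_natCast_atTop_atTop.eventually_ge_atTop (1 / ε),
    tau_small hc hc0 hbc (by linarith) v hε] with n hn hlow h1 h2 h3 h4 h5 h6 hτ
  have hn' : (0 : ℝ) < n := by exact_mod_cast hn
  have hn1 : (1 : ℝ) ≤ n := by exact_mod_cast hn
  have hprob := (hW n hn).prob
  obtain ⟨hL0, hμ1, hτ⟩ := hτ
  set M := win b n with hM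
  set l := win b' n with hl
  have hM0 : (0 : ℝ) ≤ M := Nat.cast_nonneg _
  have hMpos : 0 < M := win_pos b hn
  have hMsM : (M : ℝ) ≤ s * M := le_mul_of_one_le_left hM0 hs'
  have hsM : 2 * ((s : ℝ) * M) ≤ n := by
    rw [div_le_iff₀ hn', div_mul_eq_mul_div, le_div_iff₀ (by positivity)] at h1
    linarith
  have hsM' : 2 * (s * M) ≤ n := by exact_mod_cast hsM
  have hlM : (l : ℝ) ≤ ε * (s * M) := by
    rw [div_le_iff₀ (by positivity)] at h5
    have : (n : ℝ) ^ b ≤ s * M := by linarith [win_ge b n]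
    exact h5.trans (mul_le_mul_of_nonneg_left this hε.le)
  set lam : ℝ := (1 - b) / 4 * Real.log n with hlam
  have hlam0 : 0 ≤ lam := by
    have := Real.log_nonneg hn1
    have : 0 < 1 - b := by linarith
    positivity
  have hexp : Real.exp (2 * lam) = (n : ℝ) ^ ((1 - b) / 2) := by
    rw [Real.rpow_def_of_pos hn', hlam]; congr 1; ring
  have hexp2 : Real.exp (-(lam * ε)) = (n : ℝ) ^ (-a) := by
    rw [Real.rpow_def_of_pos hn', hlam, ha]; congr 1; ring
  have hshort : ((s * M : ℕ) : ℝ) * Real.exp (2 * lam) ≤ n := by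
    rw [hexp]
    rw [div_le_iff₀ (by positivity), div_mul_eq_mul_div, one_mul, le_div_iff₀ (by positivity)] at h2
    push_cast
    calc (s : ℝ) * M * (n : ℝ) ^ ((1 - b) / 2) ≤ (n : ℝ) ^ ((1 + b) / 2) * (n : ℝ) ^ ((1 - b) / 2) := by
          gcongr; linarith
      _ = n := by
          rw [← Real.rpow_add hn', show (1 + b) / 2 + (1 - b) / 2 = 1 by ring, Real.rpow_one]
  have hr : 2 * Real.exp (-(lam * ε)) ≤ 1 := by rw [hexp2]; linarith
  have hδ : ∀ q, Pw.real (badW (J n) ε s M q) ≤ ε := by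
    intro q
    refine (prob_badW (hW n hn) s M q hlam0 hshort hr).trans (le_trans ?_ h4)
    rw [hexp2, mul_pow]
    have hMn : (M : ℝ) ≤ n := by linarith
    have hpw : ((n : ℝ) ^ (-a)) ^ s ≤ (n : ℝ) ^ (-3 : ℝ) := by
      rw [← Real.rpow_natCast, ← Real.rpow_mul hn'.le]
      exact Real.rpow_le_rpow_of_exponent_le hn1 (by linarith)
    calc (M : ℝ) ^ 2 * (2 ^ s * ((n : ℝ) ^ (-a)) ^ s) ≤ (n : ℝ) ^ 2 * (2 ^ s * (n : ℝ) ^ (-3 : ℝ)) := by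
          gcongr
      _ = 2 ^ s * (n : ℝ)⁻¹ := by
          rw [Real.rpow_neg hn'.le, show (3 : ℝ) = ((3 : ℕ) : ℝ) by norm_num, Real.rpow_natCast]
          field_simp
  set W := θseq n / (s * M + l) with hWd
  have hθW : W * (s * M + l) ≤ θseq n := Nat.div_mul_le_self _ _
  have hsMp : 0 < s * M + l := by positivity
  have hθW2 : θseq n < (W + 1) * (s * M + l) := by
    have := Nat.lt_div_mul_add hsMp (a := θseq n)
    rw [add_mul, one_mul]; exact this
  have hmain := mean_lower_fixed (p := p) hn (hG n) (hW n hn) (Lf c v n) hε1.le hs1 hθW hsM' hδ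
    (τ := Real.exp (-(Lf c v n ^ 2 / (2 * n))) *
      (2 * (Real.exp (-(Lf c v n ^ 2 / (2 * n ^ 2) * l / 4)) +
        8 / (Lf c v n ^ 2 / (2 * n ^ 2)) * Real.exp (-(Lf c v n ^ 2 / (2 * n ^ 2) * n / 4)))))
    (by
      intro i k hk
      refine (pair_mean hp hn (hG n) (hW n hn) hL0 rfl hμ1 i k).trans ?_
      have : (l : ℝ) ≤ k := by exact_mod_cast hk
      gcongr)
  rw [integral_Mx (hG n) (hW n hn)]
  refine le_trans ?_ hmain
  have hq := q0_pos c v n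
  have hγ := γ_pos c hn
  set Q := γseq c n ^ 2 * q0 c v n with hQ
  have hQ0 : 0 < Q := by positivity
  set T := Real.exp (-(Lf c v n ^ 2 / (2 * n))) *
      (2 * (Real.exp (-(Lf c v n ^ 2 / (2 * n ^ 2) * l / 4)) +
        8 / (Lf c v n ^ 2 / (2 * n ^ 2)) * Real.exp (-(Lf c v n ^ 2 / (2 * n ^ 2) * n / 4)))) with hT
  have hT0 : 0 ≤ T := by positivity
  have hθ3 : (θseq n : ℝ) = 3 * (n : ℝ) ^ 2 := by simp [θseq]
  have c1 : (W : ℝ) * (s * M + l) ≤ θseq n := by exact_mod_cast hθW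
  have c2 : (θseq n : ℝ) ≤ ((W : ℝ) + 1) * (s * M + l) := by exact_mod_cast hθW2.le
  have hq' : (1 - ε) * (2 * p * (1 - ε) * s * M * Q) ≤
      arProb n (2 * p * (1 - ε) * s / n) M (Lf c v n) := by
    rw [hQ, ← mul_assoc (2 * p * (1 - ε) * s * (M : ℝ))]
    exact hlow
  have hτ' : (θseq n : ℝ) ^ 2 * T ≤ ε * (θseq n * Q) := by
    rw [hQ, ← mul_assoc (θseq n : ℝ)]
    exact hτ
  have hfin := lower_arith hε hε1 hn1 hp' hs' hM0 (Nat.cast_nonneg l) (Nat.cast_nonneg W) hQ0 hT0 hθ3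
    hsM hlM h6 c1 c2 hq' hτ'
  have c12 : 2 * p * θseq n * γseq c n ^ 2 * q0 c v n = 2 * p * θseq n * Q := by rw [hQ]; ring
  rw [c12]
  exact hfin

lemma mean_tendsto (hp : 0 < p) (hc0 : 0 < c) (hc : c < 1 / 2) (v : ℝ)
    (hG : ∀ n : ℕ, GV Pe (H n) (fun x y => (n : ℝ) * overlap n x y ^ p))
    (hW : ∀ n, 0 < n → WK Pw n (J n)) :
    Tendsto (fun n => aseq c n / θseq n *
      ∫ ω, Mx Pw (J n) (θseq n) (Lf c v n) (fun x => H n x ω) ∂Pe) atTop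
      (nhds (2 * p * Real.exp (-v))) := by
  have hp' : (0 : ℝ) < p := by exact_mod_cast hp
  have hq := (q0_asymp hc v).const_mul (2 * p : ℝ)
  have hratio : Tendsto (fun n => (∫ ω, Mx Pw (J n) (θseq n) (Lf c v n) (fun x => H n x ω) ∂Pe) /
      (2 * p * θseq n * γseq c n ^ 2 * q0 c v n)) atTop (nhds 1) := by
    rw [Metric.tendsto_atTop']
    intro ε hε
    have h0 : 0 < min (ε / 12) (1 / 2) := by positivity
    have h1 : min (ε / 12) (1 / 2) < 1 := lt_of_le_of_lt (min_le_right _ _) (by norm_num)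
    have h2 : min (ε / 12) (1 / 2) ≤ ε / 12 := min_le_left _ _
    have hev := (mean_lower_aux (Pw := Pw) (J := J) hp hc0 hc v hG hW h0 h1).and
      ((mean_upper (Pw := Pw) (J := J) hp hc0 hc v hG hW h0).and (eventually_gt_atTop 0))
    obtain ⟨N, hN⟩ := eventually_atTop.1 hev
    refine ⟨N, fun n hn => ?_⟩
    obtain ⟨hl, hu, hn0⟩ := hN n hn.le
    have hn' : (0 : ℝ) < n := by exact_mod_cast hn0
    have hθ : (0 : ℝ) < θseq n := by simp only [θseq]; push_cast; positivity
    have hD : 0 < 2 * p * θseq n * γseq c n ^ 2 * q0 c v n := by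
      have := q0_pos c v n
      have := γ_pos c hn0
      positivity
    rw [← le_div_iff₀ hD] at hl
    rw [← div_le_iff₀ hD] at hu
    rw [Real.dist_eq, abs_lt]
    constructor <;> linarith
  have := hratio.mul hq
  rw [one_mul] at this
  refine this.congr' ?_
  filter_upwards [eventually_gt_atTop 0] with n hn
  have hn' : (0 : ℝ) < n := by exact_mod_cast hn
  have hθ : (0 : ℝ) < θseq n := by simp only [θseq]; push_cast; positivity
  have := q0_pos c v n
  have := γ_pos c hn
  field_simp
end

-- part F1
/-- times `1 ≤ j ≤ θ` -/
def tms (θ : ℕ) : Finset (Fin (θ + 1)) := univ.filter (fun j => 1 ≤ (j : ℕ))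

lemma card_tms (θ : ℕ) : (tms θ).card ≤ θ := by
  have h : tms θ ⊆ univ.erase 0 := by
    intro j hj
    simp only [tms, Finset.mem_filter, Finset.mem_univ, true_and] at hj
    simp only [Finset.mem_erase, Finset.mem_univ, and_true]
    rintro rfl
    simp at hj
  have := Finset.card_le_card h
  rw [Finset.card_erase_of_mem (Finset.mem_univ _), Finset.card_univ, Fintype.card_fin] at this
  omega

/-- smoothed exceedance probability -/
noncomputable def Ms (φ : ℝ → ℝ) (n θ : ℕ) (h : V n → ℝ) : ℝ :=
  1 - ∑ xs : Fin (θ + 1) → V n, wt n θ xs * ∏ j ∈ tms θ, φ (h (xs j))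

/-- partial derivative of `Ms` -/
noncomputable def Msd (φ ψ : ℝ → ℝ) (n θ : ℕ) (x : V n) (h : V n → ℝ) : ℝ :=
  ψ (h x) * ∑ xs : Fin (θ + 1) → V n, wt n θ xs *
    ∑ j ∈ tms θ, (if xs j = x then 1 else 0) * ∏ i ∈ (tms θ).erase j, φ (h (xs i))

section
variable {φ ψ : ℝ → ℝ} {n θ : ℕ}

lemma Ms_hasFDerivAt (hφ : ∀ x, HasDerivAt φ (-(ψ x)) x) (h : V n → ℝ) :
    HasFDerivAt (Ms φ n θ) (∑ x, Msd φ ψ n θ x h •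
      ContinuousLinearMap.proj (R := ℝ) (φ := fun _ : V n => ℝ) x) h := by
  have h1 : ∀ xs : Fin (θ + 1) → V n, HasFDerivAt (fun h : V n → ℝ => ∏ j ∈ tms θ, φ (h (xs j)))
      (∑ j ∈ tms θ, (∏ i ∈ (tms θ).erase j, φ (h (xs i))) • (-(ψ (h (xs j))) •
        ContinuousLinearMap.proj (R := ℝ) (φ := fun _ : V n => ℝ) (xs j))) h := by
    intro xs
    refine HasFDerivAt.finsetProd (g := fun j (h : V n → ℝ) => φ (h (xs j))) fun j _ => ?_
    have h2 : HasFDerivAt (fun h : V n → ℝ => h (xs j))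
      (ContinuousLinearMap.proj (R := ℝ) (φ := fun _ : V n => ℝ) (xs j)) h :=
      (ContinuousLinearMap.proj (R := ℝ) (φ := fun _ : V n => ℝ) (xs j)).hasFDerivAt
    exact (hφ (h (xs j))).comp_hasFDerivAt h h2
  have h3 : HasFDerivAt (fun h : V n → ℝ => ∑ xs : Fin (θ + 1) → V n, wt n θ xs *
      ∏ j ∈ tms θ, φ (h (xs j))) (∑ xs : Fin (θ + 1) → V n, wt n θ xs •
      (∑ j ∈ tms θ, (∏ i ∈ (tms θ).erase j, φ (h (xs i))) • (-(ψ (h (xs j))) •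
        ContinuousLinearMap.proj (R := ℝ) (φ := fun _ : V n => ℝ) (xs j)))) h :=
    HasFDerivAt.fun_sum fun xs _ => (h1 xs).const_mul (wt n θ xs)
  have h4 := h3.const_sub 1
  refine h4.congr_fderiv ?_
  ext g
  simp only [_root_.neg_apply, _root_.sum_apply,
    _root_.smul_apply, ContinuousLinearMap.proj_apply, smul_eq_mul, Msd]
  simp only [Finset.mul_sum, Finset.sum_mul]
  rw [← Finset.sum_neg_distrib, Finset.sum_comm]
  refine Finset.sum_congr rfl fun xs _ => ?_
  rw [← Finset.sum_neg_distrib, Finset.sum_comm]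
  refine Finset.sum_congr rfl fun j _ => ?_
  rw [Finset.sum_eq_single (xs j)]
  · simp; ring
  · intro x _ hx; rw [if_neg (Ne.symm hx)]; ring
  · intro hx; exact absurd (Finset.mem_univ _) hx

variable {Ω' : Type*} [MeasurableSpace Ω'] {Pw : Measure Ω'} {J : ℕ → Ω' → V n}

lemma sum_wt_eq (hW : WK Pw n J) (j : Fin (θ + 1)) (x : V n) :
    ∑ xs : Fin (θ + 1) → V n, wt n θ xs * (if xs j = x then 1 else 0) = ((2 : ℝ) ^ n)⁻¹ := by
  have := hW.prob
  rw [← hW.marg j x, ← hW.integral_eq θ (fun xs => if xs j = x then 1 else 0)]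
  have hm : MeasurableSet {ω' | J j ω' = x} := hW.meas j (MeasurableSet.singleton x)
  rw [← integral_indicator_one hm]
  congr 1
  ext ω'
  by_cases hx : J j ω' = x
  · rw [Set.indicator_of_mem (by exact hx)]; simp [hx]
  · rw [Set.indicator_of_notMem (by exact hx)]; simp [hx]

lemma Msd_bound (hW : WK Pw n J) (h0 : ∀ x, 0 ≤ φ x) (h1 : ∀ x, φ x ≤ 1) {K L : ℝ}
    (hψ : ∀ x, |ψ x| ≤ K) (hψ0 : ∀ x ≤ L, ψ x = 0) (x : V n) (h : V n → ℝ) :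
    |Msd φ ψ n θ x h| ≤ K * (θ * ((2 : ℝ) ^ n)⁻¹) * (if L < h x then 1 else 0) := by
  have hK : 0 ≤ K := (abs_nonneg _).trans (hψ 0)
  by_cases hx : L < h x
  swap
  · rw [if_neg hx, Msd, hψ0 _ (not_lt.1 hx)]; simp
  rw [if_pos hx, mul_one, Msd, abs_mul]
  have hpr : ∀ (xs : Fin (θ + 1) → V n) (j : Fin (θ + 1)),
      0 ≤ ∏ i ∈ (tms θ).erase j, φ (h (xs i)) ∧ ∏ i ∈ (tms θ).erase j, φ (h (xs i)) ≤ 1 :=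
    fun xs j => ⟨Finset.prod_nonneg fun _ _ => h0 _, Finset.prod_le_one (fun _ _ => h0 _) fun _ _ => h1 _⟩
  have hnn : ∀ (xs : Fin (θ + 1) → V n) (j : Fin (θ + 1)), (0 : ℝ) ≤ (if xs j = x then 1 else 0) := by
    intro xs j; split_ifs <;> norm_num
  have hS0 : 0 ≤ ∑ xs : Fin (θ + 1) → V n, wt n θ xs *
    ∑ j ∈ tms θ, (if xs j = x then 1 else 0) * ∏ i ∈ (tms θ).erase j, φ (h (xs i)) :=
    Finset.sum_nonneg fun xs _ => mul_nonneg (wt_nonneg _ _ _) (Finset.sum_nonneg fun j _ =>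
      mul_nonneg (hnn _ _) (hpr xs j).1)
  rw [abs_of_nonneg hS0]
  refine mul_le_mul (hψ _) ?_ hS0 hK
  calc ∑ xs : Fin (θ + 1) → V n, wt n θ xs *
        ∑ j ∈ tms θ, (if xs j = x then 1 else 0) * ∏ i ∈ (tms θ).erase j, φ (h (xs i))
      ≤ ∑ xs : Fin (θ + 1) → V n, wt n θ xs * ∑ j ∈ tms θ, (if xs j = x then 1 else 0) := by
        refine Finset.sum_le_sum fun xs _ => mul_le_mul_of_nonneg_left
          (Finset.sum_le_sum fun j _ => ?_) (wt_nonneg _ _ _)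
        exact mul_le_of_le_one_right (hnn _ _) (hpr xs j).2
    _ = ∑ j ∈ tms θ, ∑ xs : Fin (θ + 1) → V n, wt n θ xs * (if xs j = x then 1 else 0) := by
        simp only [Finset.mul_sum]; rw [Finset.sum_comm]
    _ = ∑ j ∈ tms θ, ((2 : ℝ) ^ n)⁻¹ := Finset.sum_congr rfl fun j _ => sum_wt_eq hW j x
    _ ≤ _ := by
        rw [Finset.sum_const, nsmul_eq_mul]
        have : ((tms θ).card : ℝ) ≤ θ := by exact_mod_cast card_tms θ
        gcongr

lemma Ms_eq (hn : 0 < n) (h : V n → ℝ) : Ms φ n θ h = ∑ xs : Fin (θ + 1) → V n, wt n θ xs *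
    (1 - ∏ j ∈ tms θ, φ (h (xs j))) := by
  unfold Ms
  simp only [mul_sub, mul_one]
  rw [Finset.sum_sub_distrib, sum_wt n θ hn]

lemma Ms_abs (hn : 0 < n) (h0 : ∀ x, 0 ≤ φ x) (h1 : ∀ x, φ x ≤ 1) (h : V n → ℝ) :
    |Ms φ n θ h| ≤ 1 := by
  rw [Ms_eq hn]
  have hpr : ∀ (xs : Fin (θ + 1) → V n),
      0 ≤ ∏ i ∈ tms θ, φ (h (xs i)) ∧ ∏ i ∈ tms θ, φ (h (xs i)) ≤ 1 :=
    fun xs => ⟨Finset.prod_nonneg fun _ _ => h0 _, Finset.prod_le_one (fun _ _ => h0 _) fun _ _ => h1 _⟩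
  rw [abs_of_nonneg (Finset.sum_nonneg fun xs _ => mul_nonneg (wt_nonneg _ _ _)
    (by linarith [(hpr xs).2]))]
  refine le_trans (Finset.sum_le_sum fun xs _ => ?_) (sum_wt n θ hn).le
  exact mul_le_of_le_one_right (wt_nonneg _ _ _) (by linarith [(hpr xs).1])

lemma Ms_le_Mx (hW : WK Pw n J) (h0 : ∀ x, 0 ≤ φ x) {L : ℝ} (hL : ∀ x ≤ L, φ x = 1)
    (h : V n → ℝ) : Ms φ n θ h ≤ Mx Pw J θ L h := by
  rw [Ms_eq hW.pos, Mx_eq hW]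
  refine Finset.sum_le_sum fun xs _ => mul_le_mul_of_nonneg_left ?_ (wt_nonneg _ _ _)
  by_cases hx : ∃ j : Fin (θ + 1), 1 ≤ (j : ℕ) ∧ L < h (xs j)
  · rw [Set.indicator_of_mem (by exact hx)]
    have : 0 ≤ ∏ j ∈ tms θ, φ (h (xs j)) := Finset.prod_nonneg fun _ _ => h0 _
    simp only [Pi.one_apply]; linarith
  · rw [Set.indicator_of_notMem (by exact hx)]
    push Not at hx
    rw [Finset.prod_eq_one, sub_self]
    intro j hj
    simp only [tms, Finset.mem_filter, Finset.mem_univ, true_and] at hj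
    exact hL _ (hx j hj)

lemma Mx_le_Ms (hW : WK Pw n J) (h0 : ∀ x, 0 ≤ φ x) (h1 : ∀ x, φ x ≤ 1) {L : ℝ}
    (hL : ∀ x, L < x → φ x = 0) (h : V n → ℝ) : Mx Pw J θ L h ≤ Ms φ n θ h := by
  rw [Ms_eq hW.pos, Mx_eq hW]
  refine Finset.sum_le_sum fun xs _ => mul_le_mul_of_nonneg_left ?_ (wt_nonneg _ _ _)
  by_cases hx : ∃ j : Fin (θ + 1), 1 ≤ (j : ℕ) ∧ L < h (xs j)
  · rw [Set.indicator_of_mem (by exact hx)]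
    obtain ⟨j, hj, hj2⟩ := hx
    rw [Finset.prod_eq_zero (i := j) (by simpa [tms] using hj) (hL _ hj2)]
    simp
  · rw [Set.indicator_of_notMem (by exact hx)]
    have := Finset.prod_le_one (s := tms θ) (f := fun j => φ (h (xs j))) (fun _ _ => h0 _) fun _ _ => h1 _
    linarith

variable {Ω : Type*} [MeasurableSpace Ω] {Pe : Measure Ω} {H : V n → Ω → ℝ}

lemma Ms_var {p : ℕ} (hG : GV Pe H (fun x y => (n : ℝ) * overlap n x y ^ p)) (hW : WK Pw n J)
    (hφ : ∀ x, HasDerivAt φ (-(ψ x)) x) (hψc : Continuous ψ)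
    (h0 : ∀ x, 0 ≤ φ x) (h1 : ∀ x, φ x ≤ 1) {K L : ℝ}
    (hψ : ∀ x, |ψ x| ≤ K) (hψ0 : ∀ x ≤ L, ψ x = 0) :
    Var[fun ω => Ms φ n θ (fun x => H x ω); Pe] ≤ π ^ 2 / 8 * ((K * (θ * ((2 : ℝ) ^ n)⁻¹)) ^ 2 *
      ∑ x, ∑ y, n * (|overlap n x y| ^ p * P2 Pe H L x y)) := by
  have := hG.prob
  have hK : 0 ≤ K := (abs_nonneg _).trans (hψ 0)
  have hφc : Continuous φ := continuous_iff_continuousAt.2 fun x => (hφ x).continuousAt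
  set B := K * (θ * ((2 : ℝ) ^ n)⁻¹) with hB
  have hB0 : 0 ≤ B := by positivity
  have hb := Msd_bound (θ := θ) hW h0 h1 hψ hψ0
  have hbc : ∀ x, Continuous (Msd φ ψ n θ x) := by
    intro x; unfold Msd
    fun_prop
  have hind : ∀ z : ℝ, (if L < z then (1 : ℝ) else 0) ≤ 1 := by intro z; split_ifs <;> norm_num
  have hind0 : ∀ z : ℝ, 0 ≤ (if L < z then (1 : ℝ) else 0) := by intro z; split_ifs <;> norm_num
  have hp := gaussian_poincare hG (Ms φ n θ) (Msd φ ψ n θ) (max 1 B)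
    (fun h => (Ms_abs hW.pos h0 h1 h).trans (le_max_left _ _)) hbc
    (fun x h => (hb x h).trans ((mul_le_of_le_one_right hB0 (hind _)).trans (le_max_right _ _)))
    (Ms_hasFDerivAt hφ)
  refine hp.trans ?_
  gcongr
  have hm : ∀ x, MeasurableSet {ω | L < H x ω} := fun x => measurableSet_lt measurable_const (hG.meas x)
  have hi2 : ∀ x y, Integrable (fun ω => B ^ 2 * (n * (|overlap n x y| ^ p *
      ({ω | L < H x ω} ∩ {ω | L < H y ω}).indicator 1 ω))) Pe := fun x y =>
    ((((integrable_const (1 : ℝ)).indicator ((hm x).inter (hm y))).const_mul _).const_mul _).const_mul _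
  have hH : ∀ x, Measurable (H x) := hG.meas
  have hvec : Measurable (fun ω => (fun k => H k ω)) := measurable_pi_lambda _ hH
  have hi1 : ∀ x y, Integrable (fun ω => ((n : ℝ) * overlap n x y ^ p) *
      (Msd φ ψ n θ x (fun k => H k ω) * Msd φ ψ n θ y (fun k => H k ω))) Pe := by
    intro x y
    refine Integrable.const_mul ?_ _
    refine Integrable.of_bound (C := B * B)
      (((hbc x).measurable.comp hvec).mul ((hbc y).measurable.comp hvec)).aestronglyMeasurable
      (Eventually.of_forall fun ω => ?_)
    rw [norm_mul]
    exact mul_le_mul ((hb x _).trans (mul_le_of_le_one_right hB0 (hind _)))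
      ((hb y _).trans (mul_le_of_le_one_right hB0 (hind _))) (norm_nonneg _) hB0
  rw [integral_finsetSum _ fun x _ => integrable_finsetSum _ fun y _ => hi1 x y, Finset.mul_sum]
  refine Finset.sum_le_sum fun x _ => ?_
  rw [integral_finsetSum _ fun y _ => hi1 x y, Finset.mul_sum]
  refine Finset.sum_le_sum fun y _ => ?_
  have hfin : B ^ 2 * (n * (|overlap n x y| ^ p * P2 Pe H L x y)) =
      ∫ ω, B ^ 2 * (n * (|overlap n x y| ^ p *
      ({ω | L < H x ω} ∩ {ω | L < H y ω}).indicator 1 ω)) ∂Pe := by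
    rw [integral_const_mul, integral_const_mul, integral_const_mul,
      integral_indicator_one ((hm x).inter (hm y))]
    rfl
  rw [hfin]
  refine integral_mono (hi1 x y) (hi2 x y) fun ω => ?_
  have e1 : ({ω | L < H x ω} ∩ {ω | L < H y ω}).indicator (1 : Ω → ℝ) ω =
      (if L < H x ω then 1 else 0) * (if L < H y ω then 1 else 0) := by
    by_cases hx : L < H x ω <;> by_cases hy : L < H y ω <;> simp [Set.indicator_apply, hx, hy]
  simp only
  rw [e1]
  refine (le_abs_self _).trans ?_
  rw [abs_mul, abs_mul, abs_mul, abs_pow, Nat.abs_cast]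
  calc (n : ℝ) * |overlap n x y| ^ p * (|Msd φ ψ n θ x fun k => H k ω| * |Msd φ ψ n θ y fun k => H k ω|)
      ≤ (n : ℝ) * |overlap n x y| ^ p * ((B * (if L < H x ω then 1 else 0)) *
        (B * (if L < H y ω then 1 else 0))) := by
        gcongr
        · exact hb x _
        · exact hb y _
    _ = _ := by ring
end

-- part F2
section
variable {n : ℕ}

lemma overlap_mul (hn : 0 < n) (x y : V n) :
    (n : ℝ) * overlap n x y = ∑ i, (if x i = y i then (1 : ℝ) else -1) := by
  have hn' : (n : ℝ) ≠ 0 := by positivity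
  have h1 : (hammingDist x y : ℝ) = ∑ i, (if x i = y i then (0 : ℝ) else 1) := by
    unfold hammingDist
    rw [Finset.card_filter]; push_cast
    refine Finset.sum_congr rfl fun i _ => ?_
    by_cases h : x i = y i <;> simp [h]
  have h2 : ∑ i, (if x i = y i then (1 : ℝ) else -1) =
      ∑ i : Fin n, (1 - 2 * (if x i = y i then (0 : ℝ) else 1)) := by
    refine Finset.sum_congr rfl fun i _ => ?_
    by_cases h : x i = y i <;> simp [h]; norm_num
  rw [h2, Finset.sum_sub_distrib, ← Finset.mul_sum, ← h1]
  unfold overlap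
  simp
  field_simp

lemma sum_exp_overlap (hn : 0 < n) (x : V n) (t : ℝ) :
    ∑ y : V n, Real.exp (t * (n * overlap n x y)) ≤ 2 ^ n * Real.exp (n * (t ^ 2 / 2)) := by
  have h1 : ∀ y : V n, Real.exp (t * (n * overlap n x y)) =
      ∏ i, Real.exp (t * (if x i = y i then (1 : ℝ) else -1)) := by
    intro y; rw [overlap_mul hn, Finset.mul_sum, Real.exp_sum]
  have h2 := Finset.prod_univ_sum (fun _ : Fin n => (Finset.univ : Finset Bool))
    (fun i b => Real.exp (t * (if x i = b then (1 : ℝ) else -1)))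
  rw [Fintype.piFinset_univ] at h2
  rw [Finset.sum_congr rfl fun y _ => h1 y, ← h2]
  have h3 : ∀ i : Fin n, ∑ b : Bool, Real.exp (t * (if x i = b then (1 : ℝ) else -1)) = 2 * Real.cosh t := by
    intro i
    rw [Fintype.sum_bool, Real.cosh_eq]
    cases x i <;> simp <;> ring
  rw [Finset.prod_congr rfl fun i _ => h3 i, Finset.prod_const, Finset.card_univ, Fintype.card_fin,
    mul_pow, Real.exp_nat_mul]
  gcongr
  exact Real.cosh_le_exp_half_sq t

lemma sum_exp_overlap_sq (hn : 0 < n) (x : V n) :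
    ∑ y : V n, Real.exp (n * overlap n x y ^ 2 / 4) ≤ 2 ^ n * (n + 1) := by
  have hn' : (0 : ℝ) < n := by exact_mod_cast hn
  let k : ℕ → ℝ := fun d => (n : ℝ) - 2 * d
  have h1 : ∀ y : V n, Real.exp (n * overlap n x y ^ 2 / 4) ≤
      ∑ d ∈ Finset.range (n + 1), Real.exp (-(3 * k d ^ 2 / (4 * n))) *
        Real.exp ((k d / n) * (n * overlap n x y)) := by
    intro y
    have hmem : hammingDist x y ∈ Finset.range (n + 1) := by
      have := hd_le x y
      rw [Finset.mem_range]; omega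
    refine le_trans (le_of_eq ?_) (Finset.single_le_sum (f := fun d => Real.exp (-(3 * k d ^ 2 / (4 * n))) *
        Real.exp ((k d / n) * (n * overlap n x y))) (fun d _ => by positivity) hmem)
    have hk : k (hammingDist x y) = n * overlap n x y := by
      simp only [k, overlap]; field_simp
    rw [← Real.exp_add, hk]
    congr 1
    field_simp; ring
  refine (Finset.sum_le_sum fun y _ => h1 y).trans ?_
  rw [Finset.sum_comm]
  have h2 : ∀ d ∈ Finset.range (n + 1), ∑ y : V n, Real.exp (-(3 * k d ^ 2 / (4 * n))) *
        Real.exp ((k d / n) * (n * overlap n x y)) ≤ 2 ^ n := by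
    intro d _
    rw [← Finset.mul_sum]
    calc _ ≤ Real.exp (-(3 * k d ^ 2 / (4 * n))) * (2 ^ n * Real.exp (n * ((k d / n) ^ 2 / 2))) := by
          gcongr; exact sum_exp_overlap hn x _
      _ = 2 ^ n * Real.exp (-(k d ^ 2 / (4 * n))) := by
          rw [mul_left_comm, ← Real.exp_add]; congr 2; field_simp; ring
      _ ≤ 2 ^ n * 1 := by
          gcongr
          rw [Real.exp_le_one_iff, neg_nonpos]; positivity
      _ = _ := mul_one _
  refine (Finset.sum_le_sum h2).trans ?_
  rw [Finset.sum_const, Finset.card_range, nsmul_eq_mul]; push_cast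
  rw [mul_comm]

variable {Ω : Type*} [MeasurableSpace Ω] {Pe : Measure Ω} {H : V n → Ω → ℝ} {p : ℕ}

lemma P2_far (hp : 2 ≤ p) (hn : 0 < n) (hG : GV Pe H (fun x y => (n : ℝ) * overlap n x y ^ p)) {L : ℝ}
    (hL : 0 < L) (hL2 : L ^ 2 / n ≤ n / 8) (x y : V n) :
    P2 Pe H L x y ≤ Real.exp (-(L ^ 2 / n)) * Real.exp (n * overlap n x y ^ 2 / 8) := by
  have := hG.prob
  have hn' : (0 : ℝ) < n := by exact_mod_cast hn
  set R := overlap n x y with hR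
  have hR1 : |R| ≤ 1 := abs_overlap_le x y
  have hr2 : |R ^ p| ≤ R ^ 2 := by
    rw [abs_pow, ← sq_abs R]; exact pow_le_pow_of_le_one (abs_nonneg _) hR1 hp
  have hr1 : |R ^ p| ≤ 1 := overlap_pow_le p x y
  have hmain : P2 Pe H L x y ≤ Real.exp (-(L ^ 2 / n) * (1 - |R ^ p|)) := by
    by_cases h1 : R ^ p ≤ -1
    · have : |R ^ p| = 1 := le_antisymm hr1 (by rw [abs_of_nonpos (by linarith)]; linarith)
      rw [this]; simp
      exact measureReal_le_one
    · have h1' : 0 < 1 + R ^ p := by linarith [not_le.1 h1]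
      have hS : (n : ℝ) * overlap n x x ^ p + n * overlap n x y ^ p + n * overlap n y x ^ p +
          n * overlap n y y ^ p = 2 * n * (1 + R ^ p) := by
        rw [overlap_self, overlap_self, overlap_comm y x, ← hR, one_pow]; ring
      have h2 := hG.pair_tail x y (by rw [hS]; positivity) L
      rw [hS] at h2
      refine h2.trans ((Qf_le_exp _ (by positivity)).trans ?_)
      rw [Real.exp_le_exp, div_pow, Real.sq_sqrt (by positivity)]
      have h3 : 1 - |R ^ p| ≤ 1 / (1 + R ^ p) := by
        rw [le_div_iff₀ h1']
        rcases abs_cases (R ^ p) with h | h <;> nlinarith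
      have h4 : -((2 * L) ^ 2 / (2 * n * (1 + R ^ p))) / 2 = -(L ^ 2 / n) * (1 / (1 + R ^ p)) := by
        field_simp
      have h6 : 0 ≤ L ^ 2 / n := by positivity
      rw [h4]
      nlinarith
  refine hmain.trans ?_
  rw [← Real.exp_add, Real.exp_le_exp]
  have h6 : 0 ≤ L ^ 2 / n := by positivity
  have h7 : L ^ 2 / n * |R ^ p| ≤ n / 8 * R ^ 2 := by gcongr
  linarith

lemma P2_near (hn : 2 ≤ n) (hG : GV Pe H (fun x y => (n : ℝ) * overlap n x y ^ p)) {L : ℝ}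
    (hL : 1 ≤ L) (x y : V n) (hr : n * |overlap n x y ^ p| ≤ 1) :
    P2 Pe H L x y ≤ Qf (L / √n) * Qf ((L - 1) / √n) + Qf √n := by
  have := hG.prob
  have hn' : (2 : ℝ) ≤ n := by exact_mod_cast hn
  set r := overlap n x y ^ p with hrdef
  have hr1 : |r| < 1 := by nlinarith [abs_nonneg r]
  have hr2 : 0 < 1 - r ^ 2 := by rw [← sq_abs]; nlinarith [abs_nonneg r]
  have hxx : (n : ℝ) * overlap n x x ^ p = n := by rw [overlap_self]; simp
  have hyy : (n : ℝ) * overlap n y y ^ p = n := by rw [overlap_self]; simp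
  have hyx : overlap n y x ^ p = r := by rw [overlap_comm]
  have h2 := hG.comb (K := Unit ⊕ Unit) (Sum.elim (fun _ => x) (fun _ => y)) (fun _ => x)
    (fun _ => 1) (Sum.elim (fun _ => 0) (fun _ => -r))
  have hind := h2.indep (K₁ := Unit) (K₂ := Unit) (by
    rintro ⟨⟩ ⟨⟩
    simp [overlap_self, ← hrdef]
    ring)
  set Z : Ω → ℝ := fun ω => 1 * H y ω + -r * H x ω with hZ
  have hZt := h2.tail (Sum.inr ()) (by
    simp only [Sum.elim_inr, hxx, hyy, hyx, ← hrdef]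
    have : (0 : ℝ) < n * (1 - r ^ 2) := by positivity
    linarith) (L - 1)
  have hvar : (1 : ℝ) * 1 * (n * overlap n y y ^ p) + 1 * -r * (n * overlap n y x ^ p) +
      -r * 1 * (n * overlap n x y ^ p) + -r * -r * (n * overlap n x x ^ p) = n * (1 - r ^ 2) := by
    rw [hxx, hyy, hyx, ← hrdef]; ring
  simp only [Sum.elim_inr] at hZt
  rw [hvar] at hZt
  have hZ2 : Pe.real {ω | L - 1 < Z ω} ≤ Qf ((L - 1) / √n) := by
    rw [hZ, hZt]
    apply Qf_anti
    apply div_le_div_of_nonneg_left (by linarith) (by positivity)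
    apply Real.sqrt_le_sqrt
    nlinarith [sq_nonneg r]
  have hX : ∀ l, Pe.real {ω | l < H x ω} = Qf (l / √n) := by
    intro l
    rw [hG.tail x (by rw [hxx]; linarith), hxx]
  have hi2 : IndepFun (H x) Z Pe := by
    have := hind.comp (measurable_pi_apply ()) (measurable_pi_apply ())
    convert this using 1
    · ext ω; simp
    · ext ω; simp [hZ]
  have hsub : {ω | L < H x ω} ∩ {ω | L < H y ω} ⊆
      (H x ⁻¹' Set.Ioi L ∩ Z ⁻¹' Set.Ioi (L - 1)) ∪ {ω | (n : ℝ) < H x ω} := by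
    rintro ω ⟨h1, h3⟩
    simp only [Set.mem_ofPred_eq] at h1 h3
    by_cases h4 : (n : ℝ) < H x ω
    · right; exact h4
    · left
      refine ⟨h1, ?_⟩
      simp only [hZ, Set.mem_preimage, Set.mem_Ioi]
      have h5 : r * H x ω ≤ 1 := by
        calc r * H x ω ≤ |r| * H x ω := by
              apply mul_le_mul_of_nonneg_right (le_abs_self r); linarith
          _ ≤ |r| * n := mul_le_mul_of_nonneg_left (not_lt.1 h4) (abs_nonneg r)
          _ ≤ 1 := by linarith
      linarith
  refine (measureReal_mono hsub (measure_ne_top _ _)).trans ((measureReal_union_le _ _).trans ?_)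
  have h6 : Pe.real (H x ⁻¹' Set.Ioi L ∩ Z ⁻¹' Set.Ioi (L - 1)) =
      Pe.real {ω | L < H x ω} * Pe.real {ω | L - 1 < Z ω} := by
    have := hi2.measure_inter_preimage_eq_mul _ _ (measurableSet_Ioi (a := L)) (measurableSet_Ioi (a := L - 1))
    rw [measureReal_def, this, ENNReal.toReal_mul]; rfl
  rw [h6, hX, hX, Real.div_sqrt]
  gcongr
  exact Qf_nonneg _
end

-- part F3
section
variable {n : ℕ} {Ω : Type*} [MeasurableSpace Ω] {Pe : Measure Ω} {H : V n → Ω → ℝ} {p : ℕ}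

lemma P2_sum (hp : 2 ≤ p) (hn : 2 ≤ n) (hG : GV Pe H (fun x y => (n : ℝ) * overlap n x y ^ p)) {L : ℝ}
    (hL : 1 ≤ L) (hL2 : L ^ 2 / n ≤ n / 8) {ρ Q A : ℝ} (hρ : 0 < ρ) (hρp : n * ρ ^ p ≤ 1)
    (hA : 0 ≤ A) (h1 : Qf (L / √n) ≤ Q) (h2 : Qf ((L - 1) / √n) ≤ Q) (h3 : Qf √n ≤ Q ^ 2)
    (h4 : Real.exp (-(L ^ 2 / n)) ≤ A * Q ^ 2) :
    ∑ x, ∑ y, n * (|overlap n x y| ^ p * P2 Pe H L x y) ≤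
      (2 ^ n) ^ 2 * (n * (Q ^ 2 * (2 * ρ ^ p + A * ((n + 1) * Real.exp (-(n * ρ ^ 2 / 8)))))) := by
  have hn0 : 0 < n := by omega
  have hn' : (0 : ℝ) < n := by exact_mod_cast hn0
  have hQ : 0 ≤ Q := (Qf_nonneg _).trans h1
  have hpair : ∀ x y : V n, |overlap n x y| ^ p * P2 Pe H L x y ≤ 2 * ρ ^ p * Q ^ 2 +
      A * Q ^ 2 * Real.exp (-(n * ρ ^ 2 / 8)) * Real.exp (n * overlap n x y ^ 2 / 4) := by
    intro x y
    have hP0 : 0 ≤ P2 Pe H L x y := measureReal_nonneg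
    rcases le_or_gt |overlap n x y| ρ with h | h
    · have hr : |overlap n x y| ^ p ≤ ρ ^ p := pow_le_pow_left₀ (abs_nonneg _) h p
      have hP := P2_near hn hG hL x y (by
        rw [abs_pow]; exact (mul_le_mul_of_nonneg_left hr hn'.le).trans hρp)
      have hP2 : P2 Pe H L x y ≤ 2 * Q ^ 2 := by
        have := mul_le_mul h1 h2 (Qf_nonneg _) hQ
        linarith
      have e0 : 0 ≤ A * Q ^ 2 * Real.exp (-(n * ρ ^ 2 / 8)) * Real.exp (n * overlap n x y ^ 2 / 4) := by
        positivity
      have := mul_le_mul hr hP2 hP0 (by positivity)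
      linarith
    · have hP := P2_far hp hn0 hG (by linarith) hL2 x y
      have hr : |overlap n x y| ^ p ≤ 1 := pow_le_one₀ (abs_nonneg _) (abs_overlap_le x y)
      have hsq : ρ ^ 2 ≤ overlap n x y ^ 2 := by
        rw [← sq_abs (overlap n x y)]; exact pow_le_pow_left₀ hρ.le h.le 2
      have e0 : 0 ≤ 2 * ρ ^ p * Q ^ 2 := by positivity
      calc |overlap n x y| ^ p * P2 Pe H L x y ≤ 1 * P2 Pe H L x y := by gcongr
        _ ≤ (A * Q ^ 2) * Real.exp (n * overlap n x y ^ 2 / 8) := by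
            rw [one_mul]; exact hP.trans (by gcongr)
        _ ≤ (A * Q ^ 2) * (Real.exp (-(n * ρ ^ 2 / 8)) * Real.exp (n * overlap n x y ^ 2 / 4)) := by
            rw [← Real.exp_add]
            gcongr
            have := mul_le_mul_of_nonneg_left hsq hn'.le
            linarith
        _ ≤ _ := by rw [← mul_assoc]; linarith
  have hrow : ∀ x : V n, ∑ y, n * (|overlap n x y| ^ p * P2 Pe H L x y) ≤
      2 ^ n * (n * (Q ^ 2 * (2 * ρ ^ p + A * ((n + 1) * Real.exp (-(n * ρ ^ 2 / 8)))))) := by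
    intro x
    rw [← Finset.mul_sum]
    calc _ ≤ (n : ℝ) * ∑ y : V n, (2 * ρ ^ p * Q ^ 2 +
            A * Q ^ 2 * Real.exp (-(n * ρ ^ 2 / 8)) * Real.exp (n * overlap n x y ^ 2 / 4)) := by
          gcongr; exact hpair x _
      _ = (n : ℝ) * (2 ^ n * (2 * ρ ^ p * Q ^ 2) +
            A * Q ^ 2 * Real.exp (-(n * ρ ^ 2 / 8)) * ∑ y : V n, Real.exp (n * overlap n x y ^ 2 / 4)) := by
          rw [Finset.sum_add_distrib, Finset.sum_const, Finset.card_univ,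
            Finset.mul_sum _ _ (A * Q ^ 2 * Real.exp (-(n * ρ ^ 2 / 8)))]
          simp
      _ ≤ (n : ℝ) * (2 ^ n * (2 * ρ ^ p * Q ^ 2) +
            A * Q ^ 2 * Real.exp (-(n * ρ ^ 2 / 8)) * (2 ^ n * (n + 1))) := by
          gcongr; exact sum_exp_overlap_sq hn0 x
      _ = _ := by ring
  refine (Finset.sum_le_sum fun x _ => hrow x).trans (le_of_eq ?_)
  rw [Finset.sum_const, Finset.card_univ]
  simp
  ring
end

lemma q0_anti (c : ℝ) {v w : ℝ} (h : v ≤ w) {n : ℕ} (hn : 0 < n) : q0 c w n ≤ q0 c v n := by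
  have := γ_pos c hn
  apply Qf_anti
  unfold Lf
  gcongr

lemma P2_sum_eventually {p : ℕ} {c : ℝ} (hp : 5 ≤ p) (hc0 : 0 < c) (hc : c < 1 / 2) (v : ℝ) {δ : ℝ}
    (hδ : 0 < δ) (hδ1 : δ ≤ 1 / 4) {Ω : Type*} [MeasurableSpace Ω] {Pe : Measure Ω}
    {H : (n : ℕ) → V n → Ω → ℝ} (hG : ∀ n, GV Pe (H n) (fun x y => (n : ℝ) * overlap n x y ^ p)) :
    ∀ᶠ n : ℕ in atTop, ∑ x, ∑ y, n * (|overlap n x y| ^ p * P2 Pe (H n) (Lf c v n) x y) ≤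
      (2 ^ n) ^ 2 * (3 * (q0 c (v - 1) n ^ 2 * (n : ℝ) ^ (1 - (p : ℝ) / 2 + p * δ))) := by
  have hpr : (5 : ℝ) ≤ p := by exact_mod_cast hp
  -- Qf √n ≤ q^2
  have hb1 : ∀ᶠ n : ℕ in atTop, Qf √n ≤ q0 c (v - 1) n ^ 2 := by
    have h1 := poly_exp (a := 1) (K := 1 / 4) 2 (by norm_num) (by norm_num)
    filter_upwards [eventually_gt_atTop 0, Lf_bounds hc (v - 1) (show (0 : ℝ) < 1 by norm_num),
      Lf_bounds hc (v - 1) (show (0 : ℝ) < 1 / 2 by norm_num),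
      exp_le_q0 hc hc0 (v - 1), h1.eventually (ge_mem_nhds (show (0 : ℝ) < 1 / 36 by norm_num)),
      (γ_tendsto hc0).eventually (ge_mem_nhds (show (0 : ℝ) < 1 / 4 by norm_num))]
      with n hn hL hL0 he h1 hγ
    have hn' : (0 : ℝ) < n := by exact_mod_cast hn
    have hγ0 := γ_pos c hn
    refine (Qf_le_exp _ (by positivity)).trans ?_
    rw [Real.sq_sqrt hn'.le]
    rw [Real.rpow_one, Real.rpow_two] at h1
    have hLn0 : 0 ≤ Lf c (v - 1) n := le_trans (by positivity) hL0.1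
    have hLn : Lf c (v - 1) n ≤ n / 2 := hL.2.trans (by nlinarith)
    have hLL : Lf c (v - 1) n ^ 2 / n ≤ n / 4 := by
      rw [div_le_iff₀ hn']; nlinarith
    have h5 : Real.exp (-(Lf c (v - 1) n ^ 2 / n)) ≤ 36 * (n ^ 2 * q0 c (v - 1) n ^ 2) := by
      have := pow_le_pow_left₀ (Real.exp_pos _).le he 2
      rw [← Real.exp_nat_mul] at this
      refine le_trans (le_of_eq ?_) (this.trans (le_of_eq (by ring)))
      congr 1; push_cast; field_simp
    have h6 : Real.exp (-(n / 4 : ℝ)) ≤ Real.exp (-(Lf c (v - 1) n ^ 2 / n)) :=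
      Real.exp_le_exp.2 (by linarith)
    have h7 : Real.exp (-(n : ℝ) / 2) = Real.exp (-(1 / 4 * (n : ℝ))) * Real.exp (-(n / 4 : ℝ)) := by
      rw [← Real.exp_add]; congr 1; ring
    rw [h7]
    calc _ ≤ Real.exp (-(1 / 4 * (n : ℝ))) * (36 * (n ^ 2 * q0 c (v - 1) n ^ 2)) := by
          gcongr; exact h6.trans h5
      _ = 36 * (n ^ 2 * Real.exp (-(1 / 4 * (n : ℝ)))) * q0 c (v - 1) n ^ 2 := by ring
      _ ≤ 1 * q0 c (v - 1) n ^ 2 := by gcongr; linarith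
      _ = _ := one_mul _
  have hb2 := poly_exp (a := 2 * δ) (K := 1 / 8) ((p : ℝ) / 2 - p * δ + 3) (by linarith) (by norm_num)
  filter_upwards [eventually_ge_atTop 2, hb1, Lf_bounds hc v (show (0 : ℝ) < 1 by norm_num),
    Lf_bounds hc v (show (0 : ℝ) < 1 / 2 by norm_num), exp_le_q0 hc hc0 v,
    hb2.eventually (ge_mem_nhds (show (0 : ℝ) < 1 / 72 by norm_num)),
    (γ_tendsto hc0).eventually (ge_mem_nhds (show (0 : ℝ) < 1 / 8 by norm_num)),
    (γ_sq_mul_tendsto hc).eventually_ge_atTop 2] with n hn hb1 hL hL0 he hb2 hγ hγ2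
  have hn0 : 0 < n := by omega
  have hn' : (0 : ℝ) < n := by exact_mod_cast hn0
  have hn1 : (1 : ℝ) ≤ n := by exact_mod_cast hn0
  have hγ0 := γ_pos c hn0
  have hLn : Lf c v n ≤ n / 4 := hL.2.trans (by nlinarith)
  have hγn : 2 ≤ γseq c n * n := by nlinarith
  have hL1 : 1 ≤ Lf c v n := by linarith [hL0.1]
  have hLL : Lf c v n ^ 2 / n ≤ n / 8 := by
    rw [div_le_iff₀ hn']; nlinarith
  set Q := q0 c (v - 1) n with hQ
  have hQ0 : 0 < Q := q0_pos _ _ _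
  have hqQ : q0 c v n ≤ Q := q0_anti c (by linarith) hn0
  have hE : Real.exp (-(Lf c v n ^ 2 / n)) ≤ (36 * n ^ 2) * Q ^ 2 := by
    have := pow_le_pow_left₀ (Real.exp_pos _).le (he.trans (mul_le_mul_of_nonneg_left hqQ (by positivity))) 2
    rw [← Real.exp_nat_mul] at this
    refine le_trans (le_of_eq ?_) (this.trans (le_of_eq (by ring)))
    congr 1; push_cast; field_simp
  set ρ : ℝ := (n : ℝ) ^ (-(1 / 2) + δ) with hρ
  have hρ0 : 0 < ρ := by positivity
  have hρp : ρ ^ p = (n : ℝ) ^ (-(p : ℝ) / 2 + p * δ) := by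
    rw [hρ, ← Real.rpow_natCast, ← Real.rpow_mul hn'.le]; congr 1; ring
  have hρ2 : n * ρ ^ 2 = (n : ℝ) ^ (2 * δ) := by
    rw [hρ, ← Real.rpow_natCast, ← Real.rpow_mul hn'.le]
    nth_rewrite 1 [← Real.rpow_one (n : ℝ)]
    rw [← Real.rpow_add hn']; congr 1; push_cast; ring
  have hnρ : n * ρ ^ p = (n : ℝ) ^ (1 - (p : ℝ) / 2 + p * δ) := by
    rw [hρp]
    nth_rewrite 1 [← Real.rpow_one (n : ℝ)]
    rw [← Real.rpow_add hn']; congr 1; ring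
  have hnρ1 : n * ρ ^ p ≤ 1 := by
    rw [hnρ]
    refine Real.rpow_le_one_of_one_le_of_nonpos hn1 ?_
    nlinarith
  have hs := P2_sum (by omega) hn (hG n) hL1 hLL hρ0 hnρ1 (A := 36 * n ^ 2) (by positivity)
    hqQ (Q := Q) (by
      rw [hQ]; apply Qf_anti
      have : 1 ≤ 1 / γseq c n := by rw [le_div_iff₀ hγ0]; linarith
      have h : Lf c (v - 1) n = Lf c v n - 1 / γseq c n := by unfold Lf; ring
      rw [h]; gcongr) hb1 hE
  refine hs.trans ?_
  have hfin : 36 * (n : ℝ) ^ 2 * ((n + 1) * Real.exp (-(n * ρ ^ 2 / 8))) ≤ ρ ^ p := by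
    rw [hρ2, hρp]
    have e1 : (n : ℝ) ^ ((p : ℝ) / 2 - p * δ + 3) = ((n : ℝ) ^ (-(p : ℝ) / 2 + p * δ))⁻¹ * n ^ 3 := by
      rw [← Real.rpow_neg hn'.le, ← Real.rpow_natCast, ← Real.rpow_add hn']; congr 1; push_cast; ring
    rw [e1] at hb2
    set W := (n : ℝ) ^ (-(p : ℝ) / 2 + p * δ) with hW
    have hW0 : 0 < W := by positivity
    have e2 : Real.exp (-(1 / 8 * (n : ℝ) ^ (2 * δ))) = Real.exp (-((n : ℝ) ^ (2 * δ) / 8)) := by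
      congr 1; ring
    rw [e2] at hb2
    set E := Real.exp (-((n : ℝ) ^ (2 * δ) / 8)) with hEdef
    have hE0 : 0 < E := Real.exp_pos _
    have e3 : n ^ 3 * E ≤ W / 72 := by
      have := mul_le_mul_of_nonneg_left hb2 hW0.le
      rw [← mul_assoc, ← mul_assoc, mul_inv_cancel₀ hW0.ne', one_mul] at this
      linarith
    calc 36 * (n : ℝ) ^ 2 * ((n + 1) * E) ≤ 36 * (n : ℝ) ^ 2 * ((n + n) * E) := by gcongr
      _ = 72 * (n ^ 3 * E) := by ring
      _ ≤ W := by linarith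
  rw [← hnρ]
  have : 2 * ρ ^ p + 36 * (n : ℝ) ^ 2 * ((n + 1) * Real.exp (-(n * ρ ^ 2 / 8))) ≤ 3 * ρ ^ p := by linarith
  calc _ ≤ (2 ^ n) ^ 2 * (n * (Q ^ 2 * (3 * ρ ^ p))) := by gcongr
    _ = _ := by ring

-- part F4
/-- Borel–Cantelli via summable variances. -/
lemma ae_tendsto_of_var {Ω : Type*} [MeasurableSpace Ω] {P : Measure Ω} [IsProbabilityMeasure P]
    (X : ℕ → Ω → ℝ) (s : ℕ → ℝ) (hs : Summable s)
    (hX : ∀ᶠ n in atTop, MemLp (X n) 2 P ∧ Var[X n; P] ≤ s n) :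
    ∀ᵐ ω ∂P, Tendsto (fun n => X n ω - ∫ ω, X n ω ∂P) atTop (nhds 0) := by
  obtain ⟨N, hN⟩ := eventually_atTop.1 hX
  have hm : ∀ n, MemLp (X (n + N)) 2 P := fun n => (hN _ (by omega)).1
  have hv : ∀ n, Var[X (n + N); P] ≤ s (n + N) := fun n => (hN _ (by omega)).2
  have hs' : Summable (fun n => s (n + N)) := (summable_nat_add_iff N).2 hs
  have hae : ∀ n, AEMeasurable (fun ω => ENNReal.ofReal ((X (n + N) ω - ∫ ω, X (n + N) ω ∂P) ^ 2)) P := by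
    intro n
    have := (hm n).1.aemeasurable
    fun_prop
  have hl : ∀ n, ∫⁻ ω, ENNReal.ofReal ((X (n + N) ω - ∫ ω, X (n + N) ω ∂P) ^ 2) ∂P ≤
      ENNReal.ofReal (s (n + N)) := by
    intro n
    rw [← ofReal_integral_eq_lintegral_ofReal]
    · apply ENNReal.ofReal_le_ofReal
      rw [← variance_eq_integral (hm n).1.aemeasurable]
      exact hv n
    · exact ((hm n).sub (memLp_const _)).integrable_sq
    · exact Eventually.of_forall fun ω => sq_nonneg _
  have hfin : ∫⁻ ω, ∑' n, ENNReal.ofReal ((X (n + N) ω - ∫ ω, X (n + N) ω ∂P) ^ 2) ∂P ≠ ⊤ := by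
    rw [lintegral_tsum hae]
    refine ne_top_of_le_ne_top ?_ (ENNReal.tsum_le_tsum hl)
    exact hs'.tsum_ofReal_ne_top
  have h1 := ae_lt_top' (AEMeasurable.tsum hae) hfin
  filter_upwards [h1] with ω hω
  have h2 := ENNReal.tendsto_atTop_zero_of_tsum_ne_top hω.ne
  have h3 : Tendsto (fun n => (X (n + N) ω - ∫ ω, X (n + N) ω ∂P) ^ 2) atTop (nhds 0) := by
    have := (ENNReal.tendsto_toReal (ENNReal.zero_ne_top)).comp h2
    refine (this.congr fun n => ?_)
    simp only [Function.comp]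
    rw [ENNReal.toReal_ofReal (sq_nonneg _)]
  have h4 : Tendsto (fun n => |X (n + N) ω - ∫ ω, X (n + N) ω ∂P|) atTop (nhds 0) := by
    have := (Real.continuous_sqrt.tendsto 0).comp h3
    rw [Real.sqrt_zero] at this
    refine this.congr fun n => ?_
    simp only [Function.comp]
    rw [Real.sqrt_sq_eq_abs]
  have h5 := (tendsto_zero_iff_abs_tendsto_zero _).2 h4
  exact (tendsto_add_atTop_iff_nat (f := fun n => X n ω - ∫ ω, X n ω ∂P) N).1 h5

section
variable {p : ℕ} {c : ℝ} {Ω : Type*} [MeasurableSpace Ω] {Pe : Measure Ω}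
    {H : (n : ℕ) → V n → Ω → ℝ} {Ω' : Type*} [MeasurableSpace Ω'] {Pw : Measure Ω'}
    {J : (n : ℕ) → ℕ → Ω' → V n}

lemma var_arith {a g K η θ q W S V T : ℝ} (hg : 0 < g) (hη : 0 < η) (hθ : 0 < θ) (hT : 0 < T)
    (hV : V ≤ π ^ 2 / 8 * ((K * g / η * (θ * T⁻¹)) ^ 2 * S))
    (hS : S ≤ T ^ 2 * (3 * (q ^ 2 * W))) (hW : 0 ≤ W) {B : ℝ} (h0 : 0 ≤ a * g ^ 2 * q)
    (hB : a * g ^ 2 * q ≤ B) :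
    (a / θ) ^ 2 * V ≤ (π ^ 2 / 8 * (K / η) ^ 2 * 3 * B ^ 2) * ((g ^ 2)⁻¹ * W) := by
  have h2 : (a * g ^ 2 * q) ^ 2 ≤ B ^ 2 := pow_le_pow_left₀ h0 hB 2
  calc (a / θ) ^ 2 * V ≤ (a / θ) ^ 2 * (π ^ 2 / 8 * ((K * g / η * (θ * T⁻¹)) ^ 2 *
        (T ^ 2 * (3 * (q ^ 2 * W))))) := by
        gcongr
        exact hV.trans (by gcongr)
    _ = (π ^ 2 / 8 * (K / η) ^ 2 * 3 * (a * g ^ 2 * q) ^ 2) * ((g ^ 2)⁻¹ * W) := by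
        field_simp
    _ ≤ _ := by gcongr

lemma as_step (hp : 5 ≤ p) (hc0 : 0 < c) (hc : c < 1 / 2) (hpc : 2 + 2 * c < (p : ℝ) / 2) (v : ℝ) {η : ℝ}
    (hη : 0 < η) (hG : ∀ n, GV Pe (H n) (fun x y => (n : ℝ) * overlap n x y ^ p))
    (hW : ∀ n, 0 < n → WK Pw n (J n)) :
    ∀ᵐ ω ∂Pe, ∀ ε > 0, ∀ᶠ n : ℕ in atTop,
      aseq c n / θseq n * Mx Pw (J n) (θseq n) (Lf c (v + η) n) (fun x => H n x ω) ≤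
        2 * p * Real.exp (-v) + ε ∧
      2 * p * Real.exp (-(v + η)) - ε ≤
        aseq c n / θseq n * Mx Pw (J n) (θseq n) (Lf c v n) (fun x => H n x ω) := by
  have hprob := (hG 0).prob
  have hpr : (5 : ℝ) ≤ p := by exact_mod_cast hp
  obtain ⟨T, T', K, hd, hT'c, hK, hT0, hT1, -, hTz, hTo, hT'z⟩ := exists_step
  have hT'0 : ∀ x ≤ 0, T' x = 0 := by
    intro x hx
    have : Set.Iic (0 : ℝ) ⊆ {x | T' x = 0} := by
      rw [← closure_Iio]
      exact closure_minimal (fun y hy => hT'z y hy) (isClosed_eq hT'c continuous_const)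
    exact this hx
  let φ : ℕ → ℝ → ℝ := fun n x => 1 - T ((x - Lf c v n) * (γseq c n / η))
  let ψ : ℕ → ℝ → ℝ := fun n x => T' ((x - Lf c v n) * (γseq c n / η)) * (γseq c n / η)
  have hφ : ∀ n x, HasDerivAt (φ n) (-(ψ n x)) x := by
    intro n x
    have h1 : HasDerivAt (fun x => (x - Lf c v n) * (γseq c n / η)) (1 * (γseq c n / η)) x :=
      ((hasDerivAt_id x).sub_const _).mul_const _
    have h2 := ((hd _).comp x h1).const_sub 1
    rw [one_mul] at h2
    exact h2
  have hφc : ∀ n, Continuous (φ n) := fun n =>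
    continuous_iff_continuousAt.2 fun x => (hφ n x).continuousAt
  have hψc : ∀ n, Continuous (ψ n) := by intro n; simp only [ψ]; fun_prop
  have h0 : ∀ n x, 0 ≤ φ n x := fun n x => by simp only [φ]; linarith [hT1 ((x - Lf c v n) * (γseq c n / η))]
  have h1 : ∀ n x, φ n x ≤ 1 := fun n x => by simp only [φ]; linarith [hT0 ((x - Lf c v n) * (γseq c n / η))]
  have hψK : ∀ n, 0 < n → ∀ x, |ψ n x| ≤ K * γseq c n / η := by
    intro n hn x
    have := γ_pos c hn
    simp only [ψ]
    rw [abs_mul, abs_of_pos (a := γseq c n / η) (by positivity), mul_div_assoc]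
    gcongr; exact hK _
  have hlow : ∀ n, 0 < n → ∀ x ≤ Lf c v n, (x - Lf c v n) * (γseq c n / η) ≤ 0 := by
    intro n hn x hx
    have := γ_pos c hn
    exact mul_nonpos_of_nonpos_of_nonneg (by linarith) (by positivity)
  have hψ0 : ∀ n, 0 < n → ∀ x ≤ Lf c v n, ψ n x = 0 := by
    intro n hn x hx
    simp only [ψ]; rw [hT'0 _ (hlow n hn x hx), zero_mul]
  have hφ1 : ∀ n, 0 < n → ∀ x ≤ Lf c v n, φ n x = 1 := by
    intro n hn x hx
    simp only [φ]; rw [hTz _ (hlow n hn x hx), sub_zero]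
  have hφ0 : ∀ n, 0 < n → ∀ x, Lf c (v + η) n < x → φ n x = 0 := by
    intro n hn x hx
    have hg := γ_pos c hn
    simp only [φ]; rw [hTo, sub_self]
    have : Lf c (v + η) n = Lf c v n + η / γseq c n := by unfold Lf; ring
    rw [this] at hx
    calc (1 : ℝ) = (η / γseq c n) * (γseq c n / η) := by field_simp
      _ ≤ _ := by gcongr; linarith
  have hMm : ∀ n, Measurable (fun ω => Ms (φ n) n (θseq n) (fun x => H n x ω)) := by
    intro n
    have hh := (hG n).meas
    have hc2 : Continuous (Ms (φ n) n (θseq n)) := by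
      have := hφc n
      unfold Ms; fun_prop
    exact hc2.measurable.comp (measurable_pi_lambda _ hh)
  have hMi : ∀ n, 0 < n → MemLp (fun ω => Ms (φ n) n (θseq n) (fun x => H n x ω)) 2 Pe := fun n hn =>
    MemLp.of_bound (hMm n).aestronglyMeasurable 1 (Eventually.of_forall fun ω => Ms_abs hn (h0 n) (h1 n) _)
  set δ : ℝ := ((p : ℝ) / 2 - 2 - 2 * c) / (2 * p) with hδ
  have hδ0 : 0 < δ := by rw [hδ]; apply div_pos <;> linarith
  have hδ1 : δ ≤ 1 / 4 := by rw [hδ, div_le_iff₀ (by linarith)]; linarith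
  have hpδ : p * δ = ((p : ℝ) / 2 - 2 - 2 * c) / 2 := by rw [hδ]; field_simp
  set s : ℝ := -(1 + 2 * c - (p : ℝ) / 2 + p * δ) with hs
  have hs1 : 1 < s := by rw [hs, hpδ]; linarith
  set B : ℝ := Real.exp (-(v - 1)) + 1 with hB
  set C : ℝ := π ^ 2 / 8 * (K / η) ^ 2 * 3 * B ^ 2 with hC
  have hsum : Summable (fun n : ℕ => C * ((n : ℝ) ^ s)⁻¹) :=
    (Real.summable_nat_rpow_inv.2 hs1).mul_left C
  have hA := ae_tendsto_of_var (P := Pe) (fun n ω => aseq c n / θseq n *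
    Ms (φ n) n (θseq n) (fun x => H n x ω)) _ hsum (by
    filter_upwards [eventually_gt_atTop 0, P2_sum_eventually hp hc0 hc v hδ0 hδ1 hG,
      (q0_asymp hc (v - 1)).eventually (ge_mem_nhds (show Real.exp (-(v - 1)) < B by rw [hB]; linarith))]
      with n hn hS hq
    refine ⟨(hMi n hn).const_mul _, ?_⟩
    rw [variance_const_mul]
    have hn' : (0 : ℝ) < n := by exact_mod_cast hn
    have hg := γ_pos c hn
    have hθ : (0 : ℝ) < θseq n := by unfold θseq; push_cast; positivity
    have hV := Ms_var (hG n) (hW n hn) (hφ n) (hψc n) (h0 n) (h1 n) (hψK n hn) (hψ0 n hn) (θ := θseq n)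
    have := var_arith hg hη hθ (by positivity) hV hS (by positivity) (B := B)
      (mul_nonneg (mul_nonneg (by unfold aseq; positivity) (by positivity)) (q0_pos _ _ _).le) hq
    refine this.trans (le_of_eq ?_)
    congr 1
    rw [← Real.rpow_neg hn'.le, ← Real.rpow_natCast (γseq c n), γ_pow, ← Real.rpow_neg hn'.le,
      ← Real.rpow_add hn', hs]
    congr 1; push_cast; ring)
  have hE1 := mean_tendsto (by omega) hc0 hc v hG hW
  have hE2 := mean_tendsto (by omega) hc0 hc (v + η) hG hW
  filter_upwards [hA] with ω hω ε hε
  have ha0 : ∀ n, 0 ≤ aseq c n / θseq n := by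
    intro n; unfold aseq γseq; positivity
  filter_upwards [eventually_gt_atTop 0, hω.eventually (ge_mem_nhds (show (0 : ℝ) < ε / 2 by linarith)),
    hω.eventually (le_mem_nhds (show -(ε / 2) < (0 : ℝ) by linarith)),
    hE1.eventually (ge_mem_nhds (show 2 * p * Real.exp (-v) < 2 * p * Real.exp (-v) + ε / 2 by linarith)),
    hE2.eventually (le_mem_nhds (show 2 * p * Real.exp (-(v + η)) - ε / 2 <
      2 * p * Real.exp (-(v + η)) by linarith))] with n hn ho1 ho2 he1 he2
  have hu : ∀ ω, Ms (φ n) n (θseq n) (fun x => H n x ω) ≤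
      Mx Pw (J n) (θseq n) (Lf c v n) (fun x => H n x ω) := fun ω =>
    Ms_le_Mx (hW n hn) (h0 n) (hφ1 n hn) _
  have hl : ∀ ω, Mx Pw (J n) (θseq n) (Lf c (v + η) n) (fun x => H n x ω) ≤
      Ms (φ n) n (θseq n) (fun x => H n x ω) := fun ω =>
    Mx_le_Ms (hW n hn) (h0 n) (h1 n) (hφ0 n hn) _
  have hMxi : ∀ L, Integrable (fun ω => Mx Pw (J n) (θseq n) L (fun x => H n x ω)) Pe := by
    intro L
    simp only [Mx_eq (hW n hn)]
    refine integrable_finsetSum _ fun xs _ => Integrable.const_mul ?_ _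
    have hi : (fun ω => Set.indicator {xs : Fin (θseq n + 1) → V n |
        ∃ j : Fin (θseq n + 1), 1 ≤ (j : ℕ) ∧ L < H n (xs j) ω} (1 : (Fin (θseq n + 1) → V n) → ℝ) xs) =
        Set.indicator {ω | ∃ j : Fin (θseq n + 1), 1 ≤ (j : ℕ) ∧ L < H n (xs j) ω} (1 : Ω → ℝ) := by
      ext ω; simp [Set.indicator_apply]
    rw [hi]
    exact IntegrableOn.integrable_indicator (integrable_const (1 : ℝ)).integrableOn
      (meas_Gx (hG n).meas L xs)
  have hMsi := (hMi n hn).integrable (by norm_num)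
  have hm1 := mul_le_mul_of_nonneg_left (integral_mono hMsi (hMxi _) hu) (ha0 n)
  have hm2 := mul_le_mul_of_nonneg_left (integral_mono (hMxi _) hMsi hl) (ha0 n)
  rw [integral_const_mul] at ho1 ho2
  have hu1 := mul_le_mul_of_nonneg_left (hu ω) (ha0 n)
  have hl1 := mul_le_mul_of_nonneg_left (hl ω) (ha0 n)
  constructor <;> linarith

lemma as_Mx (hp : 5 ≤ p) (hc0 : 0 < c) (hc : c < 1 / 2) (hpc : 2 + 2 * c < (p : ℝ) / 2)
    (hG : ∀ n, GV Pe (H n) (fun x y => (n : ℝ) * overlap n x y ^ p))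
    (hW : ∀ n, 0 < n → WK Pw n (J n)) :
    ∀ᵐ ω ∂Pe, ∀ w : ℝ, Tendsto (fun n : ℕ =>
      aseq c n / θseq n * Mx Pw (J n) (θseq n) (Lf c w n) (fun x => H n x ω)) atTop
      (nhds (2 * p * Real.exp (-w))) := by
  have h : ∀ᵐ ω ∂Pe, ∀ v η : ℚ, 0 < η → ∀ ε > 0, ∀ᶠ n : ℕ in atTop,
      aseq c n / θseq n * Mx Pw (J n) (θseq n) (Lf c ((v : ℝ) + (η : ℝ)) n) (fun x => H n x ω) ≤
        2 * p * Real.exp (-(v : ℝ)) + ε ∧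
      2 * p * Real.exp (-((v : ℝ) + (η : ℝ))) - ε ≤
        aseq c n / θseq n * Mx Pw (J n) (θseq n) (Lf c v n) (fun x => H n x ω) := by
    rw [ae_all_iff]; intro v
    rw [ae_all_iff]; intro η
    by_cases hη : 0 < η
    · filter_upwards [as_step hp hc0 hc hpc (v : ℝ) (η := (η : ℝ)) (by exact_mod_cast hη) hG hW] with ω hω _
      exact hω
    · exact Eventually.of_forall fun ω h => absurd h hη
  filter_upwards [h] with ω hω w
  have hcont : ContinuousAt (fun z : ℝ => 2 * p * Real.exp (-z)) w := by fun_prop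
  have ha0 : ∀ n, 0 ≤ aseq c n / θseq n := by
    intro n; unfold aseq γseq; positivity
  have hmono : ∀ n, 0 < n → ∀ w w' : ℝ, w ≤ w' →
      aseq c n / θseq n * Mx Pw (J n) (θseq n) (Lf c w' n) (fun x => H n x ω) ≤
      aseq c n / θseq n * Mx Pw (J n) (θseq n) (Lf c w n) (fun x => H n x ω) := by
    intro n hn w w' hw
    refine mul_le_mul_of_nonneg_left ?_ (ha0 n)
    have := (hW n hn).prob
    have hg := γ_pos c hn
    unfold Mx
    refine measureReal_mono ?_ (measure_ne_top _ _)
    rintro ω' ⟨j, hj, hj2⟩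
    refine ⟨j, hj, lt_of_le_of_lt ?_ hj2⟩
    unfold Lf; gcongr
  have hrat : ∀ (v v' : ℚ), v < v' → ∀ ε > 0, ∀ᶠ n : ℕ in atTop,
      aseq c n / θseq n * Mx Pw (J n) (θseq n) (Lf c (v' : ℝ) n) (fun x => H n x ω) ≤
        2 * p * Real.exp (-(v : ℝ)) + ε ∧
      2 * p * Real.exp (-(v' : ℝ)) - ε ≤
        aseq c n / θseq n * Mx Pw (J n) (θseq n) (Lf c v n) (fun x => H n x ω) := by
    intro v v' hv ε hε
    have h1 := hω v (v' - v) (by linarith) ε hε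
    have h2 : (v : ℝ) + ((v' - v : ℚ) : ℝ) = v' := by push_cast; ring
    rw [h2] at h1
    exact h1
  rw [tendsto_order]
  constructor
  · intro b hb
    obtain ⟨b', hb1, hb2⟩ := exists_between hb
    have h1 := hcont.eventually (lt_mem_nhds hb2)
    obtain ⟨r, hr, hr2⟩ := Metric.eventually_nhds_iff.1 h1
    obtain ⟨v', hv1, hv2⟩ := exists_rat_btwn (show w < w + r by linarith)
    obtain ⟨v, hv3, hv4⟩ := exists_rat_btwn hv1
    have hb3 : b' < 2 * p * Real.exp (-(v' : ℝ)) := hr2 (by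
      rw [Real.dist_eq, abs_of_pos (by linarith)]; linarith)
    filter_upwards [hrat v v' (by exact_mod_cast hv4) (b' - b) (by linarith), eventually_gt_atTop 0] with n h hn
    have := hmono n hn w v hv3.le
    linarith [h.2]
  · intro b hb
    obtain ⟨b', hb1, hb2⟩ := exists_between hb
    have h1 := hcont.eventually (gt_mem_nhds hb1)
    obtain ⟨r, hr, hr2⟩ := Metric.eventually_nhds_iff.1 h1
    obtain ⟨v, hv1, hv2⟩ := exists_rat_btwn (show w - r < w by linarith)
    obtain ⟨v', hv3, hv4⟩ := exists_rat_btwn hv2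
    have hb3 : 2 * p * Real.exp (-(v : ℝ)) < b' := hr2 (by
      rw [Real.dist_eq, abs_of_neg (by linarith)]; linarith)
    filter_upwards [hrat v v' (by exact_mod_cast hv3) (b - b') (by linarith), eventually_gt_atTop 0] with n h hn
    have := hmono n hn v' w hv4.le
    linarith [h.1]
end

-- part G1
section
variable {Ω' : Type*} [MeasurableSpace Ω'] {Pw : Measure Ω'} [IsProbabilityMeasure Pw]
    {J : (n : ℕ) → ℕ → Ω' → V n} {e : ℕ → ℕ → Ω' → ℝ}

lemma path_exp (hJmeas : ∀ n i, Measurable (J n i)) (hemeas : ∀ n i, Measurable (e n i))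
    (hlaw : WalkExpLaw Pw J e) (n m : ℕ) (A : Set (Fin (m + 1) → V n))
    (ys : Fin (m + 1) → ℝ) (hy : ∀ k, 0 ≤ ys k) :
    Pw.real {ω' | (fun k : Fin (m + 1) => J n k ω') ∈ A ∧ ∀ k : Fin (m + 1), ys k < e n k ω'} =
      (∑ xs : Fin (m + 1) → V n, wt n m xs * A.indicator 1 xs) * Real.exp (-∑ k, ys k) := by
  classical
  have hset : {ω' | (fun k : Fin (m + 1) => J n k ω') ∈ A ∧ ∀ k : Fin (m + 1), ys k < e n k ω'} =
      ⋃ xs ∈ univ.filter (fun xs => xs ∈ A),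
        {ω' | (∀ k : Fin (m + 1), J n k ω' = xs k) ∧ ∀ k : Fin (m + 1), ys k < e n k ω'} := by
    ext ω'
    simp only [Set.mem_ofPred_eq, Set.mem_iUnion, Finset.mem_filter, Finset.mem_univ, true_and]
    constructor
    · rintro ⟨h1, h2⟩; exact ⟨_, h1, fun k => rfl, h2⟩
    · rintro ⟨xs, h1, h2, h3⟩
      have : (fun k : Fin (m + 1) => J n k ω') = xs := funext h2
      exact ⟨this ▸ h1, h3⟩
  have hm : ∀ xs : Fin (m + 1) → V n, MeasurableSet
      {ω' | (∀ k : Fin (m + 1), J n k ω' = xs k) ∧ ∀ k : Fin (m + 1), ys k < e n k ω'} := by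
    intro xs
    refine MeasurableSet.inter (s₁ := {ω' | ∀ k : Fin (m + 1), J n k ω' = xs k})
      (s₂ := {ω' | ∀ k : Fin (m + 1), ys k < e n k ω'}) ?_ ?_
    · have h : {ω' | ∀ k : Fin (m + 1), J n k ω' = xs k} = ⋂ k : Fin (m + 1), {ω' | J n k ω' = xs k} := by
        ext; simp
      rw [h]
      exact MeasurableSet.iInter fun k => hJmeas n k (MeasurableSet.singleton _)
    · have h : {ω' | ∀ k : Fin (m + 1), ys k < e n k ω'} = ⋂ k : Fin (m + 1), {ω' | ys k < e n k ω'} := by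
        ext; simp
      rw [h]
      exact MeasurableSet.iInter fun k => measurableSet_lt measurable_const (hemeas n k)
  rw [hset, measureReal_biUnion_finset _ fun xs _ => hm xs]
  · rw [Finset.sum_mul, Finset.sum_filter]
    refine Finset.sum_congr rfl fun xs _ => ?_
    by_cases hx : xs ∈ A
    · rw [if_pos hx, law_exp Pw J e hlaw n m xs ys hy, Set.indicator_of_mem hx]; simp
    · rw [if_neg hx, Set.indicator_of_notMem hx]; simp
  · intro xs _ xs' _ hne
    refine Set.disjoint_left.2 ?_
    rintro ω' ⟨h1, -⟩ ⟨h2, -⟩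
    exact hne (funext fun k => (h1 k).symm.trans (h2 k))

lemma exp_tail (hJmeas : ∀ n i, Measurable (J n i)) (hemeas : ∀ n i, Measurable (e n i))
    (hlaw : WalkExpLaw Pw J e) {n : ℕ} (hn : 0 < n) (j : ℕ) {y : ℝ} (hy : 0 ≤ y) :
    Pw.real {ω' | y < e n j ω'} ≤ Real.exp (-y) := by
  have h1 := path_exp hJmeas hemeas hlaw n j Set.univ (fun _ => 0) (fun _ => le_rfl)
  have h2 := path_exp hJmeas hemeas hlaw n j Set.univ (fun k => if k = Fin.last j then y else 0)
    (fun k => by split_ifs <;> simp [hy])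
  simp only [Set.indicator_univ, Pi.one_apply, mul_one, sum_wt n j hn, Set.mem_univ, true_and,
    Finset.sum_const_zero, neg_zero, Real.exp_zero, Finset.sum_ite_eq', Finset.mem_univ, if_true,
    one_mul] at h1 h2
  have hm : MeasurableSet {ω' | ∀ k : Fin (j + 1), 0 < e n k ω'} := by
    have h : {ω' | ∀ k : Fin (j + 1), 0 < e n k ω'} = ⋂ k : Fin (j + 1), {ω' | 0 < e n k ω'} := by
      ext; simp
    rw [h]
    exact MeasurableSet.iInter fun k => measurableSet_lt measurable_const (hemeas n k)
  have h3 : Pw.real {ω' | ∀ k : Fin (j + 1), 0 < e n k ω'}ᶜ = 0 := by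
    rw [measureReal_compl hm, h1]; simp
  have hsub : {ω' | y < e n j ω'} ⊆ {ω' | ∀ k : Fin (j + 1), (if k = Fin.last j then y else 0) < e n k ω'} ∪
      {ω' | ∀ k : Fin (j + 1), 0 < e n k ω'}ᶜ := by
    intro ω' hω
    by_cases h : ∀ k : Fin (j + 1), 0 < e n k ω'
    · left
      intro k
      split_ifs with hk
      · rw [hk]; simpa using hω
      · exact h k
    · right; exact h
  refine (measureReal_mono hsub (measure_ne_top _ _)).trans ((measureReal_union_le _ _).trans ?_)
  rw [h3, h2, add_zero]

/-- the event in `nuSum` -/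
def Ev (J : (n : ℕ) → ℕ → Ω' → V n) (e : ℕ → ℕ → Ω' → ℝ) (b thr : ℝ) (n : ℕ) (h : V n → ℝ) : Set Ω' :=
  {ω' | thr < ∑ j ∈ Icc 1 (θseq n), Real.exp (b * h (J n j ω')) * e n j ω'}

lemma Ev_upper (hJmeas : ∀ n i, Measurable (J n i)) (hemeas : ∀ n i, Measurable (e n i))
    (hlaw : WalkExpLaw Pw J e) {n : ℕ} (hn : 0 < n) {b thr L : ℝ} (hb : 0 < b) (h : V n → ℝ)
    (hL : Real.exp (b * L) * (3 * n ^ 3) ≤ thr) :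
    Pw.real (Ev J e b thr n h) ≤ Mx Pw (J n) (θseq n) L h + θseq n * Real.exp (-(n : ℝ)) := by
  have hn' : (0 : ℝ) < n := by exact_mod_cast hn
  have hsub : Ev J e b thr n h ⊆ {ω' | ∃ j ∈ Icc 1 (θseq n), L < h (J n j ω')} ∪
      ⋃ j ∈ Icc 1 (θseq n), {ω' | (n : ℝ) < e n j ω'} := by
    intro ω' hω
    by_contra hcon
    simp only [Set.mem_union, Set.mem_ofPred_eq, Set.mem_iUnion, not_or, not_exists, not_and, not_lt] at hcon
    obtain ⟨h1, h2⟩ := hcon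
    have h3 : ∑ j ∈ Icc 1 (θseq n), Real.exp (b * h (J n j ω')) * e n j ω' ≤
        ∑ j ∈ Icc 1 (θseq n), Real.exp (b * L) * n := by
      refine Finset.sum_le_sum fun j hj => ?_
      calc Real.exp (b * h (J n j ω')) * e n j ω' ≤ Real.exp (b * h (J n j ω')) * n := by
            gcongr
            exact h2 j hj
        _ ≤ Real.exp (b * L) * n := by
            gcongr
            exact h1 j hj
    rw [Finset.sum_const, Nat.card_Icc, nsmul_eq_mul] at h3
    have h4 : ((θseq n + 1 - 1 : ℕ) : ℝ) * (Real.exp (b * L) * n) = Real.exp (b * L) * (3 * n ^ 3) := by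
      unfold θseq; simp; ring
    rw [h4] at h3
    exact absurd hω (not_lt.2 (h3.trans hL))
  refine (measureReal_mono hsub (measure_ne_top _ _)).trans ((measureReal_union_le _ _).trans ?_)
  have h5 : Pw.real (⋃ j ∈ Icc 1 (θseq n), {ω' | (n : ℝ) < e n j ω'}) ≤ θseq n * Real.exp (-(n : ℝ)) := by
    refine (measureReal_biUnion_finset_le _ _).trans
      ((Finset.sum_le_sum fun j _ => exp_tail hJmeas hemeas hlaw hn j hn'.le).trans (le_of_eq ?_))
    rw [Finset.sum_const, Nat.card_Icc, nsmul_eq_mul]; simp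
  have h6 : Mx Pw (J n) (θseq n) L h = Pw.real {ω' | ∃ j ∈ Icc 1 (θseq n), L < h (J n j ω')} := rfl
  rw [h6]
  linarith

lemma Ev_lower (hJmeas : ∀ n i, Measurable (J n i)) (hemeas : ∀ n i, Measurable (e n i))
    (hlaw : WalkExpLaw Pw J e) {n : ℕ} (hW : WK Pw n (J n)) {b thr L : ℝ} (hb : 0 < b) (h : V n → ℝ)
    (hL : thr ≤ Real.exp (b * L) * ((n : ℝ) ^ 3)⁻¹) :
    Mx Pw (J n) (θseq n) L h * Real.exp (-((θseq n + 1) * ((n : ℝ) ^ 3)⁻¹)) ≤ Pw.real (Ev J e b thr n h) := by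
  have hn' : (0 : ℝ) < n := by exact_mod_cast hW.pos
  have h1 := path_exp hJmeas hemeas hlaw n (θseq n)
    {xs : Fin (θseq n + 1) → V n | ∃ j : Fin (θseq n + 1), 1 ≤ (j : ℕ) ∧ L < h (xs j)}
    (fun _ => ((n : ℝ) ^ 3)⁻¹) (fun _ => by positivity)
  rw [← Mx_eq hW, Finset.sum_const, Finset.card_univ, Fintype.card_fin, nsmul_eq_mul] at h1
  push_cast at h1
  rw [← h1]
  refine measureReal_mono ?_ (measure_ne_top _ _)
  rintro ω' ⟨⟨j, hj1, hj2⟩, h2⟩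
  have hpos : ∀ i ∈ Icc 1 (θseq n), 0 < e n i ω' := by
    intro i hi
    rw [Finset.mem_Icc] at hi
    have := h2 ⟨i, by omega⟩
    exact lt_trans (by positivity) this
  have hmem : (j : ℕ) ∈ Icc 1 (θseq n) := by rw [Finset.mem_Icc]; omega
  have h3 := Finset.single_le_sum (f := fun i => Real.exp (b * h (J n i ω')) * e n i ω')
    (fun i hi => mul_nonneg (Real.exp_pos _).le (hpos i hi).le) hmem
  refine lt_of_lt_of_le ?_ h3
  refine lt_of_le_of_lt hL ?_
  refine mul_lt_mul'' ?_ (h2 j) (Real.exp_pos _).le (by positivity)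
  exact Real.exp_lt_exp.2 (mul_lt_mul_of_pos_left hj2 hb)
end

-- part G2
lemma aseq_ge {c : ℝ} (hc0 : 0 < c) {n : ℕ} (hn : 0 < n) :
    Real.exp ((n : ℝ) ^ (1 - 2 * c) / 2) ≤ aseq c n := by
  have hn1 : (1 : ℝ) ≤ n := by exact_mod_cast hn
  have hg := γ_pos c hn
  unfold aseq
  rw [γ_sq_mul c hn]
  have h1 : 1 ≤ √(2 * π * n) := by
    rw [Real.one_le_sqrt]
    nlinarith [Real.pi_gt_three]
  have h2 : 1 ≤ (γseq c n)⁻¹ := by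
    rw [one_le_inv₀ hg]; unfold γseq
    exact Real.rpow_le_one_of_one_le_of_nonpos hn1 (by linarith)
  have h3 : 1 ≤ √(2 * π * n) * (γseq c n)⁻¹ := by nlinarith
  exact le_mul_of_one_le_left (Real.exp_pos _).le h3

lemma theta_div_a {c : ℝ} (hc0 : 0 < c) (hc : c < 1 / 2) :
    Tendsto (fun n : ℕ => (θseq n : ℝ) / aseq c n) atTop (nhds 0) := by
  have h := (poly_exp (a := 1 - 2 * c) (K := 1 / 2) 2 (by linarith) (by norm_num)).const_mul 3
  rw [mul_zero] at h
  refine tendsto_of_tendsto_of_tendsto_of_le_of_le' tendsto_const_nhds h ?_ ?_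
  · refine Eventually.of_forall fun n => ?_
    unfold aseq γseq; positivity
  · filter_upwards [eventually_gt_atTop 0] with n hn
    have h1 := aseq_ge hc0 hn
    have h2 : (0 : ℝ) < Real.exp ((n : ℝ) ^ (1 - 2 * c) / 2) := Real.exp_pos _
    calc (θseq n : ℝ) / aseq c n ≤ (θseq n : ℝ) / Real.exp ((n : ℝ) ^ (1 - 2 * c) / 2) := by gcongr
      _ = _ := by
        unfold θseq
        rw [div_eq_mul_inv, ← Real.exp_neg, Real.rpow_two]; push_cast
        rw [mul_assoc]; congr 4; ring

lemma a_exp {c : ℝ} (hc0 : 0 < c) (hc : c < 1 / 2) :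
    Tendsto (fun n : ℕ => aseq c n * Real.exp (-(n : ℝ))) atTop (nhds 0) := by
  have h := (poly_exp (a := 1) (K := 1 / 2) (1 / 2 + c) (by norm_num) (by norm_num)).const_mul √(2 * π)
  rw [mul_zero] at h
  refine tendsto_of_tendsto_of_tendsto_of_le_of_le' tendsto_const_nhds h ?_ ?_
  · refine Eventually.of_forall fun n => ?_
    unfold aseq γseq; positivity
  · filter_upwards [eventually_gt_atTop 0] with n hn
    have hn1 : (1 : ℝ) ≤ n := by exact_mod_cast hn
    have hn' : (0 : ℝ) < n := by linarith
    unfold aseq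
    rw [γ_sq_mul c hn, mul_assoc, ← Real.exp_add, Real.rpow_one, Real.sqrt_mul (by positivity),
      Real.sqrt_eq_rpow (n : ℝ)]
    have e1 : (γseq c n)⁻¹ = (n : ℝ) ^ c := by
      unfold γseq; rw [← Real.rpow_neg hn'.le, neg_neg]
    rw [e1, mul_assoc √(2 * π), ← Real.rpow_add hn', mul_assoc]
    have h3 : (n : ℝ) ^ (1 - 2 * c) ≤ n := by
      nth_rewrite 2 [← Real.rpow_one (n : ℝ)]
      exact Real.rpow_le_rpow_of_exponent_le hn1 (by linarith)
    gcongr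
    linarith

lemma k_tendsto {c : ℝ} (hc0 : 0 < c) (hc : c < 1 / 2) {t : ℝ} (ht : 0 < t) :
    Tendsto (fun n : ℕ => (kseq c n t : ℝ) * (θseq n / aseq c n)) atTop (nhds t) ∧
    ∀ n, 0 < n → (kseq c n t : ℝ) * θseq n ≤ aseq c n * t := by
  have hup : ∀ n, 0 < n → (kseq c n t : ℝ) * θseq n ≤ aseq c n * t := by
    intro n hn
    have ha : 0 ≤ aseq c n * t := by unfold aseq γseq; positivity
    have h1 : kseq c n t * θseq n ≤ ⌊aseq c n * t⌋₊ := Nat.div_mul_le_self _ _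
    have h2 : (kseq c n t : ℝ) * θseq n ≤ (⌊aseq c n * t⌋₊ : ℝ) := by exact_mod_cast h1
    exact h2.trans (Nat.floor_le ha)
  refine ⟨?_, hup⟩
  have h0 := theta_div_a hc0 hc
  have hlow : Tendsto (fun n : ℕ => t - 2 * ((θseq n : ℝ) / aseq c n)) atTop (nhds t) := by
    have := (h0.const_mul 2).const_sub t
    simpa using this
  refine tendsto_of_tendsto_of_tendsto_of_le_of_le' hlow tendsto_const_nhds ?_ ?_
  · filter_upwards [eventually_gt_atTop 0] with n hn
    have ha : 0 < aseq c n := (Real.exp_pos _).trans_le (aseq_ge hc0 hn)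
    have hθ : 0 < θseq n := by unfold θseq; positivity
    have hθ1 : (1 : ℝ) ≤ θseq n := by exact_mod_cast hθ
    have h1 : ⌊aseq c n * t⌋₊ < (kseq c n t + 1) * θseq n := by
      have := Nat.lt_succ_iff.2 (le_refl (⌊aseq c n * t⌋₊ / θseq n))
      exact (Nat.div_lt_iff_lt_mul hθ).1 this
    have h2 : (⌊aseq c n * t⌋₊ : ℝ) ≤ (kseq c n t + 1) * θseq n := by exact_mod_cast h1.le
    have h3 := Nat.lt_floor_add_one (aseq c n * t)
    have h4 : aseq c n * t ≤ kseq c n t * θseq n + 2 * θseq n := by nlinarith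
    rw [← mul_div_assoc, ← mul_div_assoc, sub_le_iff_le_add, ← add_div, le_div_iff₀ ha]
    linarith
  · filter_upwards [eventually_gt_atTop 0] with n hn
    have ha : 0 < aseq c n := (Real.exp_pos _).trans_le (aseq_ge hc0 hn)
    rw [← mul_div_assoc, div_le_iff₀ ha, mul_comm t]
    exact hup n hn

lemma γ_log {c : ℝ} (hc0 : 0 < c) :
    Tendsto (fun n : ℕ => γseq c n * Real.log (3 * (n : ℝ) ^ 3)) atTop (nhds 0) := by
  have h1 : Tendsto (fun x : ℝ => Real.log x / x ^ c) atTop (nhds 0) :=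
    (isLittleO_log_rpow_atTop hc0).tendsto_div_nhds_zero
  have h2 := ((h1.comp tendsto_natCast_atTop_atTop).const_mul 3).add ((γ_tendsto hc0).mul_const (Real.log 3))
  simp only [mul_zero, zero_mul, add_zero] at h2
  refine h2.congr' ?_
  filter_upwards [eventually_gt_atTop 0] with n hn
  have hn' : (0 : ℝ) < n := by exact_mod_cast hn
  simp only [Function.comp]
  rw [Real.log_mul (by norm_num) (by positivity), Real.log_pow]
  unfold γseq
  rw [Real.rpow_neg hn'.le]
  push_cast
  field_simp
  ring

lemma θ_cube : Tendsto (fun n : ℕ => Real.exp (-(((θseq n : ℝ) + 1) * ((n : ℝ) ^ 3)⁻¹))) atTop (nhds 1) := by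
  have h1 : Tendsto (fun n : ℕ => ((n : ℝ))⁻¹) atTop (nhds 0) := tendsto_inv_atTop_nhds_zero_nat
  have h2 : Tendsto (fun n : ℕ => -(3 * (n : ℝ)⁻¹ + (n : ℝ)⁻¹ ^ 3)) atTop (nhds 0) := by
    have := ((h1.const_mul 3).add (h1.pow 3)).neg
    simpa using this
  have h3 := (Real.continuous_exp.tendsto 0).comp h2
  rw [Real.exp_zero] at h3
  refine h3.congr' ?_
  filter_upwards [eventually_gt_atTop 0] with n hn
  have hn' : (0 : ℝ) < n := by exact_mod_cast hn
  simp only [Function.comp, θseq]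
  congr 1; push_cast; field_simp

lemma Mx_anti {Ω' : Type*} [MeasurableSpace Ω'] (Pw : Measure Ω') [IsProbabilityMeasure Pw] {n : ℕ}
    (J : ℕ → Ω' → V n) (θ : ℕ) {L L' : ℝ} (hL : L ≤ L') (h : V n → ℝ) : Mx Pw J θ L' h ≤ Mx Pw J θ L h := by
  unfold Mx
  refine measureReal_mono ?_ (measure_ne_top _ _)
  rintro ω' ⟨j, hj, hj2⟩
  exact ⟨j, hj, lt_of_le_of_lt hL hj2⟩

lemma thr_eq (c : ℝ) (β : ℕ → ℝ) (n : ℕ) {u : ℝ} (hu : 0 < u) :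
    cseq c β n * u ^ (β n / γseq c n) = Real.exp (β n * Lf c (Real.log u) n) := by
  unfold cseq Lf
  rw [Real.rpow_def_of_pos hu, ← Real.exp_add]
  congr 1; ring

section
variable {Ω' : Type*} [MeasurableSpace Ω'] {Pw : Measure Ω'} [IsProbabilityMeasure Pw]
    {J : (n : ℕ) → ℕ → Ω' → V n} {e : ℕ → ℕ → Ω' → ℝ}

lemma nu_lim {p : ℕ} {c : ℝ} (hc0 : 0 < c) (hc : c < 1 / 2) {β : ℕ → ℝ} {β₀ : ℝ} (hβ₀ : 0 < β₀)
    (hβ : ∀ n : ℕ, β₀ ≤ β n)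
    (hJmeas : ∀ n i, Measurable (J n i)) (hemeas : ∀ n i, Measurable (e n i))
    (hlaw : WalkExpLaw Pw J e) (h : (n : ℕ) → V n → ℝ)
    (hlim : ∀ w : ℝ, Tendsto (fun n : ℕ =>
      aseq c n / θseq n * Mx Pw (J n) (θseq n) (Lf c w n) (h n)) atTop
      (nhds (2 * p * Real.exp (-w)))) {u t : ℝ} (hu : 0 < u) (ht : 0 < t) :
    Tendsto (fun n => nuSum Pw J e c β n t u (h n)) atTop (nhds (2 * p * t / u)) := by
  obtain ⟨hk, hk2⟩ := k_tendsto hc0 hc ht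
  have hnu : ∀ n, nuSum Pw J e c β n t u (h n) = kseq c n t *
      Pw.real (Ev J e (β n) (Real.exp (β n * Lf c (Real.log u) n)) n (h n)) := by
    intro n; unfold nuSum; rw [thr_eq c β n hu]; rfl
  have hid : ∀ n, 0 < n → ∀ X : ℝ, (kseq c n t : ℝ) * X =
      (kseq c n t : ℝ) * (θseq n / aseq c n) * (aseq c n / θseq n * X) := by
    intro n hn X
    have ha : 0 < aseq c n := (Real.exp_pos _).trans_le (aseq_ge hc0 hn)
    have hθ : (0 : ℝ) < θseq n := by unfold θseq; push_cast; positivity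
    field_simp
  have hup : ∀ ε > 0, ∀ᶠ n in atTop, nuSum Pw J e c β n t u (h n) ≤
      (kseq c n t : ℝ) * (θseq n / aseq c n) * (aseq c n / θseq n *
        Mx Pw (J n) (θseq n) (Lf c (Real.log u - ε) n) (h n)) + t * (aseq c n * Real.exp (-(n : ℝ))) := by
    intro ε hε
    filter_upwards [eventually_gt_atTop 0,
      (γ_log hc0).eventually (ge_mem_nhds (show 0 < ε * β₀ by positivity))] with n hn hγ
    have hn' : (0 : ℝ) < n := by exact_mod_cast hn
    have hg := γ_pos c hn
    have hb : 0 < β n := hβ₀.trans_le (hβ n)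
    have h1 : β n * Lf c (Real.log u - ε) n + Real.log (3 * (n : ℝ) ^ 3) ≤ β n * Lf c (Real.log u) n := by
      have e1 : Lf c (Real.log u - ε) n = Lf c (Real.log u) n - ε / γseq c n := by unfold Lf; ring
      have e2 : Real.log (3 * (n : ℝ) ^ 3) ≤ β n * (ε / γseq c n) := by
        rw [← mul_div_assoc, le_div_iff₀ hg, mul_comm]
        exact hγ.trans (by rw [mul_comm]; gcongr; exact hβ n)
      rw [e1, mul_sub]; linarith
    have h2 := Ev_upper hJmeas hemeas hlaw hn hb (h n) (L := Lf c (Real.log u - ε) n)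
      (thr := Real.exp (β n * Lf c (Real.log u) n)) (by
        rw [← Real.exp_log (show (0 : ℝ) < 3 * n ^ 3 by positivity), ← Real.exp_add]
        exact Real.exp_le_exp.2 h1)
    rw [hnu, ← hid n hn]
    have h3 := mul_le_mul_of_nonneg_left h2 (Nat.cast_nonneg (kseq c n t) : (0 : ℝ) ≤ _)
    have h4 := mul_le_mul_of_nonneg_right (hk2 n hn) (Real.exp_pos (-(n : ℝ))).le
    linarith
  have hlo : ∀ ε > 0, ∀ᶠ n in atTop, (kseq c n t : ℝ) * (θseq n / aseq c n) * (aseq c n / θseq n *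
        Mx Pw (J n) (θseq n) (Lf c (Real.log u + ε) n) (h n)) *
        Real.exp (-(((θseq n : ℝ) + 1) * ((n : ℝ) ^ 3)⁻¹)) ≤ nuSum Pw J e c β n t u (h n) := by
    intro ε hε
    filter_upwards [eventually_gt_atTop 0,
      (γ_log hc0).eventually (ge_mem_nhds (show 0 < ε * β₀ by positivity))] with n hn hγ
    have hn' : (0 : ℝ) < n := by exact_mod_cast hn
    have hg := γ_pos c hn
    have hb : 0 < β n := hβ₀.trans_le (hβ n)
    have h1 : β n * Lf c (Real.log u) n ≤ β n * Lf c (Real.log u + ε) n - Real.log ((n : ℝ) ^ 3) := by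
      have e1 : Lf c (Real.log u + ε) n = Lf c (Real.log u) n + ε / γseq c n := by unfold Lf; ring
      have e2 : Real.log (3 * (n : ℝ) ^ 3) ≤ β n * (ε / γseq c n) := by
        rw [← mul_div_assoc, le_div_iff₀ hg, mul_comm]
        exact hγ.trans (by rw [mul_comm]; gcongr; exact hβ n)
      have e3 : Real.log ((n : ℝ) ^ 3) ≤ Real.log (3 * (n : ℝ) ^ 3) :=
        Real.log_le_log (by positivity) (by linarith [pow_pos hn' 3])
      rw [e1, mul_add]; linarith
    have h2 := Ev_lower hJmeas hemeas hlaw (WK_of_law Pw J e hJmeas hemeas hlaw n hn) hb (h n)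
      (L := Lf c (Real.log u + ε) n) (thr := Real.exp (β n * Lf c (Real.log u) n)) (by
        rw [← Real.exp_log (show (0 : ℝ) < n ^ 3 by positivity), ← Real.exp_neg, ← Real.exp_add]
        exact Real.exp_le_exp.2 h1)
    rw [hnu, ← hid n hn, mul_assoc]
    exact mul_le_mul_of_nonneg_left h2 (Nat.cast_nonneg _)
  have hval : 2 * p * t / u = t * (2 * p * Real.exp (-Real.log u)) := by
    rw [Real.exp_neg, Real.exp_log hu]; field_simp
  have hcont : Continuous (fun z : ℝ => t * (2 * p * Real.exp (-z))) := by fun_prop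
  rw [hval, tendsto_order]
  constructor
  · intro b hb
    obtain ⟨r, hr, hr2⟩ := Metric.eventually_nhds_iff.1 (hcont.continuousAt.eventually (lt_mem_nhds hb))
    have hb3 : b < t * (2 * p * Real.exp (-(Real.log u + r / 2))) := hr2 (by
      rw [Real.dist_eq, add_sub_cancel_left, abs_of_pos (by linarith)]; linarith)
    have hT := (hk.mul (hlim (Real.log u + r / 2))).mul θ_cube
    rw [mul_one] at hT
    filter_upwards [hlo (r / 2) (by linarith), hT.eventually (lt_mem_nhds hb3)] with n h1 h2
    exact lt_of_lt_of_le h2 h1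
  · intro b hb
    obtain ⟨r, hr, hr2⟩ := Metric.eventually_nhds_iff.1 (hcont.continuousAt.eventually (gt_mem_nhds hb))
    have hb3 : t * (2 * p * Real.exp (-(Real.log u - r / 2))) < b := hr2 (by
      rw [Real.dist_eq, abs_of_neg (by linarith)]; linarith)
    have hT := (hk.mul (hlim (Real.log u - r / 2))).add ((a_exp hc0 hc).const_mul t)
    rw [mul_zero, add_zero] at hT
    filter_upwards [hup (r / 2) (by linarith), hT.eventually (gt_mem_nhds hb3)] with n h1 h2
    exact lt_of_le_of_lt h1 h2
end

/-- Almost-sure convergence of the intensity (quenched version of Condition (2-1)):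
if `p > 5` and `c ∈ (0,1/2)`, or `p = 5` and `c ∈ (0,1/4)`, then ℙ-almost surely in the
environment, `ν_n^t(u,∞) → 2p·t·u⁻¹` for every `u > 0` and `t > 0`. -/
theorem nu_tendsto_almost_surely
    (p : ℕ) (c : ℝ)
    (hpc : (5 < p ∧ 0 < c ∧ c < 1 / 2) ∨ (p = 5 ∧ 0 < c ∧ c < 1 / 4))
    (β : ℕ → ℝ) (β₀ : ℝ) (hβ₀ : 0 < β₀) (hβ : ∀ n : ℕ, β₀ ≤ β n)
    (B : ℝ) (hB : ∀ n : ℕ, γseq c n * β n ≤ B)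
    {Ω : Type*} [MeasurableSpace Ω] (Pe : Measure Ω) [IsProbabilityMeasure Pe]
    (H : (n : ℕ) → V n → Ω → ℝ) (hHmeas : ∀ n x, Measurable (H n x))
    (hH : ∀ n : ℕ, IsCenteredGaussianVector Pe (H n)
      (fun x y => (n : ℝ) * overlap n x y ^ p))
    {Ω' : Type*} [MeasurableSpace Ω'] (Pw : Measure Ω') [IsProbabilityMeasure Pw]
    (J : (n : ℕ) → ℕ → Ω' → V n) (e : ℕ → ℕ → Ω' → ℝ)
    (hJmeas : ∀ n i, Measurable (J n i)) (hemeas : ∀ n i, Measurable (e n i))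
    (hlaw : WalkExpLaw Pw J e) :
    ∀ᵐ ω ∂Pe, ∀ u : ℝ, 0 < u → ∀ t : ℝ, 0 < t →
      Tendsto (fun n => nuSum Pw J e c β n t u (fun x => H n x ω))
        atTop (nhds (2 * p * t / u)) := by
  have hp5 : 5 ≤ p := by rcases hpc with h | h <;> omega
  have hc0 : 0 < c := by
    rcases hpc with h | h
    exacts [h.2.1, h.2.1]
  have hc : c < 1 / 2 := by
    rcases hpc with h | h
    · exact h.2.2
    · linarith [h.2.2]
  have hpc' : 2 + 2 * c < (p : ℝ) / 2 := by
    rcases hpc with h | h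
    · have : (6 : ℝ) ≤ p := by exact_mod_cast h.1
      linarith [h.2.2]
    · rw [h.1]; push_cast; linarith [h.2.2]
  filter_upwards [as_Mx hp5 hc0 hc hpc' (fun n => env_GV Pe p H hHmeas hH n)
    (fun n hn => WK_of_law Pw J e hJmeas hemeas hlaw n hn)] with ω hω u hu t ht
  exact nu_lim hc0 hc hβ₀ hβ hJmeas hemeas hlaw (fun n x => H n x ω) hω hu ht
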